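/- Let k be a real number with |k| < 4 and let s be a complex number with Re(s) > −1 that is not an odd integer. Then W₂(k;s) = (1/(2π)) · (tan(πs/2)/(s+1)) · |k|^{1+s} · ₃F₂(1/2, 1/2, 1/2; 1 + s/2, 3/2 + s/2; k²/16) + (Γ(s+1)²/Γ(s/2+1)⁴) · ₃F₂(−s/2, −s/2, −s/2; (1−s)/2, 1/2; k²/16), where both hypergeometric series converge since k²/16 < 1, |k|^{1+s} := exp((1+s)·log|k|) for k ≠ 0 and := 0 for k = 0, and tan denotes the complex tangent. -/

import Mathlib

open MeasureTheory Real

/-- `t ^ s` for real `t ≥ 0` and complex `s`, with `0 ^ s := 0`. -/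
noncomputable def cpow0 (t : ℝ) (s : ℂ) : ℂ :=
  if t = 0 then 0 else Complex.exp (s * Real.log t)

/-- Pochhammer symbol `(x)ₙ = x (x+1) ⋯ (x+n-1)` in `ℂ`. -/
noncomputable def poch (x : ℂ) (n : ℕ) : ℂ := (ascPochhammer ℂ n).eval x

/-- The zeta Mahler function
`W_r(k;s) = (2π)^{−r} ∫_{[0,2π]^r} |k + ∏ᵢ 2 cos θᵢ|^s dθ₁⋯dθ_r`. -/
noncomputable def Wr (r : ℕ) (k : ℝ) (s : ℂ) : ℂ :=
  ((2 * π : ℝ) : ℂ)⁻¹ ^ r *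
    ∫ θ : Fin r → ℝ in Set.univ.pi fun _ => Set.Icc 0 (2 * π),
      cpow0 |k + ∏ i, 2 * Real.cos (θ i)| s

/-- The generalized hypergeometric series `₃F₂(a₁,a₂,a₃; b₁,b₂; z)`. -/
noncomputable def hyp3F2 (a1 a2 a3 b1 b2 z : ℂ) : ℂ :=
  ∑' n : ℕ, poch a1 n * poch a2 n * poch a3 n /
    (poch b1 n * poch b2 n * (n.factorial : ℂ)) * z ^ n

/-- `|y| ^ s`, an even function of `y`. -/
noncomputable def evenPow (s : ℂ) (y : ℝ) : ℂ := cpow0 |y| s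

/-- `sign y * |y| ^ s`, an odd function of `y`. -/
noncomputable def oddPow (s : ℂ) (y : ℝ) : ℂ := (y : ℂ) * evenPow (s - 1) y

lemma evenPow_zero (s : ℂ) : evenPow s 0 = 0 := by simp [evenPow, cpow0]

lemma oddPow_zero (s : ℂ) : oddPow s 0 = 0 := by simp [oddPow]

lemma evenPow_of_ne {y : ℝ} (hy : y ≠ 0) (s : ℂ) :
    evenPow s y = Complex.exp (s * Real.log y) := by
  simp [evenPow, cpow0, hy]

lemma evenPow_neg (s : ℂ) (y : ℝ) : evenPow s (-y) = evenPow s y := by simp [evenPow]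

lemma oddPow_neg (s : ℂ) (y : ℝ) : oddPow s (-y) = -oddPow s y := by
  simp [oddPow, evenPow_neg]

lemma evenPow_abs (s : ℂ) (y : ℝ) : evenPow s |y| = evenPow s y := by simp [evenPow]

lemma evenPow_add {y : ℝ} (hy : y ≠ 0) (s t : ℂ) :
    evenPow (s + t) y = evenPow s y * evenPow t y := by
  simp only [evenPow_of_ne hy, ← Complex.exp_add]; ring_nf

lemma evenPow_two {y : ℝ} (hy : y ≠ 0) : evenPow 2 y = (y : ℂ) ^ 2 := by
  rw [evenPow_of_ne hy]
  have : (2 : ℂ) * (Real.log y : ℂ) = ((2 * Real.log y : ℝ) : ℂ) := by push_cast; ring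
  rw [this, ← Complex.ofReal_exp, two_mul, Real.exp_add, Real.exp_log_eq_abs hy, abs_mul_abs_self]
  push_cast; ring

lemma evenPow_natCast {y : ℝ} (hy : 0 < y) (n : ℕ) : evenPow n y = (y : ℂ) ^ n := by
  rw [evenPow_of_ne hy.ne', Complex.exp_nat_mul, ← Complex.ofReal_exp, Real.exp_log hy]

lemma evenPow_exp_zero {y : ℝ} (hy : y ≠ 0) : evenPow 0 y = 1 := by simp [evenPow_of_ne hy]

lemma evenPow_mul (s : ℂ) (a y : ℝ) : evenPow s (a * y) = evenPow s a * evenPow s y := by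
  rcases eq_or_ne a 0 with rfl | ha
  · simp [evenPow_zero]
  rcases eq_or_ne y 0 with rfl | hy
  · simp [evenPow_zero]
  rw [evenPow_of_ne ha, evenPow_of_ne hy, evenPow_of_ne (mul_ne_zero ha hy),
    Real.log_mul ha hy, ← Complex.exp_add]
  push_cast; ring_nf

lemma oddPow_of_pos {y : ℝ} (hy : 0 < y) (s : ℂ) : oddPow s y = evenPow s y := by
  have h := evenPow_add hy.ne' (s - 1) (1 : ℕ)
  rw [evenPow_natCast hy] at h
  rw [oddPow, mul_comm]
  simpa using h.symm

lemma mul_oddPow (s : ℂ) (y : ℝ) : (y : ℂ) * oddPow s y = evenPow (s + 1) y := by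
  rcases eq_or_ne y 0 with rfl | hy
  · simp [evenPow_zero]
  have h := evenPow_add hy (s - 1) 2
  rw [evenPow_two hy] at h
  rw [oddPow, show s + 1 = s - 1 + 2 by ring, h]; ring

lemma mul_evenPow (s : ℂ) (y : ℝ) : (y : ℂ) * evenPow s y = oddPow (s + 1) y := by
  simp [oddPow]

lemma norm_evenPow_of_ne {y : ℝ} (hy : y ≠ 0) (s : ℂ) : ‖evenPow s y‖ = |y| ^ s.re := by
  rw [evenPow_of_ne hy, Complex.norm_exp, Complex.re_mul_ofReal,
    Real.rpow_def_of_pos (abs_pos.2 hy), Real.log_abs, mul_comm]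

lemma norm_evenPow_le (s : ℂ) (y : ℝ) : ‖evenPow s y‖ ≤ |y| ^ s.re := by
  rcases eq_or_ne y 0 with rfl | hy
  · simp only [evenPow_zero, norm_zero]; positivity
  · exact (norm_evenPow_of_ne hy s).le

lemma norm_oddPow_of_ne {y : ℝ} (hy : y ≠ 0) (s : ℂ) : ‖oddPow s y‖ = |y| ^ s.re := by
  rw [oddPow, norm_mul, norm_evenPow_of_ne hy, Complex.norm_real, Real.norm_eq_abs,
    Complex.sub_re, Complex.one_re, Real.rpow_sub_one (abs_ne_zero.2 hy)]
  field_simp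

lemma norm_oddPow_le (s : ℂ) (y : ℝ) : ‖oddPow s y‖ ≤ |y| ^ s.re := by
  rcases eq_or_ne y 0 with rfl | hy
  · simp only [oddPow_zero, norm_zero]; positivity
  · exact (norm_oddPow_of_ne hy s).le

lemma measurable_evenPow (s : ℂ) : Measurable (evenPow s) := by
  unfold evenPow cpow0
  refine Measurable.ite ?_ measurable_const (by fun_prop)
  exact measurableSet_eq_fun (by fun_prop) measurable_const

lemma measurable_oddPow (s : ℂ) : Measurable (oddPow s) := by
  unfold oddPow
  exact (Complex.measurable_ofReal).mul (measurable_evenPow _)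

lemma hasDerivAt_evenPow_of_ne {y : ℝ} (hy : y ≠ 0) (s : ℂ) :
    HasDerivAt (evenPow s) (s * oddPow (s - 1) y) y := by
  have h1 : HasDerivAt (fun y : ℝ => Complex.exp (s * Real.log y))
      (Complex.exp (s * Real.log y) * (s * ((y⁻¹ : ℝ) : ℂ))) y :=
    (((Real.hasDerivAt_log hy).ofReal_comp).const_mul s).cexp
  have h2 : evenPow s =ᶠ[nhds y] fun y : ℝ => Complex.exp (s * Real.log y) := by
    filter_upwards [isOpen_ne.mem_nhds hy] with z hz using evenPow_of_ne hz s
  refine (h1.congr_of_eventuallyEq h2).congr_deriv ?_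
  have h3 : evenPow s y = y * oddPow (s - 1) y := by rw [mul_oddPow]; simp
  have hyc : (y : ℂ) ≠ 0 := by exact_mod_cast hy
  rw [← evenPow_of_ne hy, h3]
  push_cast; field_simp

lemma hasDerivAt_zero_of_norm_le {f : ℝ → ℂ} {r : ℝ} (hr : 1 < r)
    (hf : ∀ y, ‖f y‖ ≤ |y| ^ r) : HasDerivAt f 0 0 := by
  have h0 : f 0 = 0 := by
    have := hf 0
    rw [abs_zero, Real.zero_rpow (by linarith)] at this
    exact norm_le_zero_iff.1 this
  rw [hasDerivAt_iff_isLittleO]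
  simp only [h0, sub_zero, smul_zero]
  rw [Asymptotics.isLittleO_iff]
  intro c hc
  have ht : Filter.Tendsto (fun y : ℝ => |y| ^ (r - 1)) (nhds 0) (nhds 0) := by
    have h := (continuous_abs.rpow_const (p := r - 1) (fun _ => Or.inr (by linarith))).tendsto (0 : ℝ)
    simpa [Real.zero_rpow (by linarith : r - 1 ≠ 0)] using h
  filter_upwards [ht.eventually (gt_mem_nhds hc)] with y hy
  rcases eq_or_ne y 0 with rfl | hy0
  · simp [h0]
  · refine (hf y).trans ?_
    have h1 : |y| ^ r = |y| ^ (r - 1) * |y| := by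
      rw [← Real.rpow_add_one (abs_ne_zero.2 hy0)]; ring_nf
    rw [h1, Real.norm_eq_abs]
    exact mul_le_mul_of_nonneg_right hy.le (abs_nonneg _)

lemma hasDerivAt_evenPow {s : ℂ} (hs : 1 < s.re) (y : ℝ) :
    HasDerivAt (evenPow s) (s * oddPow (s - 1) y) y := by
  rcases eq_or_ne y 0 with rfl | hy
  · simpa [oddPow_zero] using hasDerivAt_zero_of_norm_le hs (norm_evenPow_le s)
  · exact hasDerivAt_evenPow_of_ne hy s

lemma hasDerivAt_oddPow_of_ne {y : ℝ} (hy : y ≠ 0) (s : ℂ) :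
    HasDerivAt (oddPow s) (s * evenPow (s - 1) y) y := by
  have h := (Complex.ofRealCLM.hasDerivAt (x := y)).mul (hasDerivAt_evenPow_of_ne hy (s - 1))
  refine h.congr_deriv ?_
  have : (y : ℂ) * oddPow (s - 1 - 1) y = evenPow (s - 1) y := by rw [mul_oddPow]; ring_nf
  simp only [Complex.ofRealCLM_apply, Complex.ofReal_one]
  linear_combination (s - 1) * this

lemma hasDerivAt_oddPow {s : ℂ} (hs : 1 < s.re) (y : ℝ) :
    HasDerivAt (oddPow s) (s * evenPow (s - 1) y) y := by
  rcases eq_or_ne y 0 with rfl | hy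
  · simpa [evenPow_zero] using hasDerivAt_zero_of_norm_le hs (norm_oddPow_le s)
  · exact hasDerivAt_oddPow_of_ne hy s

lemma continuousAt_zero_of_norm_le {f : ℝ → ℂ} {r : ℝ} (hr : 0 < r)
    (hf : ∀ y, ‖f y‖ ≤ |y| ^ r) : ContinuousAt f 0 := by
  have h0 : f 0 = 0 := by
    have := hf 0
    rw [abs_zero, Real.zero_rpow (by linarith)] at this
    exact norm_le_zero_iff.1 this
  rw [ContinuousAt, h0]
  have ht : Filter.Tendsto (fun y : ℝ => |y| ^ r) (nhds 0) (nhds 0) := by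
    have h := (continuous_abs.rpow_const (p := r) (fun _ => Or.inr hr.le)).tendsto (0 : ℝ)
    simpa [Real.zero_rpow hr.ne'] using h
  exact squeeze_zero_norm hf ht

lemma continuous_evenPow {s : ℂ} (hs : 0 < s.re) : Continuous (evenPow s) := by
  rw [continuous_iff_continuousAt]
  intro y
  rcases eq_or_ne y 0 with rfl | hy
  · exact continuousAt_zero_of_norm_le hs (norm_evenPow_le s)
  · exact (hasDerivAt_evenPow_of_ne hy s).continuousAt

lemma continuous_oddPow {s : ℂ} (hs : 0 < s.re) : Continuous (oddPow s) := by
  rw [continuous_iff_continuousAt]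
  intro y
  rcases eq_or_ne y 0 with rfl | hy
  · exact continuousAt_zero_of_norm_le hs (norm_oddPow_le s)
  · exact (hasDerivAt_oddPow_of_ne hy s).continuousAt

/-- The law of `cos θ` for `θ` uniform on `[0, 2π]`. -/
noncomputable def arcLaw : Measure ℝ :=
  Measure.map Real.cos ((ENNReal.ofReal (2 * π))⁻¹ • volume.restrict (Set.Ioc 0 (2 * π)))

instance : IsProbabilityMeasure arcLaw := by
  unfold arcLaw
  have : IsProbabilityMeasure
      ((ENNReal.ofReal (2 * π))⁻¹ • (volume.restrict (Set.Ioc 0 (2 * π)) : Measure ℝ)) := by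
    constructor
    have h : ENNReal.ofReal (2 * π) ≠ 0 := by simp [Real.pi_pos]
    simp [Real.volume_Ioc]
    simp only [ENNReal.ofReal_mul zero_le_two, ENNReal.ofReal_ofNat] at h
    exact ENNReal.inv_mul_cancel h (ENNReal.mul_ne_top (by simp) (by simp))
  exact Measure.isProbabilityMeasure_map Real.continuous_cos.aemeasurable

lemma integral_arcLaw {g : ℝ → ℂ} (hg : Measurable g) :
    ∫ c, g c ∂arcLaw = (((2 * π : ℝ) : ℂ))⁻¹ * ∫ θ in (0 : ℝ)..2 * π, g (Real.cos θ) := by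
  rw [arcLaw, integral_map Real.continuous_cos.aemeasurable hg.aestronglyMeasurable,
    integral_smul_measure, intervalIntegral.integral_of_le (by positivity)]
  simp only [ENNReal.toReal_inv, ENNReal.toReal_ofReal (by positivity : 0 ≤ 2 * π)]
  rw [← Complex.ofReal_inv, Complex.real_smul]

lemma integrable_arcLaw {g : ℝ → ℂ} (hg : Measurable g)
    (h : IntervalIntegrable (fun θ => g (Real.cos θ)) volume 0 (2 * π)) :
    Integrable g arcLaw := by
  rw [arcLaw, integrable_map_measure hg.aestronglyMeasurable Real.continuous_cos.aemeasurable]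
  refine Integrable.smul_measure ?_ (by simp [Real.pi_pos])
  exact (intervalIntegrable_iff_integrableOn_Ioc_of_le (by positivity)).1 h

lemma ae_arcLaw : ∀ᵐ c ∂arcLaw, c ∈ Set.Icc (-1 : ℝ) 1 := by
  refine (ae_map_iff (p := fun c => c ∈ Set.Icc (-1 : ℝ) 1) Real.continuous_cos.aemeasurable
    measurableSet_Icc).2 ?_
  exact Filter.Eventually.of_forall fun θ => ⟨Real.neg_one_le_cos θ, Real.cos_le_one θ⟩

lemma map_neg_arcLaw : arcLaw.map (fun c => -c) = arcLaw := by
  have : IsFiniteMeasure (arcLaw.map (fun c : ℝ => -c)) :=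
    Measure.isFiniteMeasure_map arcLaw _
  refine ext_of_forall_integral_eq_of_IsFiniteMeasure fun f => ?_
  rw [integral_map (by fun_prop) f.continuous.aestronglyMeasurable]
  have key : ∀ g : ℝ → ℝ, Continuous g → ((∫ c, g c ∂arcLaw : ℝ) : ℂ) =
      (((2 * π : ℝ) : ℂ))⁻¹ * ∫ θ in (0 : ℝ)..2 * π, (g (Real.cos θ) : ℂ) := by
    intro g hg
    rw [← integral_arcLaw (g := fun c => (g c : ℂ)) (by fun_prop), ← integral_complex_ofReal]
  have h2 := key (fun c => f (-c)) (by fun_prop)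
  have h1 := key (fun c => f c) (by fun_prop)
  have h3 : ∫ θ in (0 : ℝ)..2 * π, (f (-Real.cos θ) : ℂ) =
      ∫ θ in (0 : ℝ)..2 * π, (f (Real.cos θ) : ℂ) := by
    have hp : Function.Periodic (fun θ => (f (Real.cos θ) : ℂ)) (2 * π) := fun θ => by simp
    have h4 := hp.intervalIntegral_add_eq π 0
    rw [zero_add] at h4
    rw [← h4]
    have h5 := intervalIntegral.integral_comp_add_right (a := 0) (b := 2 * π)
      (fun θ => (f (Real.cos θ) : ℂ)) π
    simp only [Real.cos_add_pi] at h5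
    rw [h5]
    congr 1 <;> ring
  rw [h3, ← h1] at h2
  exact_mod_cast h2

/-- Integration by parts against the law of a cosine. -/
lemma integral_deriv_arcLaw {G G' : ℝ → ℂ} (hG : ∀ c, HasDerivAt G (G' c) c)
    (hG' : Continuous G') :
    ∫ c, G' c ∂arcLaw = ∫ c, ((c : ℂ) * G c + (c : ℂ) ^ 2 * G' c) ∂arcLaw := by
  have hGc : Continuous G := continuous_iff_continuousAt.2 fun c => (hG c).continuousAt
  have hm1 : Continuous fun c : ℝ => (c : ℂ) * G c + (c : ℂ) ^ 2 * G' c := by fun_prop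
  rw [integral_arcLaw hG'.measurable, integral_arcLaw hm1.measurable]
  congr 1
  rw [← sub_eq_zero, ← intervalIntegral.integral_sub
    (Continuous.intervalIntegrable (by fun_prop) _ _)
    (Continuous.intervalIntegrable (by fun_prop) _ _)]
  have hd : ∀ θ ∈ Set.uIcc 0 (2 * π), HasDerivAt
      (fun θ : ℝ => -((Real.sin θ : ℂ) * G (Real.cos θ)))
      (G' (Real.cos θ) - ((Real.cos θ : ℂ) * G (Real.cos θ)
        + (Real.cos θ : ℂ) ^ 2 * G' (Real.cos θ))) θ := by
    intro θ _
    have h1 : HasDerivAt (fun θ : ℝ => (Real.sin θ : ℂ)) (Real.cos θ : ℂ) θ :=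
      (Real.hasDerivAt_sin θ).ofReal_comp
    have h2 := (hG (Real.cos θ)).scomp θ (Real.hasDerivAt_cos θ)
    refine (h1.mul h2).neg.congr_deriv ?_
    have h3 : (Real.sin θ : ℂ) ^ 2 + (Real.cos θ : ℂ) ^ 2 = 1 := by
      exact_mod_cast Real.sin_sq_add_cos_sq θ
    simp only [Function.comp, Complex.real_smul, Complex.ofReal_neg]
    linear_combination G' (Real.cos θ) * h3
  rw [intervalIntegral.integral_eq_sub_of_hasDerivAt hd]
  · simp
  · refine Continuous.intervalIntegrable ?_ _ _
    fun_prop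

/-- The law of `cos θ₁ cos θ₂` for independent uniform angles. -/
noncomputable def prodLaw : Measure ℝ :=
  (arcLaw.prod arcLaw).map fun p => p.1 * p.2

instance : IsProbabilityMeasure prodLaw :=
  Measure.isProbabilityMeasure_map (by fun_prop)

lemma ae_prodLaw : ∀ᵐ x ∂prodLaw, |x| ≤ 1 := by
  rw [prodLaw, ae_map_iff (by fun_prop) (measurableSet_le (by fun_prop) (by fun_prop))]
  have h1 : ∀ᵐ p ∂(arcLaw.prod arcLaw), p.1 ∈ Set.Icc (-1 : ℝ) 1 :=
    Measure.quasiMeasurePreserving_fst.ae ae_arcLaw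
  have h2 : ∀ᵐ p ∂(arcLaw.prod arcLaw), p.2 ∈ Set.Icc (-1 : ℝ) 1 :=
    Measure.quasiMeasurePreserving_snd.ae ae_arcLaw
  filter_upwards [h1, h2] with p hp1 hp2
  rw [abs_mul]
  exact mul_le_one₀ (abs_le.2 hp1) (abs_nonneg _) (abs_le.2 hp2)

lemma map_neg_prodLaw : prodLaw.map (fun x => -x) = prodLaw := by
  have h : (arcLaw.prod arcLaw).map (Prod.map (fun c => -c) id) = arcLaw.prod arcLaw := by
    rw [← Measure.map_prod_map _ _ (by fun_prop) (by fun_prop), map_neg_arcLaw, Measure.map_id]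
  conv_rhs => rw [prodLaw, ← h]
  rw [prodLaw, Measure.map_map (by fun_prop) (by fun_prop),
    Measure.map_map (by fun_prop) (by fun_prop)]
  congr 1
  ext p
  simp

lemma integral_prodLaw_neg {g : ℝ → ℂ} (hg : Measurable g) :
    ∫ x, g (-x) ∂prodLaw = ∫ x, g x ∂prodLaw := by
  conv_rhs => rw [← map_neg_prodLaw]
  rw [integral_map (by fun_prop) hg.aestronglyMeasurable]

lemma integrable_prod_of_continuous {g : ℝ × ℝ → ℂ} (hg : Continuous g) :
    Integrable g (arcLaw.prod arcLaw) := by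
  have h : IntegrableOn g (Set.Icc (-1 : ℝ) 1 ×ˢ Set.Icc (-1 : ℝ) 1) (arcLaw.prod arcLaw) :=
    hg.continuousOn.integrableOn_compact (isCompact_Icc.prod isCompact_Icc)
  rw [IntegrableOn, ← Measure.prod_restrict, Measure.restrict_eq_self_of_ae_mem ae_arcLaw] at h
  exact h

lemma integral_prodLaw {g : ℝ → ℂ} (hg : Continuous g) :
    ∫ x, g x ∂prodLaw = ∫ p, g (p.1 * p.2) ∂(arcLaw.prod arcLaw) := by
  rw [prodLaw, integral_map (by fun_prop) hg.aestronglyMeasurable]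

lemma integrable_prodLaw {g : ℝ → ℂ} (hg : Continuous g) : Integrable g prodLaw := by
  rw [prodLaw, integrable_map_measure hg.aestronglyMeasurable (by fun_prop)]
  exact integrable_prod_of_continuous (g := fun p => g (p.1 * p.2)) (by fun_prop)

/-- The differential identity satisfied by the law of the product of two cosines. -/
lemma integral_prodLaw_identity {f1 f2 f3 : ℝ → ℂ}
    (h2 : ∀ x, HasDerivAt f1 (f2 x) x) (h3 : ∀ x, HasDerivAt f2 (f3 x) x)
    (hc : Continuous f3) :
    ∫ x, ((x : ℂ) * f1 x + 3 * (x : ℂ) ^ 2 * f2 x + (x : ℂ) ^ 3 * f3 x) ∂prodLaw =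
      ∫ x, (f2 x + (x : ℂ) * f3 x) ∂prodLaw := by
  have c1 : Continuous f1 := continuous_iff_continuousAt.2 fun c => (h2 c).continuousAt
  have c2 : Continuous f2 := continuous_iff_continuousAt.2 fun c => (h3 c).continuousAt
  have dmul : ∀ a c : ℝ, HasDerivAt (fun c : ℝ => a * c) a c := fun a c => by
    simpa using (hasDerivAt_id c).const_mul a
  have key1 : ∀ a : ℝ, ∫ c, ((a : ℂ) ^ 2 * (2 * f2 (a * c) + (a * c : ℝ) * f3 (a * c))) ∂arcLaw
      = ∫ c, (((a * c : ℝ) : ℂ) * f1 (a * c) + 3 * ((a * c : ℝ) : ℂ) ^ 2 * f2 (a * c)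
        + ((a * c : ℝ) : ℂ) ^ 3 * f3 (a * c)) ∂arcLaw := by
    intro a
    have hd : ∀ c : ℝ, HasDerivAt
        (fun c : ℝ => (a : ℂ) * (f1 (a * c) + (a * c : ℝ) * f2 (a * c)))
        ((a : ℂ) ^ 2 * (2 * f2 (a * c) + (a * c : ℝ) * f3 (a * c))) c := by
      intro c
      have e1 := (h2 (a * c)).scomp c (dmul a c)
      have e2 := (h3 (a * c)).scomp c (dmul a c)
      have e3 := (dmul a c).ofReal_comp
      refine ((e1.add (e3.mul e2)).const_mul (a : ℂ)).congr_deriv ?_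
      simp only [Function.comp, Complex.real_smul]
      push_cast; ring
    rw [integral_deriv_arcLaw hd (by fun_prop)]
    congr 1; ext c; push_cast; ring
  have key2 : ∀ c : ℝ, ∫ a, (f2 (a * c) + (a * c : ℝ) * f3 (a * c)) ∂arcLaw
      = ∫ a : ℝ, ((a : ℂ) ^ 2 * (2 * f2 (a * c) + (a * c : ℝ) * f3 (a * c))) ∂arcLaw := by
    intro c
    have hd : ∀ a : ℝ, HasDerivAt (fun a : ℝ => (a : ℂ) * f2 (a * c))
        (f2 (a * c) + (a * c : ℝ) * f3 (a * c)) a := by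
      intro a
      have e2 := (h3 (a * c)).scomp a ((dmul c a).congr_of_eventuallyEq
        (Filter.Eventually.of_forall fun b => mul_comm b c))
      refine ((Complex.ofRealCLM.hasDerivAt (x := a)).mul e2).congr_deriv ?_
      simp only [Function.comp, Complex.real_smul, Complex.ofRealCLM_apply]
      push_cast; ring
    rw [integral_deriv_arcLaw hd (by fun_prop)]
    congr 1; ext a; push_cast; ring
  rw [integral_prodLaw (by fun_prop), integral_prodLaw (by fun_prop)]
  have i0 : Continuous fun p : ℝ × ℝ =>
      (p.1 : ℂ) ^ 2 * (2 * f2 (p.1 * p.2) + (p.1 * p.2 : ℝ) * f3 (p.1 * p.2)) := by fun_prop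
  have i1 : Continuous fun p : ℝ × ℝ =>
      (f2 (p.1 * p.2) + (p.1 * p.2 : ℝ) * f3 (p.1 * p.2)) := by fun_prop
  have i2 : Continuous fun p : ℝ × ℝ => (((p.1 * p.2 : ℝ) : ℂ) * f1 (p.1 * p.2)
      + 3 * ((p.1 * p.2 : ℝ) : ℂ) ^ 2 * f2 (p.1 * p.2)
      + ((p.1 * p.2 : ℝ) : ℂ) ^ 3 * f3 (p.1 * p.2)) := by fun_prop
  rw [integral_prod _ (integrable_prod_of_continuous i2),
    integral_prod_symm _ (integrable_prod_of_continuous i1)]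
  simp only [← key1, key2]
  rw [← integral_prod _ (integrable_prod_of_continuous i0),
    ← integral_prod_symm _ (integrable_prod_of_continuous i0)]

lemma image_cos_sq_Ioo : (fun θ : ℝ => Real.cos θ ^ 2) '' Set.Ioo 0 (π / 2) = Set.Ioo 0 1 := by
  ext x
  constructor
  · rintro ⟨θ, ⟨h0, h1⟩, rfl⟩
    have hc : 0 < Real.cos θ := Real.cos_pos_of_mem_Ioo ⟨by linarith, h1⟩
    have hs : 0 < Real.sin θ := Real.sin_pos_of_pos_of_lt_pi h0 (by linarith)
    exact ⟨by positivity, by nlinarith [Real.sin_sq_add_cos_sq θ, mul_pos hs hs]⟩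
  · rintro ⟨h0, h1⟩
    have hq0 : 0 < √x := Real.sqrt_pos.2 h0
    have hq1 : √x < 1 := by rw [Real.sqrt_lt' one_pos]; simpa using h1
    refine ⟨Real.arccos √x, ⟨Real.arccos_pos.2 hq1, Real.arccos_lt_pi_div_two.2 hq0⟩, ?_⟩
    simp only
    rw [Real.cos_arccos (by linarith) hq1.le, Real.sq_sqrt h0.le]

lemma injOn_cos_sq : Set.InjOn (fun θ : ℝ => Real.cos θ ^ 2) (Set.Ioo 0 (π / 2)) := by
  intro x hx y hy h
  have hcx : 0 < Real.cos x := Real.cos_pos_of_mem_Ioo ⟨by linarith [hx.1, Real.pi_pos], hx.2⟩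
  have hcy : 0 < Real.cos y := Real.cos_pos_of_mem_Ioo ⟨by linarith [hy.1, Real.pi_pos], hy.2⟩
  have h2 : Real.cos x = Real.cos y := (sq_eq_sq₀ hcx.le hcy.le).1 h
  exact Real.injOn_cos ⟨hx.1.le, by linarith [hx.2, Real.pi_pos]⟩
    ⟨hy.1.le, by linarith [hy.2, Real.pi_pos]⟩ h2

lemma cos_sq_integrand_eq {w : ℂ} {θ : ℝ} (h : θ ∈ Set.Ioo 0 (π / 2)) :
    |2 * Real.cos θ ^ (2 - 1) * -Real.sin θ| •
      (((Real.cos θ ^ 2 : ℝ) : ℂ) ^ ((w + 1) / 2 - 1) *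
        (1 - ((Real.cos θ ^ 2 : ℝ) : ℂ)) ^ ((1 / 2 : ℂ) - 1)) =
      2 * evenPow w (Real.cos θ) := by
  have hc : 0 < Real.cos θ := Real.cos_pos_of_mem_Ioo ⟨by linarith [h.1, Real.pi_pos], h.2⟩
  have hs : 0 < Real.sin θ := Real.sin_pos_of_pos_of_lt_pi h.1 (by linarith [h.2, Real.pi_pos])
  have e1 : (1 : ℂ) - ((Real.cos θ ^ 2 : ℝ) : ℂ) = ((Real.sin θ ^ 2 : ℝ) : ℂ) := by
    rw [Real.sin_sq]; push_cast; ring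
  have e2 : ∀ {a : ℝ}, 0 < a → ∀ z : ℂ, ((a ^ 2 : ℝ) : ℂ) ^ z = evenPow (2 * z) a := by
    intro a ha z
    rw [Complex.cpow_def_of_ne_zero (by exact_mod_cast (pow_pos ha 2).ne'), evenPow_of_ne ha.ne',
      ← Complex.ofReal_log (by positivity), Real.log_pow]
    push_cast; ring_nf
  rw [e1, e2 hc, e2 hs, abs_mul, abs_neg, abs_of_pos hs, abs_of_pos (by positivity)]
  have e3 : evenPow (2 * ((w + 1) / 2 - 1)) (Real.cos θ) * (Real.cos θ : ℂ)
      = evenPow w (Real.cos θ) := by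
    have := evenPow_natCast hc 1
    rw [pow_one] at this
    rw [← this, ← evenPow_add hc.ne']; push_cast; ring_nf
  have e4 : evenPow (2 * ((1 / 2 : ℂ) - 1)) (Real.sin θ) * (Real.sin θ : ℂ) = 1 := by
    have := evenPow_natCast hs 1
    rw [pow_one] at this
    rw [← this, ← evenPow_add hs.ne']; norm_num [evenPow_exp_zero hs.ne']
  rw [Complex.real_smul, ← e3]
  rw [Complex.ofReal_mul, Complex.ofReal_mul, Complex.ofReal_pow, Complex.ofReal_ofNat]
  linear_combination 2 * evenPow (2 * ((w + 1) / 2 - 1)) (Real.cos θ) * (Real.cos θ : ℂ) * e4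

lemma half_period_evenPow_cos {w : ℂ} (hw : -1 < w.re) :
    IntervalIntegrable (fun θ => evenPow w (Real.cos θ)) volume 0 (π / 2) ∧
    ∫ θ in (0 : ℝ)..π / 2, evenPow w (Real.cos θ) =
      (1 / 2) * Complex.betaIntegral ((w + 1) / 2) (1 / 2) := by
  have hu : 0 < ((w + 1) / 2).re := by
    have : ((w + 1) / 2).re = (w.re + 1) / 2 := by
      rw [show (w + 1) / 2 = ((1 / 2 : ℝ) : ℂ) * (w + 1) by push_cast; ring, Complex.re_ofReal_mul]
      simp; ring
    rw [this]; linarith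
  have hder : ∀ θ ∈ Set.Ioo 0 (π / 2), HasDerivWithinAt (fun θ : ℝ => Real.cos θ ^ 2)
      (2 * Real.cos θ ^ (2 - 1) * -Real.sin θ) (Set.Ioo 0 (π / 2)) θ := fun θ _ =>
    ((Real.hasDerivAt_cos θ).pow 2).hasDerivWithinAt
  have hconv := Complex.betaIntegral_convergent (u := (w + 1) / 2) (v := 1 / 2) hu (by norm_num)
  rw [intervalIntegrable_iff_integrableOn_Ioo_of_le zero_le_one, ← image_cos_sq_Ioo,
    integrableOn_image_iff_integrableOn_abs_deriv_smul measurableSet_Ioo hder injOn_cos_sq,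
    integrableOn_congr_fun (fun θ hθ => cos_sq_integrand_eq hθ) measurableSet_Ioo] at hconv
  refine ⟨?_, ?_⟩
  · rw [intervalIntegrable_iff_integrableOn_Ioo_of_le (by positivity)]
    have := hconv.const_mul (1 / 2 : ℂ)
    simpa [← mul_assoc, IntegrableOn] using this
  · have h2 := integral_image_eq_integral_abs_deriv_smul measurableSet_Ioo hder injOn_cos_sq
      fun x : ℝ => (x : ℂ) ^ ((w + 1) / 2 - 1) * (1 - (x : ℂ)) ^ ((1 / 2 : ℂ) - 1)
    rw [image_cos_sq_Ioo, setIntegral_congr_fun measurableSet_Ioo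
      (fun θ hθ => cos_sq_integrand_eq (w := w) hθ), ← integral_Ioc_eq_integral_Ioo,
      ← intervalIntegral.integral_of_le zero_le_one, integral_const_mul,
      ← integral_Ioc_eq_integral_Ioo, ← intervalIntegral.integral_of_le (by positivity)] at h2
    rw [Complex.betaIntegral, h2]; ring

lemma full_period_evenPow_cos {w : ℂ} (hw : -1 < w.re) :
    IntervalIntegrable (fun θ => evenPow w (Real.cos θ)) volume 0 (2 * π) ∧
    ∫ θ in (0 : ℝ)..2 * π, evenPow w (Real.cos θ) =
      2 * Complex.betaIntegral ((w + 1) / 2) (1 / 2) := by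
  obtain ⟨hi, hv⟩ := half_period_evenPow_cos hw
  have hi2 : IntervalIntegrable (fun θ => evenPow w (Real.cos θ)) volume (-(π / 2)) 0 := by
    have := (IntervalIntegrable.iff_comp_neg (f := fun θ => evenPow w (Real.cos θ))
      (a := 0) (b := π / 2)).1 hi
    simpa using this.symm
  have hv2 : ∫ θ in (-(π / 2) : ℝ)..0, evenPow w (Real.cos θ) =
      (1 / 2) * Complex.betaIntegral ((w + 1) / 2) (1 / 2) := by
    have := intervalIntegral.integral_comp_neg (a := 0) (b := π / 2)
      (fun θ => evenPow w (Real.cos θ))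
    simp only [Real.cos_neg, neg_zero] at this
    rw [← this, hv]
  have hp : Function.Periodic (fun θ => evenPow w (Real.cos θ)) π := fun θ => by
    simp [Real.cos_add_pi, evenPow_neg]
  have hi3 := hp.intervalIntegrable Real.pi_ne_zero (t := -(π / 2)) (by
    rw [show -(π / 2) + π = π / 2 by ring]
    exact hi2.trans hi)
  refine ⟨hi3 _ _, ?_⟩
  have h1 := hp.intervalIntegral_add_zsmul_eq 2 0 hi3
  have h2 := hp.intervalIntegral_add_eq 0 (-(π / 2))
  rw [show -(π / 2) + π = π / 2 by ring,
    ← intervalIntegral.integral_add_adjacent_intervals (hi3 (-(π / 2)) 0) (hi3 0 _), hv, hv2] at h2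
  rw [h2] at h1
  simp only [zero_add, zsmul_eq_mul] at h1
  push_cast at h1
  rw [h1]; ring

/-- The moment `E |cos θ| ^ w`. -/
noncomputable def arcMoment (w : ℂ) : ℂ :=
  Complex.Gamma ((w + 1) / 2) / (Complex.Gamma (1 / 2) * Complex.Gamma (w / 2 + 1))

lemma integrable_evenPow_arcLaw {w : ℂ} (hw : -1 < w.re) : Integrable (evenPow w) arcLaw :=
  integrable_arcLaw (measurable_evenPow w) (full_period_evenPow_cos hw).1

lemma complex_Gamma_half_sq : Complex.Gamma (1 / 2) ^ 2 = π := by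
  rw [Complex.Gamma_one_half_eq, ← Complex.cpow_nat_mul]
  norm_num

lemma integral_evenPow_arcLaw {w : ℂ} (hw : -1 < w.re) :
    ∫ c, evenPow w c ∂arcLaw = arcMoment w := by
  have hu : 0 < ((w + 1) / 2).re := by
    have : ((w + 1) / 2).re = (w.re + 1) / 2 := by
      rw [show (w + 1) / 2 = ((1 / 2 : ℝ) : ℂ) * (w + 1) by push_cast; ring, Complex.re_ofReal_mul]
      simp; ring
    rw [this]; linarith
  rw [integral_arcLaw (measurable_evenPow w), (full_period_evenPow_cos hw).2,
    Complex.betaIntegral_eq_Gamma_mul_div _ _ hu (by norm_num), arcMoment,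
    show (w + 1) / 2 + 1 / 2 = w / 2 + 1 by ring]
  have h1 := complex_Gamma_half_sq
  have h2 : Complex.Gamma (1 / 2) ≠ 0 := Complex.Gamma_ne_zero_of_re_pos (by norm_num)
  have hpi : (π : ℂ) ≠ 0 := by exact_mod_cast Real.pi_ne_zero
  generalize Complex.Gamma (w / 2 + 1) = g
  push_cast
  rw [div_eq_mul_inv, div_eq_mul_inv, mul_inv]
  field_simp
  linear_combination Complex.Gamma ((w + 1) / 2) * g⁻¹ * h1

lemma integrable_evenPow_prodLaw {w : ℂ} (hw : -1 < w.re) : Integrable (evenPow w) prodLaw := by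
  rw [prodLaw, integrable_map_measure (measurable_evenPow w).aestronglyMeasurable (by fun_prop)]
  have := (integrable_evenPow_arcLaw hw).mul_prod (integrable_evenPow_arcLaw hw)
  refine this.congr (Filter.Eventually.of_forall fun p => ?_)
  simp [evenPow_mul]

lemma integral_evenPow_prodLaw {w : ℂ} (hw : -1 < w.re) :
    ∫ x, evenPow w x ∂prodLaw = arcMoment w ^ 2 := by
  rw [prodLaw, integral_map (by fun_prop) (measurable_evenPow w).aestronglyMeasurable]
  simp only [evenPow_mul]
  rw [integral_prod_mul, integral_evenPow_arcLaw hw, sq]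

lemma arcMoment_zero : arcMoment 0 = 1 := by
  have h2 : Complex.Gamma (1 / 2) ≠ 0 := Complex.Gamma_ne_zero_of_re_pos (by norm_num)
  rw [arcMoment]; simp only [zero_add, zero_div, Complex.Gamma_one, mul_one]
  exact div_self h2

lemma ae_prodLaw_ne_zero : ∀ᵐ x ∂prodLaw, x ≠ 0 := by
  have h := integral_evenPow_prodLaw (w := 0) (by norm_num)
  rw [arcMoment_zero, one_pow] at h
  have h1 : ∀ x : ℝ, evenPow 0 x = Set.indicator {0}ᶜ (fun _ => (1 : ℂ)) x := by
    intro x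
    rcases eq_or_ne x 0 with rfl | hx
    · simp [evenPow_zero]
    · simp [hx, evenPow_exp_zero hx]
  simp only [h1] at h
  rw [integral_indicator (by measurability), setIntegral_const] at h
  simp only [Complex.real_smul, mul_one] at h
  have h2 : prodLaw.real {0}ᶜ = 1 := by exact_mod_cast h
  have h3 := probReal_compl_eq_one_sub (μ := prodLaw) (measurableSet_singleton (0 : ℝ))
  have h4 : prodLaw.real {0} = 0 := by linarith
  rw [measureReal_eq_zero_iff] at h4
  rw [ae_iff]; simpa using h4

/-- `E |κ + X| ^ s` for `X` the product of two independent cosines. -/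
noncomputable def evenMean (s : ℂ) (κ : ℝ) : ℂ := ∫ x, evenPow s (κ + x) ∂prodLaw

/-- `E sign (κ + X) |κ + X| ^ s` for `X` the product of two independent cosines. -/
noncomputable def oddMean (s : ℂ) (κ : ℝ) : ℂ := ∫ x, oddPow s (κ + x) ∂prodLaw

lemma hasDerivAt_integral_prodLaw {f f' : ℝ → ℂ} (hf : ∀ y, HasDerivAt f (f' y) y)
    (hf' : Continuous f') (κ : ℝ) :
    HasDerivAt (fun κ : ℝ => ∫ x, f (κ + x) ∂prodLaw) (∫ x, f' (κ + x) ∂prodLaw) κ := by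
  have hfc : Continuous f := continuous_iff_continuousAt.2 fun c => (hf c).continuousAt
  obtain ⟨C, hC⟩ := (isCompact_Icc (a := κ - 2) (b := κ + 2)).exists_bound_of_continuousOn
    hf'.continuousOn
  refine (hasDerivAt_integral_of_dominated_loc_of_deriv_le (F := fun κ x => f (κ + x))
    (F' := fun κ x => f' (κ + x)) (bound := fun _ => C) (Metric.ball_mem_nhds κ one_pos) ?_ ?_ ?_
    ?_ (integrable_const C) ?_).2
  · exact Filter.Eventually.of_forall fun k => Continuous.aestronglyMeasurable (by fun_prop)
  · exact integrable_prodLaw (by fun_prop)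
  · exact Continuous.aestronglyMeasurable (by fun_prop)
  · filter_upwards [ae_prodLaw] with x hx k hk
    rw [Metric.mem_ball, Real.dist_eq, abs_lt] at hk
    rw [abs_le] at hx
    exact hC _ ⟨by linarith, by linarith⟩
  · exact Filter.Eventually.of_forall fun x k _ => (hf (k + x)).comp_add_const k x

lemma hasDerivAt_evenMean {s : ℂ} (hs : 1 < s.re) (κ : ℝ) :
    HasDerivAt (evenMean s) (s * oddMean (s - 1) κ) κ := by
  have h := hasDerivAt_integral_prodLaw (hasDerivAt_evenPow hs)
    ((continuous_oddPow (s := s - 1) (by simpa using hs)).const_mul s) κ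
  rwa [integral_const_mul] at h

lemma hasDerivAt_oddMean {s : ℂ} (hs : 1 < s.re) (κ : ℝ) :
    HasDerivAt (oddMean s) (s * evenMean (s - 1) κ) κ := by
  have h := hasDerivAt_integral_prodLaw (hasDerivAt_oddPow hs)
    ((continuous_evenPow (s := s - 1) (by simpa using hs)).const_mul s) κ
  rwa [integral_const_mul] at h

lemma evenMean_neg (s : ℂ) (κ : ℝ) : evenMean s (-κ) = evenMean s κ := by
  have h := integral_prodLaw_neg (g := fun x => evenPow s (κ + x))
    ((measurable_evenPow s).comp (by fun_prop))
  rw [evenMean, evenMean, ← h]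
  congr 1; ext x
  rw [← evenPow_neg]; congr 1; ring

lemma evenMean_abs (s : ℂ) (κ : ℝ) : evenMean s |κ| = evenMean s κ := by
  rcases abs_choice κ with h | h <;> rw [h]
  exact evenMean_neg s κ

lemma oddMean_neg (s : ℂ) (κ : ℝ) : oddMean s (-κ) = -oddMean s κ := by
  have h := integral_prodLaw_neg (g := fun x => oddPow s (κ + x))
    ((measurable_oddPow s).comp (by fun_prop))
  rw [oddMean, oddMean, ← h, ← integral_neg]
  congr 1; ext x
  rw [← oddPow_neg]; congr 1; ring

lemma oddMean_zero (s : ℂ) : oddMean s 0 = 0 := by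
  have h := oddMean_neg s 0
  rw [neg_zero] at h
  exact self_eq_neg.1 h

lemma evenMean_zero {s : ℂ} (hs : -1 < s.re) : evenMean s 0 = arcMoment s ^ 2 := by
  simp [evenMean, ← integral_evenPow_prodLaw hs]

/-- The third order differential equation satisfied by `evenMean`. -/
lemma evenMean_ode {s : ℂ} (hs : 3 < s.re) (κ : ℝ) :
    s ^ 3 * evenMean s κ - (3 * s ^ 2 - 3 * s + 1) * κ * (s * oddMean (s - 1) κ)
      + (3 * s - 3) * κ ^ 2 * (s * (s - 1) * evenMean (s - 2) κ)
      - κ ^ 3 * (s * (s - 1) * (s - 2) * oddMean (s - 3) κ)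
    = (s - 1) * (s * (s - 1) * evenMean (s - 2) κ)
      - κ * (s * (s - 1) * (s - 2) * oddMean (s - 3) κ) := by
  have c0 : Continuous (evenPow s) := continuous_evenPow (by linarith)
  have c1 : Continuous (oddPow (s - 1)) := continuous_oddPow (by simp; linarith)
  have c2 : Continuous (evenPow (s - 2)) := continuous_evenPow (by simp; linarith)
  have c3 : Continuous (oddPow (s - 3)) := continuous_oddPow (by simp; linarith)
  have h := integral_prodLaw_identity
    (f1 := fun x => s * oddPow (s - 1) (κ + x))
    (f2 := fun x => s * (s - 1) * evenPow (s - 2) (κ + x))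
    (f3 := fun x => s * (s - 1) * (s - 2) * oddPow (s - 3) (κ + x))
    (fun x => by
      refine (((hasDerivAt_oddPow (s := s - 1) (by simp; linarith) (κ + x)).comp_const_add
        κ x).const_mul s).congr_deriv ?_
      rw [show s - 1 - 1 = s - 2 by ring]; ring)
    (fun x => by
      refine (((hasDerivAt_evenPow (s := s - 2) (by simp; linarith) (κ + x)).comp_const_add
        κ x).const_mul (s * (s - 1))).congr_deriv ?_
      rw [show s - 2 - 1 = s - 3 by ring]; ring)
    (by fun_prop)
  have r1 : ∀ y : ℝ, (y : ℂ) * oddPow (s - 1) y = evenPow s y := fun y => by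
    rw [mul_oddPow]; ring_nf
  have r2 : ∀ y : ℝ, (y : ℂ) * evenPow (s - 2) y = oddPow (s - 1) y := fun y => by
    rw [mul_evenPow]; ring_nf
  have r3 : ∀ y : ℝ, (y : ℂ) * oddPow (s - 3) y = evenPow (s - 2) y := fun y => by
    rw [mul_oddPow]; ring_nf
  have i0 : Integrable (fun x => evenPow s (κ + x)) prodLaw := integrable_prodLaw (by fun_prop)
  have i1 : Integrable (fun x => oddPow (s - 1) (κ + x)) prodLaw :=
    integrable_prodLaw (by fun_prop)
  have i2 : Integrable (fun x => evenPow (s - 2) (κ + x)) prodLaw :=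
    integrable_prodLaw (by fun_prop)
  have i3 : Integrable (fun x => oddPow (s - 3) (κ + x)) prodLaw :=
    integrable_prodLaw (by fun_prop)
  have hl : ∀ a b c d : ℂ, ∫ x, (a * evenPow s (κ + x) + b * oddPow (s - 1) (κ + x)
      + c * evenPow (s - 2) (κ + x) + d * oddPow (s - 3) (κ + x)) ∂prodLaw
      = a * evenMean s κ + b * oddMean (s - 1) κ + c * evenMean (s - 2) κ
        + d * oddMean (s - 3) κ := by
    intro a b c d
    rw [integral_add, integral_add, integral_add]
    · simp only [integral_const_mul]; rfl
    · exact i0.const_mul a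
    · exact i1.const_mul b
    · exact (i0.const_mul a).add (i1.const_mul b)
    · exact i2.const_mul c
    · exact ((i0.const_mul a).add (i1.const_mul b)).add (i2.const_mul c)
    · exact i3.const_mul d
  have e1 : ∀ x : ℝ, (x : ℂ) * (s * oddPow (s - 1) (κ + x))
      + 3 * (x : ℂ) ^ 2 * (s * (s - 1) * evenPow (s - 2) (κ + x))
      + (x : ℂ) ^ 3 * (s * (s - 1) * (s - 2) * oddPow (s - 3) (κ + x))
      = s ^ 3 * evenPow s (κ + x)
        + (-(3 * s ^ 2 - 3 * s + 1) * κ * s) * oddPow (s - 1) (κ + x)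
        + ((3 * s - 3) * κ ^ 2 * (s * (s - 1))) * evenPow (s - 2) (κ + x)
        + (-κ ^ 3 * (s * (s - 1) * (s - 2))) * oddPow (s - 3) (κ + x) := by
    intro x
    have q1 := r1 (κ + x)
    have q2 := r2 (κ + x)
    have q3 := r3 (κ + x)
    generalize oddPow (s - 3) (κ + x) = O3 at *
    rw [← q1, ← q2, ← q3]
    push_cast; ring
  have e2 : ∀ x : ℝ, s * (s - 1) * evenPow (s - 2) (κ + x)
      + (x : ℂ) * (s * (s - 1) * (s - 2) * oddPow (s - 3) (κ + x))
      = 0 * evenPow s (κ + x) + 0 * oddPow (s - 1) (κ + x)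
        + (s * (s - 1) * (s - 1)) * evenPow (s - 2) (κ + x)
        + (-κ * (s * (s - 1) * (s - 2))) * oddPow (s - 3) (κ + x) := by
    intro x
    have q3 := r3 (κ + x)
    generalize oddPow (s - 3) (κ + x) = O3 at *
    rw [← q3]
    push_cast; ring
  simp only [e1, e2, hl] at h
  linear_combination h

/-- The power series with coefficients `a` converges absolutely in the open unit disc. -/
def UnitSummable (a : ℕ → ℂ) : Prop := ∀ r : ℝ, 0 ≤ r → r < 1 → Summable fun n => ‖a n‖ * r ^ n

/-- The generalized power series `κ ^ lam * ∑ a n * κ ^ (2 n)`, for `κ > 0`. -/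
noncomputable def powSer (a : ℕ → ℂ) (lam : ℂ) (κ : ℝ) : ℂ :=
  ∑' n : ℕ, a n * evenPow (lam + 2 * n) κ

lemma evenPow_add_two_mul {κ : ℝ} (hκ : κ ≠ 0) (lam : ℂ) (n : ℕ) :
    evenPow (lam + 2 * n) κ = evenPow lam κ * ((κ : ℂ) ^ 2) ^ n := by
  rw [evenPow_add hκ, ← evenPow_two hκ, evenPow_of_ne hκ, evenPow_of_ne hκ, evenPow_of_ne hκ,
    ← Complex.exp_nat_mul]
  ring_nf

lemma norm_evenPow_add_two_mul {κ : ℝ} (hκ : 0 < κ) (lam : ℂ) (n : ℕ) :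
    ‖evenPow (lam + 2 * n) κ‖ = κ ^ lam.re * (κ ^ 2) ^ n := by
  rw [evenPow_add_two_mul hκ.ne', norm_mul, norm_evenPow_of_ne hκ.ne', abs_of_pos hκ, norm_pow,
    norm_pow, Complex.norm_real, Real.norm_eq_abs, abs_of_pos hκ]

lemma UnitSummable.summable {a : ℕ → ℂ} (ha : UnitSummable a) (lam : ℂ) {κ : ℝ} (h0 : 0 < κ)
    (h1 : κ < 1) : Summable fun n : ℕ => a n * evenPow (lam + 2 * n) κ := by
  refine Summable.of_norm ?_
  refine ((ha (κ ^ 2) (by positivity) (by nlinarith)).mul_left (κ ^ lam.re)).congr fun n => ?_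
  rw [norm_mul, norm_evenPow_add_two_mul h0]; ring

lemma UnitSummable.mul_linear {a : ℕ → ℂ} (ha : UnitSummable a) (lam : ℂ) :
    UnitSummable fun n => (lam + 2 * n) * a n := by
  intro r hr0 hr1
  set q := (1 + r) / 2 with hq
  have hq0 : 0 < q := by rw [hq]; linarith
  have hq1 : q < 1 := by rw [hq]; linarith
  have hrq : r / q < 1 := by rw [div_lt_one hq0, hq]; linarith
  have hrq0 : 0 ≤ r / q := by positivity
  have h1 := tendsto_self_mul_const_pow_of_lt_one hrq0 hrq
  obtain ⟨C, hC⟩ := h1.bddAbove_range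
  refine Summable.of_nonneg_of_le (fun n => by positivity) (fun n => ?_)
    ((ha q hq0.le hq1).mul_left (‖lam‖ + 2 * C))
  have h2 : (n : ℝ) * (r / q) ^ n ≤ C := hC ⟨n, rfl⟩
  have h3 : (r / q) ^ n ≤ 1 := pow_le_one₀ hrq0 hrq.le
  have h4 : r ^ n = (r / q) ^ n * q ^ n := by rw [← mul_pow, div_mul_cancel₀ _ hq0.ne']
  have h5 : ‖lam + 2 * n‖ ≤ ‖lam‖ + 2 * n := by
    refine (norm_add_le _ _).trans ?_
    simp
  rw [norm_mul, h4]
  calc ‖lam + 2 * n‖ * ‖a n‖ * ((r / q) ^ n * q ^ n)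
      ≤ (‖lam‖ + 2 * n) * ‖a n‖ * ((r / q) ^ n * q ^ n) := by gcongr
    _ = (‖lam‖ * (r / q) ^ n + 2 * (n * (r / q) ^ n)) * (‖a n‖ * q ^ n) := by ring
    _ ≤ (‖lam‖ + 2 * C) * (‖a n‖ * q ^ n) := by
      gcongr
      exact mul_le_of_le_one_right (norm_nonneg _) h3

lemma UnitSummable.shift {a : ℕ → ℂ} (ha : UnitSummable a) (N : ℕ) :
    UnitSummable fun n => a (n + N) := by
  intro r hr0 hr1
  rcases hr0.eq_or_lt with rfl | h
  · refine summable_of_ne_finset_zero (s := {0}) fun n hn => ?_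
    simp at hn; simp [hn]
  · have h1 := ((summable_nat_add_iff N).2 (ha r hr0 hr1)).mul_left (r ^ N)⁻¹
    refine h1.congr fun n => ?_
    rw [pow_add]; field_simp

lemma hasDerivAt_powSer {a : ℕ → ℂ} (ha : UnitSummable a) (lam : ℂ) {κ : ℝ} (h0 : 0 < κ)
    (h1 : κ < 1) :
    HasDerivAt (powSer a lam) (powSer (fun n => (lam + 2 * n) * a n) (lam - 1) κ) κ := by
  have hb := ha.mul_linear lam
  set ρ := (1 + κ) / 2 with hρ
  have hκt : κ ∈ Set.Ioo (κ / 2) ρ := ⟨by linarith, by rw [hρ]; linarith⟩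
  set M := (κ / 2) ^ (lam - 1).re + 1 with hM
  have hMb : ∀ y ∈ Set.Ioo (κ / 2) ρ, y ^ (lam - 1).re ≤ M := by
    intro y hy
    have hy0 : 0 < y := by linarith [hy.1]
    rcases le_total 0 (lam - 1).re with h | h
    · have := Real.rpow_le_one hy0.le (by linarith [hy.2] : y ≤ 1) h
      have : 0 ≤ (κ / 2) ^ (lam - 1).re := by positivity
      linarith
    · have := Real.rpow_le_rpow_of_nonpos (by linarith : 0 < κ / 2) hy.1.le h
      linarith
  have hMnn : 0 ≤ M := by positivity
  unfold powSer
  refine hasDerivAt_tsum_of_isPreconnected (t := Set.Ioo (κ / 2) ρ) (y₀ := κ)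
    (g := fun (n : ℕ) y => a n * evenPow (lam + 2 * n) y)
    (g' := fun (n : ℕ) y => (lam + 2 * n) * a n * evenPow (lam - 1 + 2 * n) y)
    (u := fun n => M * (‖(lam + 2 * n) * a n‖ * (ρ ^ 2) ^ n)) ?_ isOpen_Ioo isPreconnected_Ioo
    ?_ ?_ hκt (ha.summable lam h0 h1) hκt
  · exact (hb (ρ ^ 2) (by positivity) (by rw [hρ]; nlinarith)).mul_left M
  · intro n y hy
    have hy0 : 0 < y := by linarith [hy.1]
    have h := (hasDerivAt_evenPow_of_ne hy0.ne' (lam + 2 * n)).const_mul (a n)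
    rw [oddPow_of_pos hy0] at h
    refine h.congr_deriv ?_
    rw [show lam + 2 * (n : ℂ) - 1 = lam - 1 + 2 * n by ring]; ring
  · intro n y hy
    have hy0 : 0 < y := by linarith [hy.1]
    rw [norm_mul, norm_evenPow_add_two_mul hy0]
    calc ‖(lam + 2 * n) * a n‖ * (y ^ (lam - 1).re * (y ^ 2) ^ n)
        ≤ ‖(lam + 2 * n) * a n‖ * (M * (ρ ^ 2) ^ n) := by
          gcongr
          · exact hMb y hy
          · exact hy.2.le
      _ = _ := by ring

lemma powSer_bound {a : ℕ → ℂ} (ha : UnitSummable a) (lam : ℂ) {ρ : ℝ} (h0 : 0 < ρ)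
    (h1 : ρ < 1) : ∃ C, 0 ≤ C ∧ ∀ κ, 0 < κ → κ ≤ ρ → ‖powSer a lam κ‖ ≤ C * κ ^ lam.re := by
  refine ⟨∑' n, ‖a n‖ * (ρ ^ 2) ^ n, tsum_nonneg fun n => by positivity, fun κ hκ hκρ => ?_⟩
  have hs := ha (ρ ^ 2) (by positivity) (by nlinarith)
  rw [powSer, mul_comm, ← tsum_mul_left]
  refine tsum_of_norm_bounded (hs.mul_left _).hasSum fun n => ?_
  rw [norm_mul, norm_evenPow_add_two_mul hκ]
  calc ‖a n‖ * (κ ^ lam.re * (κ ^ 2) ^ n) = κ ^ lam.re * (‖a n‖ * (κ ^ 2) ^ n) := by ring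
    _ ≤ κ ^ lam.re * (‖a n‖ * (ρ ^ 2) ^ n) := by gcongr

lemma powSer_eq_head_add {a : ℕ → ℂ} (ha : UnitSummable a) (lam : ℂ) {κ : ℝ} (h0 : 0 < κ)
    (h1 : κ < 1) :
    powSer a lam κ = a 0 * evenPow lam κ + powSer (fun n => a (n + 1)) (lam + 2) κ := by
  have h := (ha.summable lam h0 h1).sum_add_tsum_nat_add 1
  rw [powSer, ← h, powSer]
  simp only [Finset.range_one, Finset.sum_singleton, Nat.cast_zero, mul_zero, add_zero]
  congr 2; ext n; push_cast; ring_nf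

lemma mul_powSer (a : ℕ → ℂ) (lam : ℂ) {κ : ℝ} (h0 : 0 < κ) :
    (κ : ℂ) * powSer a lam κ = powSer a (lam + 1) κ := by
  rw [powSer, powSer, ← tsum_mul_left]
  congr 1; ext n
  rw [show lam + 1 + 2 * (n : ℂ) = lam + 2 * n + 1 by ring, ← oddPow_of_pos h0 (lam + 2 * n + 1),
    ← mul_evenPow]
  ring

lemma powSer_add {a b : ℕ → ℂ} (ha : UnitSummable a) (hb : UnitSummable b) (lam : ℂ) {κ : ℝ}
    (h0 : 0 < κ) (h1 : κ < 1) :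
    powSer a lam κ + powSer b lam κ = powSer (fun n => a n + b n) lam κ := by
  rw [powSer, powSer, ← (ha.summable lam h0 h1).tsum_add (hb.summable lam h0 h1), powSer]
  congr 1; ext n; ring

lemma const_mul_powSer (c : ℂ) (a : ℕ → ℂ) (lam : ℂ) (κ : ℝ) :
    c * powSer a lam κ = powSer (fun n => c * a n) lam κ := by
  rw [powSer, powSer, ← tsum_mul_left]
  congr 1; ext n; ring

lemma UnitSummable.const_mul {a : ℕ → ℂ} (ha : UnitSummable a) (c : ℂ) :
    UnitSummable fun n => c * a n := by
  intro r hr0 hr1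
  refine ((ha r hr0 hr1).mul_left ‖c‖).congr fun n => ?_
  rw [norm_mul]; ring

lemma UnitSummable.add {a b : ℕ → ℂ} (ha : UnitSummable a) (hb : UnitSummable b) :
    UnitSummable fun n => a n + b n := by
  intro r hr0 hr1
  refine Summable.of_nonneg_of_le (fun n => by positivity) (fun n => ?_)
    ((ha r hr0 hr1).add (hb r hr0 hr1))
  rw [← add_mul]
  gcongr
  exact norm_add_le _ _

lemma poch_succ (x : ℂ) (n : ℕ) : poch x (n + 1) = poch x n * (x + n) :=
  ascPochhammer_succ_eval n x

lemma poch_zero (x : ℂ) : poch x 0 = 1 := by simp [poch]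

lemma poch_succ_left (x : ℂ) (n : ℕ) : poch x (n + 1) = x * poch (x + 1) n := by
  induction n with
  | zero => simp [poch_succ, poch_zero]
  | succ n ih => rw [poch_succ, ih, poch_succ (x + 1)]; push_cast; ring

lemma poch_ne_zero {x : ℂ} (hx : ∀ n : ℕ, x + n ≠ 0) (n : ℕ) : poch x n ≠ 0 := by
  induction n with
  | zero => simp [poch_zero]
  | succ n ih => rw [poch_succ]; exact mul_ne_zero ih (hx n)

/-- The coefficients of `₃F₂(a, a, a; b₁, b₂; z)`. -/
noncomputable def hypCoef (a b1 b2 : ℂ) (n : ℕ) : ℂ :=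
  poch a n * poch a n * poch a n / (poch b1 n * poch b2 n * (n.factorial : ℂ))

lemma hypCoef_zero (a b1 b2 : ℂ) : hypCoef a b1 b2 0 = 1 := by simp [hypCoef, poch_zero]

lemma hypCoef_succ {b1 b2 : ℂ} (h1 : ∀ n : ℕ, b1 + n ≠ 0) (h2 : ∀ n : ℕ, b2 + n ≠ 0) (a : ℂ)
    (n : ℕ) :
    (b1 + n) * (b2 + n) * (n + 1) * hypCoef a b1 b2 (n + 1) = (a + n) ^ 3 * hypCoef a b1 b2 n := by
  have e1 := poch_ne_zero h1 n
  have e2 := poch_ne_zero h2 n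
  have e3 := h1 n
  have e4 := h2 n
  have e5 : (n.factorial : ℂ) ≠ 0 := by exact_mod_cast n.factorial_ne_zero
  have e6 : (n : ℂ) + 1 ≠ 0 := by exact_mod_cast n.succ_ne_zero
  rw [hypCoef, hypCoef, poch_succ, poch_succ, poch_succ, Nat.factorial_succ]
  push_cast
  field_simp

lemma unitSummable_hypCoef {b1 b2 : ℂ} (h1 : ∀ n : ℕ, b1 + n ≠ 0) (h2 : ∀ n : ℕ, b2 + n ≠ 0)
    (a : ℂ) : UnitSummable (hypCoef a b1 b2) := by
  intro r hr0 hr1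
  have ht : ∀ b : ℂ, Filter.Tendsto (fun n : ℕ => (a + n) / (b + n)) Filter.atTop (nhds 1) := by
    intro b
    simpa using tendsto_add_mul_div_add_mul_atTop_nhds a b (1 : ℂ) one_ne_zero
  have h3 : Filter.Tendsto
      (fun n : ℕ => ‖(a + n) / (b1 + n) * ((a + n) / (b2 + n)) * ((a + n) / (1 + n))‖ * r)
      Filter.atTop (nhds r) := by
    simpa using (((ht b1).mul (ht b2)).mul (ht 1)).norm.mul_const r
  have h4 : r < (1 + r) / 2 := by linarith
  refine summable_of_ratio_norm_eventually_le (r := (1 + r) / 2) (by linarith) ?_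
  filter_upwards [h3.eventually (gt_mem_nhds h4)] with n hn
  have e6 : (1 : ℂ) + n ≠ 0 := by
    rw [add_comm]; exact_mod_cast n.succ_ne_zero
  have e7 : hypCoef a b1 b2 (n + 1) =
      ((a + n) / (b1 + n) * ((a + n) / (b2 + n)) * ((a + n) / (1 + n))) * hypCoef a b1 b2 n := by
    have := hypCoef_succ h1 h2 a n
    have e3 := h1 n
    have e4 := h2 n
    field_simp
    linear_combination this
  rw [norm_of_nonneg (by positivity), norm_of_nonneg (by positivity), e7, norm_mul, pow_succ]
  calc _ = (‖(a + n) / (b1 + n) * ((a + n) / (b2 + n)) * ((a + n) / (1 + n))‖ * r) *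
        (‖hypCoef a b1 b2 n‖ * r ^ n) := by ring
    _ ≤ _ := by gcongr

lemma powSer_hypCoef (a b1 b2 lam : ℂ) {κ : ℝ} (h0 : κ ≠ 0) :
    powSer (hypCoef a b1 b2) lam κ = evenPow lam κ * hyp3F2 a a a b1 b2 ((κ : ℂ) ^ 2) := by
  rw [powSer, hyp3F2, ← tsum_mul_left]
  congr 1; ext n
  rw [evenPow_add_two_mul h0, hypCoef]; ring

/-- The coefficients of the solution regular at the origin. -/
noncomputable def regCoef (s : ℂ) : ℕ → ℂ := hypCoef (-s / 2) ((1 - s) / 2) (1 / 2)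

/-- The coefficients of the solution with exponent `s + 1` at the origin. -/
noncomputable def singCoef (s : ℂ) : ℕ → ℂ := hypCoef (1 / 2) (1 + s / 2) (3 / 2 + s / 2)

lemma regCoef_den_ne {s : ℂ} (hodd : ∀ n : ℤ, s ≠ 2 * n + 1) (n : ℕ) : (1 - s) / 2 + n ≠ 0 := by
  intro h
  apply hodd n
  push_cast
  linear_combination -2 * h

lemma half_add_nat_ne (n : ℕ) : (1 / 2 : ℂ) + n ≠ 0 := by
  intro h
  have := congrArg Complex.re h
  simp at this
  have : (0 : ℝ) ≤ n := n.cast_nonneg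
  linarith

lemma singCoef_den_ne {s : ℂ} (hs : -1 < s.re) (n : ℕ) :
    1 + s / 2 + n ≠ 0 ∧ 3 / 2 + s / 2 + n ≠ 0 := by
  have : (0 : ℝ) ≤ n := n.cast_nonneg
  constructor <;>
  · intro h
    have h2 := congrArg (fun z => (2 * z).re) h
    ring_nf at h2
    simp at h2
    linarith

lemma unitSummable_regCoef {s : ℂ} (hodd : ∀ n : ℤ, s ≠ 2 * n + 1) : UnitSummable (regCoef s) :=
  unitSummable_hypCoef (regCoef_den_ne hodd) half_add_nat_ne _

lemma unitSummable_singCoef {s : ℂ} (hs : -1 < s.re) : UnitSummable (singCoef s) :=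
  unitSummable_hypCoef (fun n => (singCoef_den_ne hs n).1) (fun n => (singCoef_den_ne hs n).2) _

/-- The coefficients of the derivative of `powSer a lam`, which has exponent `lam - 1`. -/
noncomputable def derivCoef (lam : ℂ) (a : ℕ → ℂ) (n : ℕ) : ℂ := (lam + 2 * n) * a n

lemma UnitSummable.derivCoef {a : ℕ → ℂ} (ha : UnitSummable a) (lam : ℂ) :
    UnitSummable (derivCoef lam a) := ha.mul_linear lam

lemma hasDerivAt_powSer' {a : ℕ → ℂ} (ha : UnitSummable a) (lam : ℂ) {κ : ℝ} (h0 : 0 < κ)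
    (h1 : κ < 1) : HasDerivAt (powSer a lam) (powSer (derivCoef lam a) (lam - 1) κ) κ :=
  hasDerivAt_powSer ha lam h0 h1

lemma mul_pow_powSer (a : ℕ → ℂ) (lam : ℂ) {κ : ℝ} (h0 : 0 < κ) (n : ℕ) :
    (κ : ℂ) ^ n * powSer a lam κ = powSer a (lam + n) κ := by
  induction n with
  | zero => simp
  | succ n ih =>
    rw [pow_succ', mul_assoc, ih, mul_powSer _ _ h0]; push_cast; ring_nf

/-- A generalized power series whose coefficients satisfy the two-term recursion solves the
differential equation of `evenMean_ode`. -/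
lemma powSer_ode {a : ℕ → ℂ} (ha : UnitSummable a) {lam s : ℂ}
    (hind : lam * (lam - 1) * (lam - 1 - s) = 0)
    (hrec : ∀ n : ℕ, (lam + 2 * n + 2) * (lam + 2 * n + 1) * (lam + 2 * n + 1 - s) * a (n + 1) =
      (lam + 2 * n - s) ^ 3 * a n) {κ : ℝ} (h0 : 0 < κ) (h1 : κ < 1) :
    s ^ 3 * powSer a lam κ
      - (3 * s ^ 2 - 3 * s + 1) * κ * powSer (derivCoef lam a) (lam - 1) κ
      + (3 * s - 3) * κ ^ 2 * powSer (derivCoef (lam - 1) (derivCoef lam a)) (lam - 2) κ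
      - κ ^ 3 * powSer (derivCoef (lam - 2) (derivCoef (lam - 1) (derivCoef lam a))) (lam - 3) κ
    = (s - 1) * powSer (derivCoef (lam - 1) (derivCoef lam a)) (lam - 2) κ
      - κ * powSer (derivCoef (lam - 2) (derivCoef (lam - 1) (derivCoef lam a))) (lam - 3) κ := by
  set a1 := derivCoef lam a with ha1
  set a2 := derivCoef (lam - 1) a1 with ha2
  set a3 := derivCoef (lam - 2) a2 with ha3
  have u1 : UnitSummable a1 := ha.derivCoef _
  have u2 : UnitSummable a2 := u1.derivCoef _
  have u3 : UnitSummable a3 := u2.derivCoef _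
  have m1 := mul_pow_powSer a1 (lam - 1) h0 1
  have m2 := mul_pow_powSer a2 (lam - 2) h0 2
  have m3 := mul_pow_powSer a3 (lam - 3) h0 3
  have m4 := mul_pow_powSer a3 (lam - 3) h0 1
  have hsum : UnitSummable fun n => (s - 1) * a2 n + (-1) * a3 n :=
    (u2.const_mul _).add (u3.const_mul _)
  have hR : (s - 1) * powSer a2 (lam - 2) κ - κ * powSer a3 (lam - 3) κ =
      powSer (fun n => (s - 1) * a2 n + (-1) * a3 n) (lam - 2) κ := by
    rw [← powSer_add (u2.const_mul _) (u3.const_mul _) _ h0 h1, ← const_mul_powSer,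
      ← const_mul_powSer]
    rw [pow_one, Nat.cast_one, show lam - 3 + 1 = lam - 2 by ring] at m4
    linear_combination -m4
  have hL : s ^ 3 * powSer a lam κ - (3 * s ^ 2 - 3 * s + 1) * κ * powSer a1 (lam - 1) κ
      + (3 * s - 3) * κ ^ 2 * powSer a2 (lam - 2) κ - κ ^ 3 * powSer a3 (lam - 3) κ =
      powSer (fun n => ((s ^ 3 * a n + (-(3 * s ^ 2 - 3 * s + 1)) * a1 n) + (3 * s - 3) * a2 n)
        + (-1) * a3 n) lam κ := by
    rw [← powSer_add (((ha.const_mul _).add (u1.const_mul _)).add (u2.const_mul _))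
        (u3.const_mul _) _ h0 h1,
      ← powSer_add ((ha.const_mul _).add (u1.const_mul _)) (u2.const_mul _) _ h0 h1,
      ← powSer_add (ha.const_mul _) (u1.const_mul _) _ h0 h1, ← const_mul_powSer,
      ← const_mul_powSer, ← const_mul_powSer, ← const_mul_powSer]
    rw [pow_one, show lam - 1 + ((1 : ℕ) : ℂ) = lam by push_cast; ring] at m1
    rw [show lam - 2 + ((2 : ℕ) : ℂ) = lam by push_cast; ring] at m2
    rw [show lam - 3 + ((3 : ℕ) : ℂ) = lam by push_cast; ring] at m3
    linear_combination -(3 * s ^ 2 - 3 * s + 1) * m1 + (3 * s - 3) * m2 - m3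
  rw [hL, hR, powSer_eq_head_add hsum _ h0 h1, show lam - 2 + 2 = lam by ring]
  have hz : (s - 1) * a2 0 + (-1) * a3 0 = 0 := by
    rw [ha3, ha2, ha1]
    simp only [derivCoef, Nat.cast_zero, mul_zero, add_zero]
    linear_combination -(a 0) * hind
  rw [hz, zero_mul, zero_add]
  congr 1; ext n
  rw [ha3, ha2, ha1]
  simp only [derivCoef]
  push_cast
  linear_combination hrec n

lemma regCoef_rec {s : ℂ} (hodd : ∀ n : ℤ, s ≠ 2 * n + 1) (n : ℕ) :
    (0 + 2 * n + 2) * (0 + 2 * n + 1) * (0 + 2 * n + 1 - s) * regCoef s (n + 1) =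
      (0 + 2 * n - s) ^ 3 * regCoef s n := by
  have := hypCoef_succ (regCoef_den_ne hodd) half_add_nat_ne (-s / 2) n
  rw [← regCoef] at this
  linear_combination 8 * this

lemma singCoef_rec {s : ℂ} (hs : -1 < s.re) (n : ℕ) :
    (s + 1 + 2 * n + 2) * (s + 1 + 2 * n + 1) * (s + 1 + 2 * n + 1 - s) * singCoef s (n + 1) =
      (s + 1 + 2 * n - s) ^ 3 * singCoef s n := by
  have := hypCoef_succ (fun n => (singCoef_den_ne hs n).1) (fun n => (singCoef_den_ne hs n).2)
    (1 / 2) n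
  rw [← singCoef] at this
  linear_combination 8 * this

lemma derivCoef_regCoef_zero (s : ℂ) : derivCoef 0 (regCoef s) 0 = 0 := by simp [derivCoef]

lemma regCoef_add_two {s : ℂ} (hodd : ∀ n : ℤ, s ≠ 2 * n + 1) (n : ℕ) :
    (s + 1) * derivCoef (0 - 1) (derivCoef 0 (regCoef (s + 2))) (n + 1) =
      (s + 2) ^ 3 * regCoef s n := by
  have h1 : s + 1 ≠ 0 := fun h => hodd (-1) (by push_cast; linear_combination h)
  have e1 := poch_ne_zero (regCoef_den_ne hodd) n
  have e2 := poch_ne_zero half_add_nat_ne n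
  have e4 := half_add_nat_ne n
  have e5 : (n.factorial : ℂ) ≠ 0 := by exact_mod_cast n.factorial_ne_zero
  have e6 : (n : ℂ) + 1 ≠ 0 := by exact_mod_cast n.succ_ne_zero
  have h2 : 1 - (s + 2) ≠ 0 := fun h => h1 (by linear_combination -h)
  simp only [derivCoef, regCoef, hypCoef]
  rw [poch_succ_left (-(s + 2) / 2), poch_succ_left ((1 - (s + 2)) / 2), poch_succ (1 / 2),
    Nat.factorial_succ, show -(s + 2) / 2 + 1 = -s / 2 by ring,
    show (1 - (s + 2)) / 2 + 1 = (1 - s) / 2 by ring]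
  generalize poch (-s / 2) n = p at *
  generalize poch ((1 - s) / 2) n = q at *
  generalize poch (1 / 2) n = t at *
  have e7 : (1 : ℂ) + 2 * n ≠ 0 := fun h => e4 (by linear_combination h / 2)
  push_cast
  field_simp
  ring

lemma singCoef_add_two {s : ℂ} (hs : -1 < s.re) (n : ℕ) :
    derivCoef (s + 3 - 1) (derivCoef (s + 3) (singCoef (s + 2))) n =
      (s + 2) * (s + 3) * singCoef s n := by
  obtain ⟨a1, a2⟩ := singCoef_den_ne hs n
  have e1 := poch_ne_zero (fun n => (singCoef_den_ne hs n).1) n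
  have e2 := poch_ne_zero (fun n => (singCoef_den_ne hs n).2) n
  have hs2 : -1 < (s + 2).re := by simp; linarith
  have f1 := poch_ne_zero (fun n => (singCoef_den_ne hs2 n).1) n
  have f2 := poch_ne_zero (fun n => (singCoef_den_ne hs2 n).2) n
  have e5 : (n.factorial : ℂ) ≠ 0 := by exact_mod_cast n.factorial_ne_zero
  have g1 := (poch_succ_left (1 + s / 2) n).symm.trans (poch_succ (1 + s / 2) n)
  have g2 := (poch_succ_left (3 / 2 + s / 2) n).symm.trans (poch_succ (3 / 2 + s / 2) n)
  rw [show 1 + s / 2 + 1 = 1 + (s + 2) / 2 by ring] at g1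
  rw [show 3 / 2 + s / 2 + 1 = 3 / 2 + (s + 2) / 2 by ring] at g2
  simp only [derivCoef, singCoef, hypCoef]
  generalize poch (1 / 2) n = t at *
  generalize poch (1 + (s + 2) / 2) n = u at *
  generalize poch (3 / 2 + (s + 2) / 2) n = v at *
  generalize poch (1 + s / 2) n = u' at *
  generalize poch (3 / 2 + s / 2) n = v' at *
  rw [mul_div_assoc', mul_div_assoc', mul_div_assoc', div_eq_div_iff (by positivity) (by positivity)]
  linear_combination (-4 * t * t * t * n.factorial) * (3 / 2 + s / 2) * v * g1 -
    (4 * t * t * t * n.factorial) * (u' * (1 + s / 2 + n)) * g2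

lemma powSer_ne_zero {a : ℕ → ℂ} (ha : UnitSummable a) (lam : ℂ) (h : a 0 ≠ 0) :
    ∃ δ, 0 < δ ∧ δ < 1 ∧ ∀ κ, 0 < κ → κ < δ → powSer a lam κ ≠ 0 := by
  obtain ⟨C, hC0, hC⟩ := powSer_bound (ha.shift 1) (lam + 2) (ρ := 1 / 2) (by norm_num)
    (by norm_num)
  have ha0 : 0 < ‖a 0‖ := norm_pos_iff.2 h
  refine ⟨min (1 / 2) (‖a 0‖ / (C + 1)), by positivity,
    (min_le_left _ _).trans_lt (by norm_num), fun κ h0 h1 heq => ?_⟩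
  have hk1 : κ < 1 / 2 := h1.trans_le (min_le_left _ _)
  have hk2 : κ < ‖a 0‖ / (C + 1) := h1.trans_le (min_le_right _ _)
  rw [lt_div_iff₀ (by positivity)] at hk2
  have hb := hC κ h0 hk1.le
  rw [powSer_eq_head_add ha lam h0 (by linarith)] at heq
  have h3 : powSer (fun n => a (n + 1)) (lam + 2) κ = -(a 0 * evenPow lam κ) := by
    linear_combination heq
  rw [h3, norm_neg, norm_mul, norm_evenPow_of_ne h0.ne', abs_of_pos h0, Complex.add_re,
    Real.rpow_add h0] at hb
  simp only [Complex.re_ofNat, Real.rpow_two] at hb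
  have hp : 0 < κ ^ lam.re := by positivity
  have h4 : ‖a 0‖ ≤ C * κ ^ 2 := by
    refine le_of_mul_le_mul_right ?_ hp
    linarith
  nlinarith

/-- `f` with derivatives `f₁, f₂, f₃` solves on `(0, 1)` the third order differential equation
satisfied by `evenMean s`. -/
structure IsSol (s : ℂ) (f f1 f2 f3 : ℝ → ℂ) : Prop where
  deriv0 : ∀ κ ∈ Set.Ioo (0 : ℝ) 1, HasDerivAt f (f1 κ) κ
  deriv1 : ∀ κ ∈ Set.Ioo (0 : ℝ) 1, HasDerivAt f1 (f2 κ) κ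
  deriv2 : ∀ κ ∈ Set.Ioo (0 : ℝ) 1, HasDerivAt f2 (f3 κ) κ
  ode : ∀ κ ∈ Set.Ioo (0 : ℝ) 1, s ^ 3 * f κ - (3 * s ^ 2 - 3 * s + 1) * κ * f1 κ
    + (3 * s - 3) * κ ^ 2 * f2 κ - κ ^ 3 * f3 κ = (s - 1) * f2 κ - κ * f3 κ

lemma IsSol.sub {s : ℂ} {f f1 f2 f3 g g1 g2 g3 : ℝ → ℂ} (hf : IsSol s f f1 f2 f3)
    (hg : IsSol s g g1 g2 g3) :
    IsSol s (fun x => f x - g x) (fun x => f1 x - g1 x) (fun x => f2 x - g2 x)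
      (fun x => f3 x - g3 x) where
  deriv0 κ h := (hf.deriv0 κ h).sub (hg.deriv0 κ h)
  deriv1 κ h := (hf.deriv1 κ h).sub (hg.deriv1 κ h)
  deriv2 κ h := (hf.deriv2 κ h).sub (hg.deriv2 κ h)
  ode κ h := by linear_combination hf.ode κ h - hg.ode κ h

lemma IsSol.const_mul {s : ℂ} {f f1 f2 f3 : ℝ → ℂ} (hf : IsSol s f f1 f2 f3) (c : ℂ) :
    IsSol s (fun x => c * f x) (fun x => c * f1 x) (fun x => c * f2 x) (fun x => c * f3 x) where
  deriv0 κ h := (hf.deriv0 κ h).const_mul c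
  deriv1 κ h := (hf.deriv1 κ h).const_mul c
  deriv2 κ h := (hf.deriv2 κ h).const_mul c
  ode κ h := by linear_combination c * hf.ode κ h

lemma norm_le_mul_of_tendsto_zero {g g' : ℝ → ℂ} {κ B : ℝ}
    (hκ : 0 < κ) (h0 : Filter.Tendsto g (nhdsWithin 0 (Set.Ioi 0)) (nhds 0))
    (hd : ∀ x, 0 < x → x ≤ κ → HasDerivAt g (g' x) x) (hB : ∀ x, 0 < x → x ≤ κ → ‖g' x‖ ≤ B) :
    ‖g κ‖ ≤ B * κ := by
  have hB0 : 0 ≤ B := (norm_nonneg _).trans (hB κ hκ le_rfl)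
  have h1 : Filter.Tendsto (fun ε => ‖g κ - g ε‖) (nhdsWithin 0 (Set.Ioi 0)) (nhds ‖g κ - 0‖) :=
    (h0.const_sub (g κ)).norm
  rw [sub_zero] at h1
  refine le_of_tendsto h1 ?_
  filter_upwards [Ioo_mem_nhdsGT hκ] with ε hε
  refine ((convex_Icc ε κ).norm_image_sub_le_of_norm_hasDerivWithin_le (f' := g')
    (fun x hx => (hd x (hε.1.trans_le hx.1) hx.2).hasDerivWithinAt)
    (fun x hx => hB x (hε.1.trans_le hx.1) hx.2) (Set.left_mem_Icc.2 hε.2.le)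
    (Set.right_mem_Icc.2 hε.2.le)).trans ?_
  rw [Real.norm_eq_abs, abs_of_pos (by linarith [hε.2])]
  gcongr
  linarith [hε.1]

/-- If `‖h'‖ ≤ B κ ^ (2 - σ)` on `(0, κ₂]` and `h κ₂ = 0`, then `‖h‖ ≤ B κ ^ (3 - σ) / (σ - 3)`. -/
lemma norm_le_rpow_of_deriv {h h' : ℝ → ℂ} {κ₂ B σ : ℝ} (hσ : 3 < σ) (hB0 : 0 ≤ B)
    (hd : ∀ x, 0 < x → x ≤ κ₂ → HasDerivAt h (h' x) x)
    (hB : ∀ x, 0 < x → x ≤ κ₂ → ‖h' x‖ ≤ B * x ^ (2 - σ)) (hz : h κ₂ = 0) {κ : ℝ} (hκ : 0 < κ)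
    (hκ2 : κ ≤ κ₂) : ‖h κ‖ ≤ B * κ ^ (3 - σ) / (σ - 3) := by
  have hneg : ∀ x ∈ Set.Icc (-κ₂) (-κ), 0 < -x ∧ -x ≤ κ₂ := fun x hx =>
    ⟨by linarith [hx.2], by linarith [hx.1]⟩
  have hd' : ∀ x ∈ Set.Icc (-κ₂) (-κ), HasDerivAt (fun x => h (-x)) (-(h' (-x))) x := by
    intro x hx
    have := (hd (-x) (hneg x hx).1 (hneg x hx).2).scomp x (hasDerivAt_neg x)
    simpa [Function.comp_def] using this
  have hB' : ∀ x ∈ Set.Icc (-κ₂) (-κ),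
      HasDerivAt (fun x : ℝ => B * (-x) ^ (3 - σ) / (σ - 3)) (B * (-x) ^ (2 - σ)) x := by
    intro x hx
    have h1 := ((hasDerivAt_neg x).rpow_const (p := 3 - σ) (Or.inl (hneg x hx).1.ne')).const_mul B
    refine (h1.div_const (σ - 3)).congr_deriv ?_
    have : σ - 3 ≠ 0 := by linarith
    rw [show 3 - σ - 1 = 2 - σ by ring]
    field_simp; ring
  have key := image_norm_le_of_norm_deriv_right_le_deriv_boundary' (f := fun x => h (-x))
    (a := -κ₂) (b := -κ)
    (fun x hx => (hd' x hx).continuousAt.continuousWithinAt)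
    (fun x hx => (hd' x (Set.Ico_subset_Icc_self hx)).hasDerivWithinAt)
    (B := fun x : ℝ => B * (-x) ^ (3 - σ) / (σ - 3)) (B' := fun x => B * (-x) ^ (2 - σ))
    (by
      have h2 : 0 ≤ κ₂ := hκ.le.trans hκ2
      have h3 : 0 < σ - 3 := by linarith
      simp only [neg_neg, hz, norm_zero]
      positivity)
    (fun x hx => (hB' x hx).continuousAt.continuousWithinAt)
    (fun x hx => (hB' x (Set.Ico_subset_Icc_self hx)).hasDerivWithinAt)
    (fun x hx => by
      have := hneg x (Set.Ico_subset_Icc_self hx)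
      simpa using hB (-x) this.1 this.2)
    (Set.right_mem_Icc.2 (by linarith : -κ₂ ≤ -κ))
  simpa using key

lemma IsSol.bound_deriv2_half {s : ℂ} (hs : 3 < s.re) : ∃ δ, 0 < δ ∧ δ < 1 ∧
    ∀ {f f1 f2 f3 : ℝ → ℂ}, IsSol s f f1 f2 f3 →
    Filter.Tendsto f (nhdsWithin 0 (Set.Ioi 0)) (nhds 0) →
    Filter.Tendsto f1 (nhdsWithin 0 (Set.Ioi 0)) (nhds 0) → ∀ κ₂ M : ℝ, 0 < κ₂ → κ₂ < δ →
    (∀ κ, 0 < κ → κ ≤ κ₂ → ‖f2 κ‖ ≤ M) → f2 κ₂ = 0 → ∀ κ, 0 < κ → κ ≤ κ₂ → ‖f2 κ‖ ≤ M / 2 := by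
  set K' := ‖s ^ 3‖ + ‖3 * s ^ 2 - 3 * s + 1‖ + ‖2 - 2 * s‖ with hK'
  have hK0 : 0 ≤ K' := by positivity
  set c := s.re - 3 with hc
  have hc0 : 0 < c := by rw [hc]; linarith
  refine ⟨min (1 / 2) (c / (4 * (K' + 1))), by positivity, (min_le_left _ _).trans_lt (by norm_num),
    fun {f f1 f2 f3} hf h0 h1 κ₂ M hκ₂ hδ hM hz κ hκ hκκ => ?_⟩
  have hk2 : κ₂ < 1 / 2 := hδ.trans_le (min_le_left _ _)
  have hk3 : κ₂ < c / (4 * (K' + 1)) := hδ.trans_le (min_le_right _ _)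
  have hM0 : 0 ≤ M := (norm_nonneg _).trans (hM κ₂ hκ₂ le_rfl)
  have m : ∀ x, 0 < x → x ≤ κ₂ → x ∈ Set.Ioo (0 : ℝ) 1 := fun x hx hx2 => ⟨hx, by linarith⟩
  have b1 : ∀ x, 0 < x → x ≤ κ₂ → ‖f1 x‖ ≤ M * x := fun x hx hx2 =>
    norm_le_mul_of_tendsto_zero hx h1 (fun y hy hy2 => hf.deriv1 y (m y hy (hy2.trans hx2)))
      fun y hy hy2 => hM y hy (hy2.trans hx2)
  have b0 : ∀ x, 0 < x → x ≤ κ₂ → ‖f x‖ ≤ M * x * x := fun x hx hx2 =>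
    norm_le_mul_of_tendsto_zero hx h0 (fun y hy hy2 => hf.deriv0 y (m y hy (hy2.trans hx2)))
      fun y hy hy2 => (b1 y hy (hy2.trans hx2)).trans (by gcongr)
  have hder : ∀ x, 0 < x → x ≤ κ₂ → HasDerivAt (fun x => evenPow (1 - s) x * f2 x)
      (evenPow (1 - s) x * ((-s ^ 3 * f x + (3 * s ^ 2 - 3 * s + 1) * x * f1 x
        + (2 - 2 * s) * x ^ 2 * f2 x) / (x * (1 - x ^ 2)))) x := by
    intro x hx hx2
    refine ((hasDerivAt_evenPow_of_ne hx.ne' (1 - s)).mul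
      (hf.deriv2 x (m x hx hx2))).congr_deriv ?_
    have e1 : evenPow (1 - s) x = x * oddPow (1 - s - 1) x := by
      rw [mul_oddPow, sub_add_cancel]
    have e2 : (x : ℂ) ≠ 0 := by exact_mod_cast hx.ne'
    have e3 : (1 : ℂ) - x ^ 2 ≠ 0 := by
      have : (1 : ℝ) - x ^ 2 ≠ 0 := by nlinarith
      exact_mod_cast this
    rw [e1]
    field_simp
    linear_combination oddPow (1 - s - 1) x * hf.ode x (m x hx hx2)
  have hbd : ∀ x, 0 < x → x ≤ κ₂ → ‖evenPow (1 - s) x * ((-s ^ 3 * f x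
        + (3 * s ^ 2 - 3 * s + 1) * x * f1 x
        + (2 - 2 * s) * x ^ 2 * f2 x) / (x * (1 - x ^ 2)))‖ ≤ 2 * K' * M * x ^ (2 - s.re) := by
    intro x hx hx2
    have hden : ‖(x : ℂ) * (1 - x ^ 2)‖ = x * (1 - x ^ 2) := by
      rw [show (x : ℂ) * (1 - x ^ 2) = ((x * (1 - x ^ 2) : ℝ) : ℂ) by push_cast; ring,
        Complex.norm_real, Real.norm_eq_abs, abs_of_nonneg]
      have : 0 ≤ 1 - x ^ 2 := by nlinarith
      positivity
    have hnum : ‖-s ^ 3 * f x + (3 * s ^ 2 - 3 * s + 1) * x * f1 x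
        + (2 - 2 * s) * x ^ 2 * f2 x‖ ≤ K' * (M * x ^ 2) := by
      refine (norm_add₃_le).trans ?_
      rw [norm_mul, norm_mul, norm_mul, norm_mul, norm_mul, norm_neg, norm_pow (x : ℂ),
        Complex.norm_real, Real.norm_eq_abs, abs_of_pos hx, hK']
      have := b0 x hx hx2
      have := b1 x hx hx2
      have := hM x hx hx2
      calc _ ≤ ‖s ^ 3‖ * (M * x * x) + ‖3 * s ^ 2 - 3 * s + 1‖ * x * (M * x)
          + ‖2 - 2 * s‖ * x ^ 2 * M := by gcongr
        _ = _ := by ring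
    have hx34 : 1 / 2 ≤ 1 - x ^ 2 := by nlinarith
    rw [norm_mul, norm_div, hden, norm_evenPow_of_ne hx.ne', abs_of_pos hx]
    have e : x ^ (2 - s.re) = x ^ (1 - s).re * x := by
      rw [← Real.rpow_add_one hx.ne']; congr 1; simp; ring
    rw [e]
    calc _ ≤ x ^ (1 - s).re * (K' * (M * x ^ 2) / (x * (1 / 2))) := by gcongr
      _ = _ := by field_simp
  have key := norm_le_rpow_of_deriv hs (by positivity) hder hbd (by simp [hz]) hκ hκκ
  rw [norm_mul, norm_evenPow_of_ne hκ.ne', abs_of_pos hκ] at key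
  have e : κ ^ (3 - s.re) = κ ^ (1 - s).re * κ ^ 2 := by
    rw [← Real.rpow_natCast, ← Real.rpow_add hκ]; congr 1; simp; ring
  rw [e] at key
  have hp : 0 < κ ^ (1 - s).re := by positivity
  have key2 : ‖f2 κ‖ ≤ 2 * K' * M * κ ^ 2 / c := by
    refine le_of_mul_le_mul_left (key.trans (le_of_eq ?_)) hp
    ring
  refine key2.trans ?_
  rw [div_le_div_iff₀ hc0 two_pos]
  have h5 : 4 * (K' + 1) * κ ≤ c := by
    have := (lt_div_iff₀ (by positivity)).1 hk3
    nlinarith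
  have h6 : 4 * K' * κ ^ 2 ≤ c := by nlinarith
  nlinarith

lemma IsSol.eq_zero_near {s : ℂ} (hs : 3 < s.re) : ∃ δ, 0 < δ ∧ δ < 1 ∧
    ∀ {f f1 f2 f3 : ℝ → ℂ}, IsSol s f f1 f2 f3 →
    Filter.Tendsto f (nhdsWithin 0 (Set.Ioi 0)) (nhds 0) →
    Filter.Tendsto f1 (nhdsWithin 0 (Set.Ioi 0)) (nhds 0) → ∀ κ₂ M : ℝ, 0 < κ₂ → κ₂ < δ →
    (∀ κ, 0 < κ → κ ≤ κ₂ → ‖f2 κ‖ ≤ M) → f2 κ₂ = 0 →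
    ∀ κ, 0 < κ → κ ≤ κ₂ → f κ = 0 ∧ f1 κ = 0 ∧ f2 κ = 0 := by
  obtain ⟨δ, hδ0, hδ1, hδ⟩ := IsSol.bound_deriv2_half hs
  refine ⟨δ, hδ0, hδ1, fun {f f1 f2 f3} hf h0 h1 κ₂ M hκ₂ hκδ hM hz => ?_⟩
  have hn : ∀ n : ℕ, ∀ κ, 0 < κ → κ ≤ κ₂ → ‖f2 κ‖ ≤ M / 2 ^ n := by
    intro n
    induction n with
    | zero => simpa using hM
    | succ n ih =>
      have := hδ hf h0 h1 κ₂ _ hκ₂ hκδ ih hz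
      rwa [div_div, ← pow_succ] at this
  have z2 : ∀ κ, 0 < κ → κ ≤ κ₂ → f2 κ = 0 := by
    intro κ h h'
    have ht : Filter.Tendsto (fun n : ℕ => M / 2 ^ n) Filter.atTop (nhds 0) := by
      have := (tendsto_pow_atTop_nhds_zero_of_lt_one (r := (1 / 2 : ℝ)) (by norm_num)
        (by norm_num)).const_mul M
      simpa [div_eq_mul_inv] using this
    exact norm_le_zero_iff.1 (ge_of_tendsto' ht fun n => hn n κ h h')
  have m : ∀ x, 0 < x → x ≤ κ₂ → x ∈ Set.Ioo (0 : ℝ) 1 := fun x hx hx2 => ⟨hx, by linarith⟩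
  have z1 : ∀ κ, 0 < κ → κ ≤ κ₂ → f1 κ = 0 := fun κ h h' => by
    have := norm_le_mul_of_tendsto_zero (B := 0) h h1
      (fun y hy hy2 => hf.deriv1 y (m y hy (hy2.trans h')))
      fun y hy hy2 => by simp [z2 y hy (hy2.trans h')]
    simpa using this
  refine fun κ h h' => ⟨?_, z1 κ h h', z2 κ h h'⟩
  have := norm_le_mul_of_tendsto_zero (B := 0) h h0
      (fun y hy hy2 => hf.deriv0 y (m y hy (hy2.trans h')))
      fun y hy hy2 => by simp [z1 y hy (hy2.trans h')]
  simpa using this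

lemma IsSol.eq_zero_of_initial {s : ℂ} {f f1 f2 f3 : ℝ → ℂ} (hf : IsSol s f f1 f2 f3) {κ₂ : ℝ}
    (h0 : 0 < κ₂) (hz : f κ₂ = 0) (hz1 : f1 κ₂ = 0) (hz2 : f2 κ₂ = 0) {ρ : ℝ}
    (hρ : κ₂ ≤ ρ) (hρ1 : ρ < 1) : f ρ = 0 := by
  set A := (‖s ^ 3‖ + ‖3 * s ^ 2 - 3 * s + 1‖ + ‖3 * s - 3‖ + ‖s - 1‖) / (κ₂ * (1 - ρ ^ 2)) with hA
  have hρ2 : 0 < 1 - ρ ^ 2 := by nlinarith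
  have m : ∀ x ∈ Set.Icc κ₂ ρ, x ∈ Set.Ioo (0 : ℝ) 1 := fun x hx =>
    ⟨by linarith [hx.1], by linarith [hx.2]⟩
  have hd : ∀ x ∈ Set.Icc κ₂ ρ, HasDerivAt (fun x => (f x, f1 x, f2 x)) (f1 x, f2 x, f3 x) x :=
    fun x hx => (hf.deriv0 x (m x hx)).prodMk
      ((hf.deriv1 x (m x hx)).prodMk (hf.deriv2 x (m x hx)))
  have key := eq_zero_of_abs_deriv_le_mul_abs_self_of_eq_zero_right (K := 1 + A)
    (f := fun x => (f x, f1 x, f2 x)) (f' := fun x => (f1 x, f2 x, f3 x)) (a := κ₂) (b := ρ)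
    (fun x hx => (hd x hx).continuousAt.continuousWithinAt)
    (fun x hx => (hd x (Set.Ico_subset_Icc_self hx)).hasDerivWithinAt)
    (by simp [hz, hz1, hz2]) (fun x hx => by
      have hxm := m x (Set.Ico_subset_Icc_self hx)
      set N := ‖(f x, f1 x, f2 x)‖ with hN
      have n0 : ‖f x‖ ≤ N := norm_fst_le (f x, f1 x, f2 x)
      have n1 : ‖f1 x‖ ≤ N := (norm_fst_le (f1 x, f2 x)).trans (norm_snd_le (f x, f1 x, f2 x))
      have n2 : ‖f2 x‖ ≤ N := (norm_snd_le (f1 x, f2 x)).trans (norm_snd_le (f x, f1 x, f2 x))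
      have hN0 : 0 ≤ N := norm_nonneg _
      have hA0 : 0 ≤ A := by positivity
      have n3 : ‖f3 x‖ ≤ A * N := by
        have e := hf.ode x hxm
        have e2 : ((x * (1 - x ^ 2) : ℝ) : ℂ) * f3 x = -(s ^ 3) * f x
          + (3 * s ^ 2 - 3 * s + 1) * x * f1 x + (-(3 * s - 3)) * x ^ 2 * f2 x
          + (s - 1) * f2 x := by
          push_cast; linear_combination e
        have hx0 : 0 < x := hxm.1
        have hx2 : 1 - ρ ^ 2 ≤ 1 - x ^ 2 := by nlinarith [hx.2]
        have e3 : κ₂ * (1 - ρ ^ 2) * ‖f3 x‖ ≤ (‖s ^ 3‖ + ‖3 * s ^ 2 - 3 * s + 1‖ + ‖3 * s - 3‖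
          + ‖s - 1‖) * N := by
          calc κ₂ * (1 - ρ ^ 2) * ‖f3 x‖ ≤ x * (1 - x ^ 2) * ‖f3 x‖ := by
                gcongr
                exact hx.1
            _ = ‖((x * (1 - x ^ 2) : ℝ) : ℂ) * f3 x‖ := by
              rw [norm_mul, Complex.norm_real, Real.norm_eq_abs, abs_of_nonneg]
              exact mul_nonneg hx0.le (by linarith)
            _ ≤ ‖s ^ 3‖ * N + ‖3 * s ^ 2 - 3 * s + 1‖ * 1 * N + ‖3 * s - 3‖ * 1 ^ 2 * N
                + ‖s - 1‖ * N := by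
              rw [e2]
              refine (norm_add₄_le).trans ?_
              simp only [norm_mul, norm_neg, Complex.norm_real, norm_pow (x : ℂ), Real.norm_eq_abs,
                abs_of_pos hx0]
              have := hxm.2.le
              gcongr
            _ = _ := by ring
        rw [hA, div_mul_eq_mul_div, le_div_iff₀ (by positivity)]
        linarith
      refine norm_prod_le_iff.2 ⟨?_, norm_prod_le_iff.2 ⟨?_, ?_⟩⟩ <;> simp only <;> nlinarith)
    ρ (Set.right_mem_Icc.2 hρ)
  exact congrArg Prod.fst key

lemma isSol_evenMean {s : ℂ} (hs : 3 < s.re) :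
    IsSol s (evenMean s) (fun κ => s * oddMean (s - 1) κ)
      (fun κ => s * (s - 1) * evenMean (s - 2) κ)
      (fun κ => s * (s - 1) * (s - 2) * oddMean (s - 3) κ) where
  deriv0 κ _ := hasDerivAt_evenMean (by linarith) κ
  deriv1 κ _ := by
    have := (hasDerivAt_oddMean (s := s - 1) (by simp; linarith) κ).const_mul s
    rw [show s - 1 - 1 = s - 2 by ring] at this
    exact this.congr_deriv (by ring)
  deriv2 κ _ := by
    have := (hasDerivAt_evenMean (s := s - 2) (by simp; linarith) κ).const_mul (s * (s - 1))
    rw [show s - 2 - 1 = s - 3 by ring] at this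
    exact this.congr_deriv (by ring)
  ode κ _ := evenMean_ode hs κ

lemma isSol_powSer {a : ℕ → ℂ} (ha : UnitSummable a) {lam s : ℂ}
    (hind : lam * (lam - 1) * (lam - 1 - s) = 0)
    (hrec : ∀ n : ℕ, (lam + 2 * n + 2) * (lam + 2 * n + 1) * (lam + 2 * n + 1 - s) * a (n + 1) =
      (lam + 2 * n - s) ^ 3 * a n) :
    IsSol s (powSer a lam) (powSer (derivCoef lam a) (lam - 1))
      (powSer (derivCoef (lam - 1) (derivCoef lam a)) (lam - 2))
      (powSer (derivCoef (lam - 2) (derivCoef (lam - 1) (derivCoef lam a))) (lam - 3)) where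
  deriv0 κ h := hasDerivAt_powSer' ha lam h.1 h.2
  deriv1 κ h := by
    have := hasDerivAt_powSer' (ha.derivCoef lam) (lam - 1) h.1 h.2
    rwa [show lam - 1 - 1 = lam - 2 by ring] at this
  deriv2 κ h := by
    have := hasDerivAt_powSer' ((ha.derivCoef lam).derivCoef (lam - 1)) (lam - 2) h.1 h.2
    rwa [show lam - 2 - 1 = lam - 3 by ring] at this
  ode κ h := powSer_ode ha hind hrec h.1 h.2

lemma tendsto_powSer {a : ℕ → ℂ} (ha : UnitSummable a) {lam : ℂ} (hl : 0 < lam.re) :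
    Filter.Tendsto (powSer a lam) (nhdsWithin 0 (Set.Ioi 0)) (nhds 0) := by
  obtain ⟨C, -, hC⟩ := powSer_bound ha lam (ρ := 1 / 2) (by norm_num) (by norm_num)
  have h1 : Filter.Tendsto (fun κ : ℝ => C * κ ^ lam.re) (nhdsWithin 0 (Set.Ioi 0)) (nhds 0) := by
    have := ((Real.continuousAt_rpow_const 0 lam.re (Or.inr hl.le)).tendsto.mono_left
      (nhdsWithin_le_nhds (s := Set.Ioi 0))).const_mul C
    simpa [Real.zero_rpow hl.ne'] using this
  refine squeeze_zero_norm' ?_ h1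
  filter_upwards [Ioo_mem_nhdsGT (show (0 : ℝ) < 1 / 2 by norm_num)] with κ h
    using hC κ h.1 h.2.le

lemma powSer_of_head_eq_zero {a : ℕ → ℂ} (ha : UnitSummable a) (h : a 0 = 0) (lam : ℂ) {κ : ℝ}
    (h0 : 0 < κ) (h1 : κ < 1) : powSer a lam κ = powSer (fun n => a (n + 1)) (lam + 2) κ := by
  rw [powSer_eq_head_add ha lam h0 h1, h]; ring

lemma tendsto_powSer_zero {a : ℕ → ℂ} (ha : UnitSummable a) :
    Filter.Tendsto (powSer a 0) (nhdsWithin 0 (Set.Ioi 0)) (nhds (a 0)) := by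
  have h1 := (tendsto_powSer (ha.shift 1) (lam := 0 + 2) (by simp)).const_add (a 0)
  rw [add_zero] at h1
  refine h1.congr' ?_
  filter_upwards [Ioo_mem_nhdsGT (show (0 : ℝ) < 1 by norm_num)] with κ h
  rw [powSer_eq_head_add ha 0 h.1 h.2, evenPow_exp_zero h.1.ne']; ring

/-- Near the origin `evenMean s` combines the regular solution and the one of exponent `s + 1`. -/
lemma exists_evenMean_eq {s : ℂ} (hs : 3 < s.re) (hodd : ∀ n : ℤ, s ≠ 2 * n + 1) :
    ∃ C : ℂ, ∀ κ ∈ Set.Ioo (0 : ℝ) 1, evenMean s κ =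
      arcMoment s ^ 2 * powSer (regCoef s) 0 κ + C * powSer (singCoef s) (s + 1) κ := by
  have hr := unitSummable_regCoef hodd
  have hg := unitSummable_singCoef (s := s) (by linarith)
  have hV := isSol_evenMean hs
  have hF := isSol_powSer hr (lam := 0) (s := s) (by ring) (regCoef_rec hodd)
  have hG := isSol_powSer hg (lam := s + 1) (s := s) (by ring) (singCoef_rec (by linarith))
  obtain ⟨δ, hδ0, hδ1, hδ⟩ := IsSol.eq_zero_near hs
  obtain ⟨δ', hδ0', hδ1', hδ'⟩ := powSer_ne_zero
    ((hg.derivCoef (s + 1)).derivCoef (s + 1 - 1)) (s + 1 - 2) (by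
      have h0 : s ≠ 0 := fun h => by simp [h] at hs; linarith
      have h1 : s + 1 ≠ 0 := fun h => by
        have := congrArg Complex.re h
        simp at this; linarith
      simp [derivCoef, singCoef, hypCoef_zero, h0, h1])
  set κ₂ := min δ δ' / 2 with hκ₂
  have hm : 0 < min δ δ' := lt_min hδ0 hδ0'
  have hκ0 : 0 < κ₂ := by positivity
  have hκδ : κ₂ < δ := by have := min_le_left δ δ'; linarith
  have hκδ' : κ₂ < δ' := by have := min_le_right δ δ'; linarith
  set A := arcMoment s ^ 2 with hA
  have hne := hδ' κ₂ hκ0 hκδ'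
  set C := (s * (s - 1) * evenMean (s - 2) κ₂ -
    A * powSer (derivCoef (0 - 1) (derivCoef 0 (regCoef s))) (0 - 2) κ₂) /
    powSer (derivCoef (s + 1 - 1) (derivCoef (s + 1) (singCoef s))) (s + 1 - 2) κ₂ with hC
  have hsol := (hV.sub (hF.const_mul A)).sub (hG.const_mul C)
  have ev : ∀ᶠ κ : ℝ in nhdsWithin 0 (Set.Ioi 0), 0 < κ ∧ κ < 1 :=
    Ioo_mem_nhdsGT (show (0 : ℝ) < 1 by norm_num)
  have t0 : Filter.Tendsto (fun x => evenMean s x - A * powSer (regCoef s) 0 x -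
      C * powSer (singCoef s) (s + 1) x) (nhdsWithin 0 (Set.Ioi 0)) (nhds 0) := by
    have a1 := ((hasDerivAt_evenMean (s := s) (by linarith) 0).continuousAt.tendsto.mono_left
      (nhdsWithin_le_nhds (s := Set.Ioi 0)))
    have a2 := (tendsto_powSer_zero hr).const_mul A
    have a3 := (tendsto_powSer hg (lam := s + 1) (by simp; linarith)).const_mul C
    have := (a1.sub a2).sub a3
    rw [evenMean_zero (by linarith), show regCoef s 0 = 1 from hypCoef_zero _ _ _, ← hA] at this
    simpa using this
  have t1 : Filter.Tendsto (fun x => s * oddMean (s - 1) x -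
      A * powSer (derivCoef 0 (regCoef s)) (0 - 1) x -
      C * powSer (derivCoef (s + 1) (singCoef s)) (s + 1 - 1) x)
      (nhdsWithin 0 (Set.Ioi 0)) (nhds 0) := by
    have a1 := ((hasDerivAt_oddMean (s := s - 1)
      (by simp; linarith) 0).continuousAt.tendsto.mono_left (nhdsWithin_le_nhds (s := Set.Ioi 0))).const_mul s
    have a2' : Filter.Tendsto (powSer (derivCoef 0 (regCoef s)) (0 - 1))
        (nhdsWithin 0 (Set.Ioi 0)) (nhds 0) := by
      refine (tendsto_powSer ((hr.derivCoef 0).shift 1) (lam := 0 - 1 + 2)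
        (by norm_num)).congr' ?_
      filter_upwards [ev] with κ h
      rw [powSer_of_head_eq_zero (hr.derivCoef 0) (derivCoef_regCoef_zero s) _ h.1 h.2]
    have a2 := a2'.const_mul A
    have a3 := (tendsto_powSer (hg.derivCoef (s + 1)) (lam := s + 1 - 1)
      (by simp; linarith)).const_mul C
    have := (a1.sub a2).sub a3
    rw [oddMean_zero] at this
    simpa using this
  have hb : ∃ M, ∀ κ, 0 < κ → κ ≤ κ₂ → ‖s * (s - 1) * evenMean (s - 2) κ -
      A * powSer (derivCoef (0 - 1) (derivCoef 0 (regCoef s))) (0 - 2) κ -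
      C * powSer (derivCoef (s + 1 - 1) (derivCoef (s + 1) (singCoef s))) (s + 1 - 2) κ‖ ≤ M := by
    have hκ1 : κ₂ < 1 := by linarith
    have hc : Continuous (evenMean (s - 2)) := continuous_iff_continuousAt.2 fun κ =>
      (hasDerivAt_evenMean (s := s - 2) (by simp; linarith) κ).continuousAt
    obtain ⟨M1, h1⟩ := (isCompact_Icc (a := 0) (b := κ₂)).exists_bound_of_continuousOn
      hc.continuousOn
    have hr2 := (hr.derivCoef 0).derivCoef (0 - 1)
    obtain ⟨M2, h20, h2⟩ := powSer_bound (hr2.shift 1) (0 - 2 + 2) hκ0 hκ1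
    obtain ⟨M3, h30, h3⟩ := powSer_bound ((hg.derivCoef (s + 1)).derivCoef (s + 1 - 1)) (s + 1 - 2)
      hκ0 hκ1
    refine ⟨‖s * (s - 1)‖ * M1 + ‖A‖ * M2 + ‖C‖ * M3, fun κ h h' => ?_⟩
    refine (norm_sub_le _ _).trans (add_le_add ((norm_sub_le _ _).trans (add_le_add ?_ ?_)) ?_)
    · rw [norm_mul]; gcongr; exact h1 κ ⟨h.le, h'⟩
    · rw [norm_mul, powSer_of_head_eq_zero hr2
        (by rw [derivCoef, derivCoef_regCoef_zero, mul_zero]) _ h (by linarith)]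
      gcongr
      simpa using h2 κ h h'
    · rw [norm_mul]
      gcongr
      refine (h3 κ h h').trans (mul_le_of_le_one_right h30 ?_)
      exact Real.rpow_le_one h.le (by linarith) (by simp; linarith)
  obtain ⟨M, hM⟩ := hb
  have key := hδ hsol t0 t1 κ₂ M hκ0 hκδ hM (by
    simp only [hC]
    rw [div_mul_cancel₀ _ hne]; ring)
  refine ⟨C, fun κ hκ => ?_⟩
  have hz : evenMean s κ - A * powSer (regCoef s) 0 κ - C * powSer (singCoef s) (s + 1) κ = 0 := by
    rcases le_total κ κ₂ with h | h
    · exact (key κ hκ.1 h).1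
    · have k2 := key κ₂ hκ0 le_rfl
      exact hsol.eq_zero_of_initial hκ0 k2.1 k2.2.1 k2.2.2 h hκ.2
  linear_combination hz

lemma ae_arcLaw_ne (c : ℝ) : ∀ᵐ x ∂arcLaw, x ≠ c := by
  rw [arcLaw, ae_map_iff Real.continuous_cos.aemeasurable (p := fun x => x ≠ c)
    (measurableSet_singleton c).compl]
  have hcount : {θ : ℝ | Real.cos θ = c}.Countable := by
    rcases Set.eq_empty_or_nonempty {θ : ℝ | Real.cos θ = c} with h | ⟨θ₀, h0⟩
    · simp [h]
    · refine ((Set.countable_range fun k : ℤ => 2 * k * π + θ₀).union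
        (Set.countable_range fun k : ℤ => 2 * k * π - θ₀)).mono fun θ hθ => ?_
      obtain ⟨k, hk | hk⟩ := Real.cos_eq_cos_iff.1 ((h0 : Real.cos θ₀ = c).trans
        (hθ : Real.cos θ = c).symm)
      · exact Or.inl ⟨k, hk.symm⟩
      · exact Or.inr ⟨k, hk.symm⟩
  refine Measure.ae_smul_measure (ae_restrict_of_ae ?_) _
  exact (ae_iff.2 (by simpa using hcount.measure_zero volume))

lemma ae_prodLaw_ne (y : ℝ) : ∀ᵐ x ∂prodLaw, x ≠ y := by
  rcases eq_or_ne y 0 with rfl | hy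
  · exact ae_prodLaw_ne_zero
  rw [prodLaw, ae_map_iff (by fun_prop) (p := fun x => x ≠ y) (measurableSet_singleton y).compl]
  have hm : MeasurableSet {p : ℝ × ℝ | p.1 * p.2 = y} :=
    measurableSet_eq_fun (by fun_prop) measurable_const
  have h0 : arcLaw.prod arcLaw {p : ℝ × ℝ | p.1 * p.2 = y} = 0 := by
    rw [Measure.measure_prod_null hm]
    filter_upwards with a
    have h1 := ae_iff.1 (ae_arcLaw_ne (y / a))
    refine measure_mono_null (fun b (hb : a * b = y) => ?_) h1
    have ha : a ≠ 0 := fun h => hy (by rw [← hb, h, zero_mul])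
    simp [← hb, ha]
  rw [ae_iff]
  simpa using h0

lemma tendsto_symm_quot {f : ℝ → ℂ} {D : ℂ} {κ : ℝ} (h : HasDerivAt f D κ) :
    Filter.Tendsto (fun t : ℝ => (2 * t)⁻¹ • (f (κ + t) - f (κ - t))) (nhdsWithin 0 {0}ᶜ)
      (nhds D) := by
  have h1 : HasDerivAt (fun t : ℝ => f (κ + t)) D 0 := by
    have := HasDerivAt.comp_const_add κ 0 (by simpa using h)
    simpa using this
  have h2 : HasDerivAt (fun t : ℝ => f (κ - t)) (-D) 0 := by
    have := HasDerivAt.comp_const_sub κ 0 (by simpa using h)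
    simpa using this
  have h3 := (hasDerivAt_iff_tendsto_slope_zero.1 (h1.sub h2)).const_smul (2⁻¹ : ℝ)
  have e : (2⁻¹ : ℝ) • (D - -D) = D := by
    rw [sub_neg_eq_add, ← two_smul ℝ D, smul_smul]; norm_num
  rw [e] at h3
  refine h3.congr fun t => ?_
  simp only [Pi.sub_apply, zero_add, add_zero, sub_zero, sub_self, smul_smul, mul_inv]

lemma oddPow_mul (s : ℂ) (a y : ℝ) : oddPow s (a * y) = oddPow s a * oddPow s y := by
  rw [oddPow, evenPow_mul, oddPow, oddPow]; push_cast; ring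

lemma oddPow_one (s : ℂ) : oddPow s 1 = 1 := by
  rw [oddPow_of_pos one_pos, evenPow_of_ne one_ne_zero]; simp

lemma norm_oddPow_symm_sub_le {s : ℂ} (h1 : -1 < s.re) (h0 : s.re ≤ 0) :
    ∃ C, 0 ≤ C ∧ ∀ y t : ℝ, y ≠ 0 →
      ‖oddPow (s + 1) (y + t) - oddPow (s + 1) (y - t)‖ ≤ C * |t| * |y| ^ s.re := by
  set B := ‖s + 1‖ * (1 / 2 : ℝ) ^ s.re with hB
  have hB0 : 0 ≤ B := by positivity
  have hre : (s + 1).re = s.re + 1 := by simp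
  have base : ∀ t : ℝ, 0 ≤ t → ‖oddPow (s + 1) (1 + t) - oddPow (s + 1) (1 - t)‖
      ≤ (2 * B + 6) * t := by
    intro t ht
    rcases le_total t (1 / 2) with h | h
    · have := (convex_Icc (1 / 2 : ℝ) (3 / 2)).norm_image_sub_le_of_norm_hasDerivWithin_le
        (f := oddPow (s + 1)) (f' := fun x => (s + 1) * evenPow (s + 1 - 1) x) (C := B)
        (fun x hx => (hasDerivAt_oddPow_of_ne (by linarith [hx.1]) (s + 1)).hasDerivWithinAt)
        (fun x hx => by
          have hx0 : 0 < x := by linarith [hx.1]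
          rw [norm_mul, add_sub_cancel_right, norm_evenPow_of_ne hx0.ne', abs_of_pos hx0, hB]
          gcongr ?_ * ?_
          exact Real.rpow_le_rpow_of_nonpos (by norm_num) hx.1 h0)
        (x := 1 - t) (y := 1 + t) ⟨by linarith, by linarith⟩ ⟨by linarith, by linarith⟩
      rw [show 1 + t - (1 - t) = 2 * t by ring, Real.norm_eq_abs, abs_of_nonneg (by linarith)]
        at this
      linarith
    · have b : ∀ z : ℝ, |z| ≤ 1 + t → ‖oddPow (s + 1) z‖ ≤ 1 + t := fun z hz => by
        refine (norm_oddPow_le _ _).trans ?_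
        rw [hre]
        refine (Real.rpow_le_rpow (abs_nonneg _) hz (by linarith)).trans ?_
        exact (Real.rpow_le_rpow_of_exponent_le (by linarith : 1 ≤ 1 + t)
          (by linarith : s.re + 1 ≤ 1)).trans (by rw [Real.rpow_one])
      have b1 := b (1 + t) (abs_of_nonneg (by linarith)).le
      have b2 := b (1 - t) (abs_le.2 ⟨by linarith, by linarith⟩)
      have := norm_sub_le (oddPow (s + 1) (1 + t)) (oddPow (s + 1) (1 - t))
      nlinarith
  have base' : ∀ t : ℝ, ‖oddPow (s + 1) (1 + t) - oddPow (s + 1) (1 - t)‖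
      ≤ (2 * B + 6) * |t| := by
    intro t
    rcases le_total 0 t with h | h
    · rw [abs_of_nonneg h]; exact base t h
    · rw [abs_of_nonpos h, norm_sub_rev]
      simpa [sub_eq_add_neg] using base (-t) (by linarith)
  refine ⟨2 * B + 6, by positivity, fun y t hy => ?_⟩
  have e1 : y + t = y * (1 + t / y) := by field_simp
  have e2 : y - t = y * (1 - t / y) := by field_simp
  rw [e1, e2, oddPow_mul, oddPow_mul, ← mul_sub, norm_mul, norm_oddPow_of_ne hy, hre,
    Real.rpow_add_one (abs_ne_zero.2 hy)]
  have hy' := abs_pos.2 hy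
  calc |y| ^ s.re * |y| * _ ≤ |y| ^ s.re * |y| * ((2 * B + 6) * |t / y|) := by
        gcongr; exact base' _
    _ = _ := by rw [abs_div]; field_simp

lemma evenPow_ofReal (σ y : ℝ) (hy : y ≠ 0) : evenPow (σ : ℂ) y = ((|y| ^ σ : ℝ) : ℂ) := by
  rw [evenPow_of_ne hy, Real.rpow_def_of_pos (abs_pos.2 hy), Real.log_abs]
  push_cast; ring_nf

lemma oddPow_ofReal_add_one (σ y : ℝ) : oddPow ((σ : ℂ) + 1) y = ((y * |y| ^ σ : ℝ) : ℂ) := by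
  rw [← mul_evenPow]
  rcases eq_or_ne y 0 with rfl | hy
  · simp
  · rw [evenPow_ofReal σ y hy]; push_cast; ring

lemma monotone_mul_abs_rpow {σ : ℝ} (hσ : -1 < σ) : Monotone fun y : ℝ => y * |y| ^ σ := by
  refine monotone_of_odd_of_monotoneOn_nonneg (fun y => by simp) ?_
  have e : Set.EqOn (fun y : ℝ => y ^ (σ + 1)) (fun y : ℝ => y * |y| ^ σ) (Set.Ici 0) := by
    intro y hy
    rcases (Set.mem_Ici.1 hy).eq_or_lt with h | h
    · simp [← h, Real.zero_rpow (by linarith : σ + 1 ≠ 0)]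
    · simp only [abs_of_pos h]; rw [Real.rpow_add_one h.ne']; ring
  refine MonotoneOn.congr ?_ e
  intro x hx y _ hxy
  exact Real.rpow_le_rpow hx hxy (by linarith)

lemma integral_symm_quot {s : ℂ} (hs : -1 < s.re) (κ t : ℝ) :
    Integrable (fun x => (2 * t)⁻¹ • (oddPow (s + 1) (κ + x + t) - oddPow (s + 1) (κ + x - t)))
      prodLaw ∧
    ∫ x, (2 * t)⁻¹ • (oddPow (s + 1) (κ + x + t) - oddPow (s + 1) (κ + x - t)) ∂prodLaw =
      (2 * t)⁻¹ • (oddMean (s + 1) (κ + t) - oddMean (s + 1) (κ - t)) := by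
  have hc : Continuous (oddPow (s + 1)) := continuous_oddPow (by simp; linarith)
  have i1 : Integrable (fun x => oddPow (s + 1) (κ + x + t)) prodLaw :=
    integrable_prodLaw (hc.comp (by fun_prop))
  have i2 : Integrable (fun x => oddPow (s + 1) (κ + x - t)) prodLaw :=
    integrable_prodLaw (hc.comp (by fun_prop))
  refine ⟨(i1.sub i2).smul (2 * t)⁻¹, ?_⟩
  rw [integral_smul, integral_sub i1 i2, oddMean, oddMean]
  congr 3 <;> ext x <;> congr 1 <;> ring

lemma tendsto_one_div_nat_ne :
    Filter.Tendsto (fun n : ℕ => 1 / ((n : ℝ) + 1)) Filter.atTop (nhdsWithin 0 {0}ᶜ) :=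
  tendsto_nhdsWithin_iff.2 ⟨tendsto_one_div_add_atTop_nhds_zero_nat,
    Filter.Eventually.of_forall fun n => by
      have : (0 : ℝ) < 1 / ((n : ℝ) + 1) := by positivity
      exact this.ne'⟩

lemma integrable_of_hasDerivAt_oddMean {σ κ : ℝ} {D : ℂ} (hσ : -1 < σ)
    (hD : HasDerivAt (oddMean ((σ : ℂ) + 1)) D κ) :
    Integrable (fun x => |κ + x| ^ σ) prodLaw := by
  set Q : ℕ → ℝ → ℂ := fun n x => (2 * (1 / ((n : ℝ) + 1)))⁻¹ •
    (oddPow ((σ : ℂ) + 1) (κ + x + 1 / ((n : ℝ) + 1))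
      - oddPow ((σ : ℂ) + 1) (κ + x - 1 / ((n : ℝ) + 1))) with hQ
  have hs : -1 < (σ : ℂ).re := by simpa using hσ
  have hint := fun n : ℕ => integral_symm_quot hs κ (1 / ((n : ℝ) + 1))
  have hre : ∀ n x, ‖Q n x‖ = (Q n x).re := by
    intro n x
    have hp : 0 < 1 / ((n : ℝ) + 1) := by positivity
    simp only [hQ, oddPow_ofReal_add_one]
    rw [← Complex.ofReal_sub, Complex.real_smul, ← Complex.ofReal_mul, Complex.norm_real,
      Complex.ofReal_re, Real.norm_eq_abs, abs_of_nonneg]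
    refine mul_nonneg (by positivity) (sub_nonneg.2 (monotone_mul_abs_rpow hσ ?_))
    linarith
  have h := integrable_of_tendsto (μ := prodLaw) (G := fun n x => ‖Q n x‖)
    (f := fun x => ‖((σ : ℂ) + 1) * evenPow σ (κ + x)‖) ?_ ?_ ?_
  · have h2 := h.const_mul (‖(σ : ℂ) + 1‖)⁻¹
    refine h2.congr ?_
    filter_upwards [ae_prodLaw_ne (-κ)] with x hx
    have hx' : κ + x ≠ 0 := fun h => hx (by linarith)
    have hn : ‖(σ : ℂ) + 1‖ ≠ 0 := by
      rw [norm_ne_zero_iff]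
      intro h
      have := congrArg Complex.re h
      simp at this; linarith
    rw [norm_mul, norm_evenPow_of_ne hx', Complex.ofReal_re]
    field_simp
  · filter_upwards [ae_prodLaw_ne (-κ)] with x hx
    have hx' : κ + x ≠ 0 := fun h => hx (by linarith)
    have := hasDerivAt_oddPow_of_ne hx' ((σ : ℂ) + 1)
    rw [add_sub_cancel_right] at this
    exact ((tendsto_symm_quot this).comp tendsto_one_div_nat_ne).norm
  · exact fun n => (hint n).1.aestronglyMeasurable.norm
  · have hl : Filter.Tendsto (fun n => ∫⁻ x, ‖(‖Q n x‖)‖ₑ ∂prodLaw) Filter.atTop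
        (nhds (ENNReal.ofReal D.re)) := by
      have h1 := (Complex.continuous_re.tendsto D).comp
        ((tendsto_symm_quot hD).comp tendsto_one_div_nat_ne)
      refine (ENNReal.tendsto_ofReal h1).congr fun n => ?_
      have e1 : ∫ x, ‖Q n x‖ ∂prodLaw = (∫ x, Q n x ∂prodLaw).re := by
        simp only [hre]
        exact integral_re (hint n).1
      simp only [enorm_norm]
      rw [← ofReal_integral_norm_eq_lintegral_enorm (hint n).1, e1, (hint n).2]
      rfl
    rw [hl.liminf_eq]
    exact ENNReal.ofReal_ne_top

/-- Where `oddMean (s + 1)` is differentiable, its derivative is `(s + 1) * evenMean s`. -/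
lemma hasDerivAt_oddMean_unique {s : ℂ} {κ : ℝ} {D D' : ℂ} (h1 : -1 < s.re) (h0 : s.re ≤ 0)
    (hD : HasDerivAt (oddMean ((s.re : ℂ) + 1)) D κ) (hD' : HasDerivAt (oddMean (s + 1)) D' κ) :
    D' = (s + 1) * evenMean s κ := by
  have hi := integrable_of_hasDerivAt_oddMean h1 hD
  obtain ⟨C, hC0, hC⟩ := norm_oddPow_symm_sub_le h1 h0
  have hint := fun n : ℕ => integral_symm_quot h1 κ (1 / ((n : ℝ) + 1))
  have hlim := tendsto_integral_of_dominated_convergence (μ := prodLaw)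
    (F := fun (n : ℕ) x => (2 * (1 / ((n : ℝ) + 1)))⁻¹ •
      (oddPow (s + 1) (κ + x + 1 / ((n : ℝ) + 1)) - oddPow (s + 1) (κ + x - 1 / ((n : ℝ) + 1))))
    (f := fun x => (s + 1) * evenPow s (κ + x)) (fun x => C / 2 * |κ + x| ^ s.re)
    (fun n => (hint n).1.aestronglyMeasurable) (hi.const_mul _) ?_ ?_
  · have h2 := (tendsto_symm_quot hD').comp tendsto_one_div_nat_ne
    rw [integral_const_mul] at hlim
    refine tendsto_nhds_unique h2 (hlim.congr fun n => ?_)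
    rw [(hint n).2]; rfl
  · intro n
    filter_upwards [ae_prodLaw_ne (-κ)] with x hx
    have hx' : κ + x ≠ 0 := fun h => hx (by linarith)
    have hp : 0 < 1 / ((n : ℝ) + 1) := by positivity
    rw [norm_smul, Real.norm_eq_abs, abs_of_pos (by positivity)]
    refine (mul_le_mul_of_nonneg_left (hC (κ + x) (1 / ((n : ℝ) + 1)) hx')
      (by positivity)).trans (le_of_eq ?_)
    rw [abs_of_pos hp]
    field_simp
  · filter_upwards [ae_prodLaw_ne (-κ)] with x hx
    have hx' : κ + x ≠ 0 := fun h => hx (by linarith)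
    have := hasDerivAt_oddPow_of_ne hx' (s + 1)
    rw [add_sub_cancel_right] at this
    exact (tendsto_symm_quot this).comp tendsto_one_div_nat_ne

/-- The expansion of `evenMean s` at the origin, with coefficient `C` on the singular solution. -/
def HasExpansion (s C : ℂ) : Prop := ∀ κ ∈ Set.Ioo (0 : ℝ) 1, evenMean s κ =
  arcMoment s ^ 2 * powSer (regCoef s) 0 κ + C * powSer (singCoef s) (s + 1) κ

lemma not_odd_add_two {s : ℂ} (hodd : ∀ n : ℤ, s ≠ 2 * n + 1) (n : ℤ) : s + 2 ≠ 2 * n + 1 :=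
  fun h => hodd (n - 1) (by push_cast; linear_combination h)

lemma ofReal_not_odd {σ : ℝ} (hs : -1 < σ) (h0 : σ ≤ 0) (n : ℤ) : (σ : ℂ) ≠ 2 * n + 1 := by
  intro hn
  have := congrArg Complex.re hn
  simp at this
  rw [this] at h0 hs
  have a1 : (-1 : ℤ) < n := by exact_mod_cast (by linarith : (-1 : ℝ) < n)
  have a2 : n < (0 : ℤ) := by exact_mod_cast (by linarith : (n : ℝ) < 0)
  omega

lemma add_ne_zero_of_re {s : ℂ} {c : ℝ} (h : -c < s.re) : s + c ≠ 0 := fun h0 => by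
  have := congrArg Complex.re h0
  simp at this; linarith

lemma arcMoment_add_two {s : ℂ} (hs : -1 < s.re) :
    (s + 2) * arcMoment (s + 2) = (s + 1) * arcMoment s := by
  have h1 : s + 1 ≠ 0 := by exact_mod_cast add_ne_zero_of_re (c := 1) hs
  have h2 : s + 2 ≠ 0 := by exact_mod_cast add_ne_zero_of_re (s := s) (c := 2) (by linarith)
  have g1 : Complex.Gamma (1 / 2) ≠ 0 := Complex.Gamma_ne_zero_of_re_pos (by norm_num)
  have g2 : Complex.Gamma (s / 2 + 1) ≠ 0 := Complex.Gamma_ne_zero_of_re_pos (by simp; linarith)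
  rw [arcMoment, arcMoment, show (s + 2 + 1) / 2 = (s + 1) / 2 + 1 by ring,
    show (s + 2) / 2 + 1 = s / 2 + 1 + 1 by ring,
    Complex.Gamma_add_one _ (by simpa using h1), Complex.Gamma_add_one (s / 2 + 1)
      (fun h => h2 (by linear_combination 2 * h))]
  have h3 : s / 2 + 1 ≠ 0 := fun h => h2 (by linear_combination 2 * h)
  field_simp

lemma HasExpansion.hasDerivAt_oddMean {s C : ℂ} (h : HasExpansion (s + 2) C) (hs : -1 < s.re)
    (hodd : ∀ n : ℤ, s ≠ 2 * n + 1) {κ : ℝ} (hκ : κ ∈ Set.Ioo (0 : ℝ) 1) :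
    HasDerivAt (oddMean (s + 1)) ((s + 1) * (arcMoment s ^ 2 * powSer (regCoef s) 0 κ
      + C * (s + 3) / (s + 1) * powSer (singCoef s) (s + 1) κ)) κ := by
  have h1 : s + 1 ≠ 0 := by exact_mod_cast add_ne_zero_of_re (c := 1) hs
  have h2 : s + 2 ≠ 0 := by exact_mod_cast add_ne_zero_of_re (s := s) (c := 2) (by linarith)
  have hre : -1 < (s + 2).re := by simp; linarith
  have hr := unitSummable_regCoef (not_odd_add_two hodd)
  have hg := unitSummable_singCoef hre
  have e1 : ∀ x ∈ Set.Ioo (0 : ℝ) 1, oddMean (s + 1) x = (s + 2)⁻¹ *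
      (arcMoment (s + 2) ^ 2 * powSer (derivCoef 0 (regCoef (s + 2))) (0 - 1) x
        + C * powSer (derivCoef (s + 3) (singCoef (s + 2))) (s + 3 - 1) x) := by
    intro x hx
    have d1 := hasDerivAt_evenMean (s := s + 2) (by simp; linarith) x
    have d2 := ((hasDerivAt_powSer' hr 0 hx.1 hx.2).const_mul (arcMoment (s + 2) ^ 2)).add
      ((hasDerivAt_powSer' hg (s + 2 + 1) hx.1 hx.2).const_mul C)
    have d3 := d1.unique (d2.congr_of_eventuallyEq (by
      filter_upwards [isOpen_Ioo.mem_nhds hx] with y hy using h y hy))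
    rw [show s + 2 - 1 = s + 1 by ring, show s + 2 + 1 = s + 3 by ring] at d3
    rw [← d3]; field_simp
  have hd := (((hasDerivAt_powSer' (hr.derivCoef 0) (0 - 1) hκ.1 hκ.2).const_mul
      (arcMoment (s + 2) ^ 2)).add ((hasDerivAt_powSer' (hg.derivCoef (s + 3)) (s + 3 - 1)
      hκ.1 hκ.2).const_mul C)).const_mul (s + 2)⁻¹
  refine (hd.congr_of_eventuallyEq (by
      filter_upwards [isOpen_Ioo.mem_nhds hκ] with y hy using e1 y hy)).congr_deriv ?_
  have f1 : (s + 1) * powSer (derivCoef (0 - 1) (derivCoef 0 (regCoef (s + 2)))) (0 - 1 - 1) κ =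
      (s + 2) ^ 3 * powSer (regCoef s) 0 κ := by
    rw [powSer_of_head_eq_zero ((hr.derivCoef 0).derivCoef _)
      (by rw [derivCoef, derivCoef_regCoef_zero, mul_zero]) _ hκ.1 hκ.2, const_mul_powSer,
      const_mul_powSer]
    congr 1
    · ext n; exact regCoef_add_two hodd n
    · ring
  have f2 : powSer (derivCoef (s + 3 - 1) (derivCoef (s + 3) (singCoef (s + 2)))) (s + 3 - 1 - 1) κ
      = (s + 2) * (s + 3) * powSer (singCoef s) (s + 1) κ := by
    rw [const_mul_powSer]
    congr 1
    · ext n; exact singCoef_add_two hs n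
    · ring
  have f3 := arcMoment_add_two hs
  have f4 : arcMoment (s + 2) = (s + 1) * arcMoment s / (s + 2) := by
    rw [← f3]; field_simp
  have f5 : powSer (derivCoef (0 - 1) (derivCoef 0 (regCoef (s + 2)))) (0 - 1 - 1) κ =
      (s + 2) ^ 3 * powSer (regCoef s) 0 κ / (s + 1) := by
    rw [← f1]; field_simp
  rw [f5, f2, f4]
  field_simp

lemma HasExpansion.down {s C : ℂ} (h : HasExpansion (s + 2) C) (hs : -1 < s.re)
    (hodd : ∀ n : ℤ, s ≠ 2 * n + 1)
    (hd : s.re ≤ 0 → ∃ C', HasExpansion ((s.re : ℂ) + 2) C') :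
    HasExpansion s (C * (s + 3) / (s + 1)) := by
  intro κ hκ
  have h1 : s + 1 ≠ 0 := by exact_mod_cast add_ne_zero_of_re (c := 1) hs
  have h2 := h.hasDerivAt_oddMean hs hodd hκ
  rcases lt_or_ge 0 s.re with h0 | h0
  · have h3 := _root_.hasDerivAt_oddMean (s := s + 1) (by simp; linarith) κ
    rw [add_sub_cancel_right] at h3
    exact mul_left_cancel₀ h1 (h3.unique h2)
  · obtain ⟨C', hC'⟩ := hd h0
    have h3 := hC'.hasDerivAt_oddMean (s := (s.re : ℂ)) (by simpa using hs)
      (ofReal_not_odd hs h0) hκ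
    exact mul_left_cancel₀ h1 (hasDerivAt_oddMean_unique hs h0 h3 h2).symm

lemma exists_hasExpansion_add_two {s : ℂ} (hs : -1 < s.re) (hodd : ∀ n : ℤ, s ≠ 2 * n + 1) :
    ∃ C, HasExpansion (s + 2) C := by
  obtain ⟨C, hC⟩ := exists_evenMean_eq (s := s + 2 + 2) (by simp; linarith)
    (not_odd_add_two (not_odd_add_two hodd))
  exact ⟨_, HasExpansion.down (C := C) hC (by simp; linarith) (not_odd_add_two hodd) fun h => by
    simp at h; linarith⟩

lemma exists_hasExpansion {s : ℂ} (hs : -1 < s.re) (hodd : ∀ n : ℤ, s ≠ 2 * n + 1) :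
    ∃ C, HasExpansion s C := by
  obtain ⟨C, hC⟩ := exists_hasExpansion_add_two hs hodd
  refine ⟨_, hC.down hs hodd fun h0 => ?_⟩
  exact exists_hasExpansion_add_two (by simpa using hs) (ofReal_not_odd hs h0)

lemma HasExpansion.unique {s C C' : ℂ} (h : HasExpansion s C) (h' : HasExpansion s C')
    (hs : -1 < s.re) : C = C' := by
  obtain ⟨δ, hδ0, hδ1, hδ⟩ := powSer_ne_zero (unitSummable_singCoef hs) (s + 1)
    (by rw [singCoef, hypCoef_zero]; exact one_ne_zero)
  have hm : δ / 2 ∈ Set.Ioo (0 : ℝ) 1 := ⟨by linarith, by linarith⟩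
  have h1 := hδ (δ / 2) hm.1 (by linarith)
  have h2 := (h _ hm).symm.trans (h' _ hm)
  exact mul_right_cancel₀ h1 (add_left_cancel h2)

/-- The coefficient of the singular solution at `s + 2` from the one at `s`. -/
lemma HasExpansion.up {s T : ℂ} (h : HasExpansion s (T / (s + 1))) (hs : -1 < s.re)
    (hodd : ∀ n : ℤ, s ≠ 2 * n + 1) : HasExpansion (s + 2) (T / (s + 3)) := by
  have h1 : s + 1 ≠ 0 := by exact_mod_cast add_ne_zero_of_re (c := 1) hs
  have h3 : s + 3 ≠ 0 := by exact_mod_cast add_ne_zero_of_re (s := s) (c := 3) (by linarith)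
  obtain ⟨C, hC⟩ := exists_hasExpansion_add_two hs hodd
  have := HasExpansion.unique h (hC.down hs hodd fun h0 => by
    exact exists_hasExpansion_add_two (by simpa using hs) (ofReal_not_odd hs h0)) hs
  have e : T / (s + 3) = C := by
    field_simp at this ⊢
    exact this
  rwa [e]

section

open Set Filter Topology Asymptotics

lemma locallyIntegrable_of_norm_le {f : ℝ → ℂ} {r : ℝ} (hr : -1 < r) (hf : Measurable f)
    (h : ∀ y, ‖f y‖ ≤ |y| ^ r) : LocallyIntegrable f := by
  refine locallyIntegrable_of_norm_le_rpow (C := 1) (α := -r) (by simp) (by simp; linarith)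
    (ae_of_all _ fun y => ?_) hf.aestronglyMeasurable
  simpa using h y

lemma locallyIntegrable_comp_one_sub {f : ℝ → ℂ} (hf : LocallyIntegrable f) :
    LocallyIntegrable fun v => f (1 - v) := by
  rw [locallyIntegrable_iff] at hf ⊢
  intro K hK
  have h := hf ((fun v : ℝ => 1 - v) '' K) (hK.image (by fun_prop))
  have hm : MeasurePreserving (fun v : ℝ => 1 - v) := Measure.measurePreserving_sub_left volume 1
  exact (hm.integrableOn_image (MeasurableEquiv.subLeft (1 : ℝ)).measurableEmbedding).1 h

lemma locallyIntegrable_comp_one_add {f : ℝ → ℂ} (hf : LocallyIntegrable f) :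
    LocallyIntegrable fun v => f (1 + v) := by
  rw [locallyIntegrable_iff] at hf ⊢
  intro K hK
  have h := hf ((fun v : ℝ => 1 + v) '' K) (hK.image (by fun_prop))
  have hm : MeasurePreserving (fun v : ℝ => 1 + v) := measurePreserving_add_left volume 1
  exact (hm.integrableOn_image (MeasurableEquiv.addLeft (1 : ℝ)).measurableEmbedding).1 h

lemma isBigO_cpow_smul {l : Filter ℝ} {f : ℝ → ℂ} {b : ℝ} {p : ℂ} (hl : ∀ᶠ v in l, 0 < v)
    (hf : f =O[l] fun v => v ^ (-b)) :
    (fun v : ℝ => (v : ℂ) ^ p * f v) =O[l] fun v => v ^ (p.re - b) := by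
  have h : (fun v : ℝ => (v : ℂ) ^ p) =O[l] fun v => v ^ p.re := by
    refine IsBigO.of_bound 1 ?_
    filter_upwards [hl] with v hv
    rw [Complex.norm_cpow_eq_rpow_re_of_pos hv, one_mul, Real.norm_of_nonneg (by positivity)]
  refine (h.mul hf).congr' (.refl _ _) ?_
  filter_upwards [hl] with v hv
  rw [← Real.rpow_add hv, sub_eq_add_neg]

/-- Integration by parts for the Mellin transform, for a function with a kink at `1`. -/
lemma mellin_euler {f f' : ℝ → ℂ} {p : ℂ} {a b : ℝ} (hc : ContinuousAt f 1)
    (hd : ∀ v, 0 < v → v ≠ 1 → HasDerivAt f (f' v) v) (h1 : MellinConvergent f p)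
    (h2 : MellinConvergent (fun v => (v : ℂ) * f' v) p)
    (ha : f =O[atTop] fun v => v ^ (-a)) (hpa : p.re < a)
    (hb : f =O[𝓝[>] 0] fun v => v ^ (-b)) (hpb : b < p.re) :
    p * mellin f p + mellin (fun v => (v : ℂ) * f' v) p = 0 := by
  set F : ℝ → ℂ := fun v => (v : ℂ) ^ p * f v with hF
  set F' : ℝ → ℂ := fun v => p * ((v : ℂ) ^ (p - 1) • f v) + (v : ℂ) ^ (p - 1) • ((v : ℂ) * f' v)
    with hF'
  have hint : IntegrableOn F' (Ioi 0) := (h1.const_mul p).add h2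
  have hderiv : ∀ v, 0 < v → v ≠ 1 → HasDerivAt F (F' v) v := by
    intro v hv hv1
    have hv' : (v : ℂ) ≠ 0 := by exact_mod_cast hv.ne'
    have hp : HasDerivAt (fun v : ℝ => (v : ℂ) ^ p) (p * (v : ℂ) ^ (p - 1)) v := by
      have := ((hasDerivAt_id (v : ℂ)).cpow_const (c := p)
        (by simpa using hv)).comp_ofReal
      simpa using this
    refine (hp.mul (hd v hv hv1)).congr_deriv ?_
    simp only [hF', smul_eq_mul]
    have : (v : ℂ) ^ p = (v : ℂ) ^ (p - 1) * v := by
      rw [Complex.cpow_sub _ _ hv', Complex.cpow_one]; field_simp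
    rw [this]; ring
  have hcF : ContinuousAt F 1 :=
    (Complex.continuousAt_ofReal_cpow_const 1 p (Or.inr one_ne_zero)).mul hc
  have hzero : Tendsto F (𝓝[>] 0) (𝓝 0) := by
    refine (isBigO_cpow_smul (p := p) self_mem_nhdsWithin hb).trans_tendsto ?_
    have := (Real.continuousAt_rpow_const 0 (p.re - b) (Or.inr (by linarith))).tendsto
    rw [Real.zero_rpow (by linarith)] at this
    exact this.mono_left nhdsWithin_le_nhds
  have htop : Tendsto F atTop (𝓝 0) := by
    refine (isBigO_cpow_smul (p := p) (eventually_gt_atTop 0) ha).trans_tendsto ?_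
    have := tendsto_rpow_neg_atTop (y := a - p.re) (by linarith)
    simpa using this
  have e1 : ∫ v in Ioc (0 : ℝ) 1, F' v = F 1 - 0 := by
    rw [← intervalIntegral.integral_of_le zero_le_one]
    refine intervalIntegral.integral_eq_sub_of_hasDerivAt_of_tendsto zero_lt_one
      (fun v hv => hderiv v hv.1 hv.2.ne) ?_ hzero (hcF.tendsto.mono_left nhdsWithin_le_nhds)
    rw [intervalIntegrable_iff_integrableOn_Ioc_of_le zero_le_one]
    exact hint.mono_set Ioc_subset_Ioi_self
  have e2 : ∫ v in Ioi (1 : ℝ), F' v = 0 - F 1 :=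
    integral_Ioi_of_hasDerivAt_of_tendsto hcF.continuousWithinAt
      (fun v hv => hderiv v (zero_lt_one.trans hv) (ne_of_gt hv))
      (hint.mono_set (Ioi_subset_Ioi zero_le_one)) htop
  have e3 : ∫ v in Ioi (0 : ℝ), F' v = 0 := by
    rw [← Ioc_union_Ioi_eq_Ioi zero_le_one, setIntegral_union Ioc_disjoint_Ioi_same
      measurableSet_Ioi (hint.mono_set Ioc_subset_Ioi_self)
      (hint.mono_set (Ioi_subset_Ioi zero_le_one)), e1, e2]
    ring
  rw [hF', integral_add (h1.const_mul p) h2, integral_const_mul] at e3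
  exact e3

/-- The odd part (doubled) of `v ↦ |1 + v| ^ s`. -/
noncomputable def powDiff (s : ℂ) (v : ℝ) : ℂ := evenPow s (1 + v) - evenPow s (1 - v)

/-- The difference `|1 + v| ^ r - sign (1 - v) * |1 - v| ^ r`. -/
noncomputable def powJump (r : ℂ) (v : ℝ) : ℂ := evenPow r (1 + v) - oddPow r (1 - v)

/-- The even part of `v ↦ |1 + v| ^ s`, minus its leading behaviour `|v| ^ s` at infinity. -/
noncomputable def powMid (s : ℂ) (v : ℝ) : ℂ :=
  (evenPow s (1 + v) + evenPow s (1 - v)) / 2 - evenPow s v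

/-- The function `(1 + v) ^ r - (1 - v)₊ ^ (r + 1)`. -/
noncomputable def powCut (r : ℂ) (v : ℝ) : ℂ :=
  evenPow r (1 + v) - evenPow (r + 1) (max (1 - v) 0)

lemma evenPow_one (s : ℂ) : evenPow s 1 = 1 := by simp [evenPow_of_ne one_ne_zero]

lemma hasDerivAt_evenPow_one_add (s : ℂ) {v : ℝ} (hv : 1 + v ≠ 0) :
    HasDerivAt (fun v : ℝ => evenPow s (1 + v)) (s * oddPow (s - 1) (1 + v)) v :=
  HasDerivAt.comp_const_add 1 v (hasDerivAt_evenPow_of_ne hv s)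

lemma hasDerivAt_oddPow_one_add (s : ℂ) {v : ℝ} (hv : 1 + v ≠ 0) :
    HasDerivAt (fun v : ℝ => oddPow s (1 + v)) (s * evenPow (s - 1) (1 + v)) v :=
  HasDerivAt.comp_const_add 1 v (hasDerivAt_oddPow_of_ne hv s)

lemma hasDerivAt_evenPow_one_sub (s : ℂ) {v : ℝ} (hv : 1 - v ≠ 0) :
    HasDerivAt (fun v : ℝ => evenPow s (1 - v)) (-(s * oddPow (s - 1) (1 - v))) v :=
  HasDerivAt.comp_const_sub 1 v (hasDerivAt_evenPow_of_ne hv s)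

lemma hasDerivAt_oddPow_one_sub (s : ℂ) {v : ℝ} (hv : 1 - v ≠ 0) :
    HasDerivAt (fun v : ℝ => oddPow s (1 - v)) (-(s * evenPow (s - 1) (1 - v))) v :=
  HasDerivAt.comp_const_sub 1 v (hasDerivAt_oddPow_of_ne hv s)

lemma isBigO_of_differentiableAt_zero {K : ℝ → ℂ} (hK : DifferentiableAt ℝ K 0) (h0 : K 0 = 0) :
    K =O[𝓝 0] fun u => u := by
  simpa [h0] using hK.isBigO_sub

lemma isBigO_sq_of_deriv {K K' : ℝ → ℂ} (hK : ∀ᶠ u in 𝓝 0, HasDerivAt K (K' u) u)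
    (h0 : K 0 = 0) (hK' : K' =O[𝓝 0] fun u => u) : K =O[𝓝 0] fun u => u ^ 2 := by
  obtain ⟨C, hC⟩ := hK'.bound
  obtain ⟨ε, hε, hball⟩ := Metric.eventually_nhds_iff.1 (hK.and hC)
  refine IsBigO.of_bound C ?_
  filter_upwards [Metric.ball_mem_nhds (0 : ℝ) hε] with u hu
  have hu' : |u| < ε := by simpa using hu
  have hC0 : ∀ x ∈ Icc (-|u|) |u|, HasDerivWithinAt K (K' x) (Icc (-|u|) |u|) x ∧
      ‖K' x‖ ≤ C * ‖x‖ := fun x hx => by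
    have := hball (y := x) (by simpa using (abs_le.2 hx).trans_lt hu')
    exact ⟨this.1.hasDerivWithinAt, this.2⟩
  rcases eq_or_ne u 0 with rfl | hu0
  · simp [h0]
  have hCpos : 0 ≤ C := by
    have := (norm_nonneg _).trans (hC0 |u| ⟨by linarith [abs_nonneg u], le_rfl⟩).2
    exact nonneg_of_mul_nonneg_left this (by simpa using hu0)
  have := (convex_Icc (-|u|) |u|).norm_image_sub_le_of_norm_hasDerivWithin_le
    (fun x hx => (hC0 x hx).1) (C := C * |u|) (fun x hx => (hC0 x hx).2.trans (by
      gcongr; exact abs_le.2 hx)) (x := 0) (y := u) (by simp) (abs_le.1 le_rfl)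
  simpa [h0, pow_two, mul_assoc] using this

lemma isBigO_zero_of_isBigO_id {f : ℝ → ℂ} (h : f =O[𝓝 0] fun u => u) :
    f =O[𝓝[>] 0] fun v => v ^ (-(-1 : ℝ)) := by
  simpa using h.mono nhdsWithin_le_nhds

lemma isBigO_atTop_of_inv {f K : ℝ → ℂ} {r : ℂ} {n : ℕ}
    (h : ∀ᶠ v in atTop, f v = evenPow r v * K v⁻¹) (hK : K =O[𝓝 0] fun u => u ^ n) :
    f =O[atTop] fun v => v ^ (-(n - r.re)) := by
  have h1 : (fun v => K v⁻¹) =O[atTop] fun v => (v⁻¹) ^ n :=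
    hK.comp_tendsto tendsto_inv_atTop_zero
  have h2 : (fun v => evenPow r v) =O[atTop] fun v => v ^ r.re := by
    refine IsBigO.of_bound 1 ?_
    filter_upwards [eventually_gt_atTop 0] with v hv
    rw [norm_evenPow_of_ne hv.ne', abs_of_pos hv, one_mul, Real.norm_of_nonneg (by positivity)]
  refine (h2.mul h1).congr' (h.mono fun v hv => hv.symm) ?_
  filter_upwards [eventually_gt_atTop 0] with v hv
  rw [neg_sub, Real.rpow_sub hv, Real.rpow_natCast, inv_pow, div_eq_mul_inv]

lemma evenPow_one_add_eq (s : ℂ) {v : ℝ} (hv : 0 < v) :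
    evenPow s (1 + v) = evenPow s v * evenPow s (1 + v⁻¹) := by
  rw [← evenPow_mul]; congr 1; field_simp; ring

lemma evenPow_one_sub_eq (s : ℂ) {v : ℝ} (hv : 0 < v) :
    evenPow s (1 - v) = evenPow s v * evenPow s (1 - v⁻¹) := by
  rw [← evenPow_mul, ← evenPow_neg]; congr 1; field_simp; ring

lemma oddPow_one_sub_eq (s : ℂ) {v : ℝ} (hv : 0 < v) :
    oddPow s (1 - v) = -(evenPow s v * oddPow s (1 - v⁻¹)) := by
  rw [← oddPow_of_pos hv, ← oddPow_mul, ← oddPow_neg]; congr 1; field_simp; ring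

lemma powDiff_isBigO_zero (s : ℂ) : powDiff s =O[𝓝 0] fun u => u := by
  refine isBigO_of_differentiableAt_zero ?_ (by simp [powDiff])
  exact ((hasDerivAt_evenPow_one_add s (by simp)).sub
    (hasDerivAt_evenPow_one_sub s (by simp))).differentiableAt

lemma powJump_isBigO_zero (s : ℂ) : powJump s =O[𝓝 0] fun u => u := by
  refine isBigO_of_differentiableAt_zero ?_ (by simp [powJump, oddPow_one, evenPow_one])
  exact ((hasDerivAt_evenPow_one_add s (by simp)).sub
    (hasDerivAt_oddPow_one_sub s (by simp))).differentiableAt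

lemma powCut_isBigO_zero (s : ℂ) : powCut s =O[𝓝 0] fun u => u := by
  refine isBigO_of_differentiableAt_zero ?_ (by simp [powCut, evenPow_one])
  refine ((hasDerivAt_evenPow_one_add s (by simp)).sub
    (hasDerivAt_evenPow_one_sub (s + 1) (v := 0) (by simp))).differentiableAt.congr_of_eventuallyEq ?_
  filter_upwards [eventually_lt_nhds (zero_lt_one (α := ℝ))] with v hv
  simp [powCut, max_eq_left (sub_nonneg.2 hv.le)]

lemma powMid_isBigO_zero (s : ℂ) {b : ℝ} (hb : 0 ≤ b) (hs : -b ≤ s.re) :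
    powMid s =O[𝓝[>] 0] fun v => v ^ (-b) := by
  have key : ∀ c : ℝ, -b ≤ c → (fun v : ℝ => v ^ c) =O[𝓝[>] 0] fun v => v ^ (-b) := by
    intro c hc
    refine IsBigO.of_bound 1 ?_
    filter_upwards [Ioo_mem_nhdsGT zero_lt_one] with v hv
    rw [one_mul, Real.norm_of_nonneg (rpow_nonneg hv.1.le _),
      Real.norm_of_nonneg (rpow_nonneg hv.1.le _)]
    exact Real.rpow_le_rpow_of_exponent_ge hv.1 hv.2.le hc
  have h1 : (fun v : ℝ => (evenPow s (1 + v) + evenPow s (1 - v)) / 2) =O[𝓝[>] 0]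
      fun v => v ^ (-b) := by
    have hd : DifferentiableAt ℝ (fun v : ℝ => (evenPow s (1 + v) + evenPow s (1 - v)) / 2) 0 :=
      (((hasDerivAt_evenPow_one_add s (by simp)).add
        (hasDerivAt_evenPow_one_sub s (by simp))).div_const 2).differentiableAt
    refine ((hd.continuousAt.isBigO_one ℝ).mono nhdsWithin_le_nhds).trans ?_
    simpa using key 0 (by linarith)
  refine h1.sub (IsBigO.trans (IsBigO.of_bound 1 ?_) (key s.re hs))
  filter_upwards [self_mem_nhdsWithin] with v hv
  have hv : 0 < v := hv
  rw [norm_evenPow_of_ne hv.ne', abs_of_pos hv, one_mul, Real.norm_of_nonneg (by positivity)]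

lemma powDiff_isBigO_atTop (s : ℂ) : powDiff s =O[atTop] fun v => v ^ (-(1 - s.re)) := by
  have := isBigO_atTop_of_inv (f := powDiff s) (K := powDiff s) (r := s) (n := 1) ?_
    (by simpa using powDiff_isBigO_zero s)
  · simpa using this
  filter_upwards [eventually_gt_atTop 0] with v hv
  simp only [powDiff]
  rw [evenPow_one_add_eq s hv, evenPow_one_sub_eq s hv]; ring

lemma powJump_isBigO_atTop (r : ℂ) : powJump r =O[atTop] fun v => v ^ (-(-r.re)) := by
  have := isBigO_atTop_of_inv (f := powJump r) (r := r) (n := 0)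
    (K := fun u => evenPow r (1 + u) + oddPow r (1 - u)) ?_ ?_
  · simpa using this
  · filter_upwards [eventually_gt_atTop 0] with v hv
    simp only [powJump]
    rw [evenPow_one_add_eq r hv, oddPow_one_sub_eq r hv]; ring
  · have hd := ((hasDerivAt_evenPow_one_add r (v := 0) (by simp)).add
      (hasDerivAt_oddPow_one_sub r (by simp))).continuousAt.isBigO_one ℝ
    simp only [pow_zero]
    exact hd

lemma powCut_isBigO_atTop (r : ℂ) : powCut r =O[atTop] fun v => v ^ (-(-r.re)) := by
  have := isBigO_atTop_of_inv (f := powCut r) (r := r) (n := 0)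
    (K := fun u => evenPow r (1 + u)) ?_ ?_
  · simpa using this
  · filter_upwards [eventually_gt_atTop 1] with v hv
    simp only [powCut]
    rw [evenPow_one_add_eq r (by linarith), max_eq_right (by linarith), evenPow_zero, sub_zero]
  · have hd := (hasDerivAt_evenPow_one_add r (v := 0) (by simp)).continuousAt.isBigO_one ℝ
    simp only [pow_zero]
    exact hd

lemma powMid_isBigO_atTop (s : ℂ) : powMid s =O[atTop] fun v => v ^ (-(2 - s.re)) := by
  have := isBigO_atTop_of_inv (f := powMid s) (r := s) (n := 2)
    (K := fun u => (evenPow s (1 + u) + evenPow s (1 - u)) / 2 - 1) ?_ ?_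
  · simpa using this
  · filter_upwards [eventually_gt_atTop 0] with v hv
    simp only [powMid]
    rw [evenPow_one_add_eq s hv, evenPow_one_sub_eq s hv]; ring
  · refine isBigO_sq_of_deriv (K' := fun u => s / 2 * (oddPow (s - 1) (1 + u)
      - oddPow (s - 1) (1 - u))) ?_ (by simp [evenPow_one]) ?_
    · filter_upwards [Ioo_mem_nhds (a := -1) (b := (1 : ℝ)) (x := 0) (by simp) (by simp)] with u hu
      refine ((((hasDerivAt_evenPow_one_add s (by linarith [hu.1])).add
        (hasDerivAt_evenPow_one_sub s (by linarith [hu.2]))).div_const 2).sub_const 1).congr_deriv ?_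
      ring
    · refine isBigO_of_differentiableAt_zero ?_ (by simp)
      exact (((hasDerivAt_oddPow_one_add (s - 1) (by simp)).sub
        (hasDerivAt_oddPow_one_sub (s - 1) (by simp))).const_mul (s / 2)).differentiableAt

lemma locallyIntegrable_evenPow {s : ℂ} (hs : -1 < s.re) : LocallyIntegrable (evenPow s) :=
  locallyIntegrable_of_norm_le hs (measurable_evenPow s) (norm_evenPow_le s)

lemma locallyIntegrable_oddPow {s : ℂ} (hs : -1 < s.re) : LocallyIntegrable (oddPow s) :=
  locallyIntegrable_of_norm_le hs (measurable_oddPow s) (norm_oddPow_le s)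

lemma mellinConvergent_powDiff {s p : ℂ} (hs : -1 < s.re) (hp : -1 < p.re)
    (hp' : p.re < 1 - s.re) : MellinConvergent (powDiff s) p :=
  mellinConvergent_of_isBigO_rpow
    (((locallyIntegrable_comp_one_add (locallyIntegrable_evenPow hs)).sub
      (locallyIntegrable_comp_one_sub (locallyIntegrable_evenPow hs))).locallyIntegrableOn _)
    (powDiff_isBigO_atTop s) hp' (isBigO_zero_of_isBigO_id (powDiff_isBigO_zero s)) hp

lemma mellinConvergent_powJump {s p : ℂ} (hs : -1 < s.re) (hp : -1 < p.re)
    (hp' : p.re < -s.re) : MellinConvergent (powJump s) p :=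
  mellinConvergent_of_isBigO_rpow
    (((locallyIntegrable_comp_one_add (locallyIntegrable_evenPow hs)).sub
      (locallyIntegrable_comp_one_sub (locallyIntegrable_oddPow hs))).locallyIntegrableOn _)
    (powJump_isBigO_atTop s) hp' (isBigO_zero_of_isBigO_id (powJump_isBigO_zero s)) hp

lemma continuousOn_powCut {r : ℂ} (hr : -1 < r.re) : ContinuousOn (powCut r) (Ioi 0) := by
  intro v hv
  have hv : 0 < v := hv
  have h1 : Continuous (evenPow (r + 1)) := continuous_evenPow (by simp; linarith)
  refine ContinuousAt.continuousWithinAt (ContinuousAt.sub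
    (hasDerivAt_evenPow_one_add r (by linarith)).continuousAt ?_)
  exact (h1.comp (by fun_prop : Continuous fun v : ℝ => max (1 - v) 0)).continuousAt

lemma mellinConvergent_powCut {s p : ℂ} (hs : -1 < s.re) (hp : -1 < p.re)
    (hp' : p.re < -s.re) : MellinConvergent (powCut s) p :=
  mellinConvergent_of_isBigO_rpow
    ((continuousOn_powCut hs).locallyIntegrableOn measurableSet_Ioi)
    (powCut_isBigO_atTop s) hp' (isBigO_zero_of_isBigO_id (powCut_isBigO_zero s)) hp

lemma mellinConvergent_powMid {s p : ℂ} (hs : -1 < s.re) (hp : 0 < p.re) (hsp : -s.re < p.re)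
    (hp' : p.re < 2 - s.re) : MellinConvergent (powMid s) p :=
  mellinConvergent_of_isBigO_rpow
    (((((locallyIntegrable_comp_one_add (locallyIntegrable_evenPow hs)).add
      (locallyIntegrable_comp_one_sub (locallyIntegrable_evenPow hs))).smul (2⁻¹ : ℂ)).sub
        (locallyIntegrable_evenPow hs)).locallyIntegrableOn _ |>.congr (by
          refine ae_of_all _ fun v => ?_
          simp [powMid]; ring))
    (powMid_isBigO_atTop s) hp' (powMid_isBigO_zero s (le_max_left 0 (-s.re))
      (by linarith [le_max_right 0 (-s.re)])) (max_lt hp hsp)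

lemma HasMellin.congr_off_one {f g : ℝ → ℂ} {p m : ℂ} (h : HasMellin f p m)
    (e : ∀ v, 0 < v → v ≠ 1 → g v = f v) : HasMellin g p m := by
  have hae : (fun t : ℝ => (t : ℂ) ^ (p - 1) • f t) =ᵐ[volume.restrict (Ioi 0)]
      fun t : ℝ => (t : ℂ) ^ (p - 1) • g t := by
    have h1 : ∀ᵐ t : ℝ ∂volume.restrict (Ioi 0), t ≠ 1 :=
      ae_restrict_of_ae (by simp [ae_iff])
    filter_upwards [h1, ae_restrict_mem measurableSet_Ioi] with t ht ht0
    rw [e t ht0 ht]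
  exact ⟨h.1.congr hae, (integral_congr_ae hae).symm.trans h.2⟩

lemma HasMellin.ofReal_mul {f : ℝ → ℂ} {p m : ℂ} (h : HasMellin f (p + 1) m) :
    HasMellin (fun v => (v : ℂ) * f v) p m := by
  have h1 := (MellinConvergent.cpow_smul (f := f) (s := p) (a := 1)).2 h.1
  have h2 := mellin_cpow_smul f p 1
  rw [h.2] at h2
  exact ⟨by simpa using h1, by simpa using h2⟩

lemma HasMellin.add {f g : ℝ → ℂ} {p m n : ℂ} (hf : HasMellin f p m) (hg : HasMellin g p n) :
    HasMellin (fun v => f v + g v) p (m + n) := by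
  have := hasMellin_add hf.1 hg.1
  rwa [hf.2, hg.2] at this

lemma HasMellin.sub {f g : ℝ → ℂ} {p m n : ℂ} (hf : HasMellin f p m) (hg : HasMellin g p n) :
    HasMellin (fun v => f v - g v) p (m - n) := by
  have := hasMellin_sub hf.1 hg.1
  rwa [hf.2, hg.2] at this

lemma HasMellin.const_mul {f : ℝ → ℂ} {p m : ℂ} (hf : HasMellin f p m) (c : ℂ) :
    HasMellin (fun v => c * f v) p (c * m) := by
  have := hasMellin_const_smul hf.1 c
  rw [hf.2] at this
  exact this

lemma MellinConvergent.hasMellin {f : ℝ → ℂ} {p : ℂ} (hf : MellinConvergent f p) :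
    HasMellin f p (mellin f p) := ⟨hf, rfl⟩

lemma mellin_powMid {s p : ℂ} (hs : -1 < s.re) (hp : -1 < p.re) (hsp : -1 - s.re < p.re)
    (hp' : p.re < 1 - s.re) :
    2 * (p + s + 1) * mellin (powMid s) (p + 1) = -(p * mellin (powDiff s) p) := by
  have hw : 0 < (s + 1).re := by simp; linarith
  have hg : MellinConvergent (powMid s) (p + 1) :=
    mellinConvergent_powMid hs (by simp; linarith) (by simp; linarith) (by simp; linarith)
  have hd := mellinConvergent_powDiff hs hp hp'
  set f : ℝ → ℂ := fun v => oddPow (s + 1) (1 + v) - oddPow (s + 1) (1 - v) - 2 * oddPow (s + 1) v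
    with hf
  have hfeq : f = fun v => powDiff s v + 2 * (v * powMid s v) := by
    funext v
    simp only [hf, powDiff, powMid, ← mul_evenPow]
    push_cast; ring
  have hmf : HasMellin f p (mellin (powDiff s) p + 2 * mellin (powMid s) (p + 1)) := by
    rw [hfeq]; exact hd.hasMellin.add (hg.hasMellin.ofReal_mul.const_mul 2)
  have hmf' := (hg.hasMellin.const_mul (2 * (s + 1))).ofReal_mul
  have hvO : ∀ {l : Filter ℝ} {b : ℝ}, (∀ᶠ v in l, 0 < v) →
      powMid s =O[l] (fun v => v ^ (-b)) →
      (fun v : ℝ => 2 * ((v : ℂ) * powMid s v)) =O[l] fun v => v ^ (-(b - 1)) := by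
    intro l b hl h
    have := (isBigO_cpow_smul (p := 1) hl h).const_mul_left 2
    simpa using this
  have key := mellin_euler (f := f) (f' := fun v => 2 * (s + 1) * powMid s v) (p := p)
    (a := 1 - s.re) (b := max 0 (-s.re) - 1) ?_ ?_ hmf.1 hmf'.1 ?_ hp' ?_ ?_
  · rw [hmf.2, hmf'.2] at key
    linear_combination key
  · have hc := continuous_oddPow hw
    exact (((hc.comp (by fun_prop : Continuous fun v : ℝ => 1 + v)).sub
      (hc.comp (by fun_prop : Continuous fun v : ℝ => 1 - v))).sub
      (continuous_const.mul hc)).continuousAt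
  · intro v hv hv1
    refine (((hasDerivAt_oddPow_one_add (s + 1) (by linarith)).sub
      (hasDerivAt_oddPow_one_sub (s + 1) (sub_ne_zero.2 hv1.symm))).sub
      ((hasDerivAt_oddPow_of_ne hv.ne' (s + 1)).const_mul 2)).congr_deriv ?_
    simp only [powMid, add_sub_cancel_right]
    ring
  · rw [hfeq]
    refine (powDiff_isBigO_atTop s).add ?_
    have := hvO (eventually_gt_atTop 0) (powMid_isBigO_atTop s)
    rwa [show (2 - s.re - 1 : ℝ) = 1 - s.re by ring] at this
  · rw [hfeq]
    refine IsBigO.add ?_ (hvO self_mem_nhdsWithin (powMid_isBigO_zero s (le_max_left 0 (-s.re))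
      (by linarith [le_max_right 0 (-s.re)])))
    refine (isBigO_zero_of_isBigO_id (powDiff_isBigO_zero s)).trans (IsBigO.of_bound 1 ?_)
    filter_upwards [Ioo_mem_nhdsGT zero_lt_one] with v hv
    rw [one_mul, Real.norm_of_nonneg (rpow_nonneg hv.1.le _),
      Real.norm_of_nonneg (rpow_nonneg hv.1.le _)]
    exact Real.rpow_le_rpow_of_exponent_ge hv.1 hv.2.le (by linarith [le_max_left 0 (-s.re)])
  · rcases max_cases 0 (-s.re) with h | h <;> linarith [h.1]

lemma mellin_powDiff_of_pos {s p : ℂ} (hs : 0 < s.re) (hp : -1 < p.re) (hp' : p.re < 1 - s.re) :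
    (p + s) * mellin (powDiff s) p = s * mellin (powJump (s - 1)) p := by
  have hd := mellinConvergent_powDiff (by linarith) hp hp'
  have hj : MellinConvergent (powJump (s - 1)) p :=
    mellinConvergent_powJump (by simp; linarith) hp (by simp; linarith)
  have hmf' : HasMellin (fun v : ℝ =>
      (v : ℂ) * (s * (oddPow (s - 1) (1 + v) + oddPow (s - 1) (1 - v)))) p
      (s * (mellin (powDiff s) p - mellin (powJump (s - 1)) p)) := by
    refine ((hd.hasMellin.sub hj.hasMellin).const_mul s).congr_off_one fun v hv hv1 => ?_
    have e1 := mul_oddPow (s - 1) (1 + v)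
    have e2 := mul_oddPow (s - 1) (1 - v)
    rw [sub_add_cancel] at e1 e2
    simp only [powDiff, powJump]
    rw [← e1, ← e2, ← oddPow_of_pos (by linarith : 0 < 1 + v)]
    push_cast; ring
  have key := mellin_euler (f := powDiff s)
    (f' := fun v => s * (oddPow (s - 1) (1 + v) + oddPow (s - 1) (1 - v))) (p := p)
    (a := 1 - s.re) (b := -1) ?_ ?_ hd hmf'.1 (powDiff_isBigO_atTop s) hp'
    (isBigO_zero_of_isBigO_id (powDiff_isBigO_zero s)) hp
  · rw [hmf'.2] at key
    linear_combination key
  · have hc := continuous_evenPow hs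
    exact ((hc.comp (by fun_prop : Continuous fun v : ℝ => 1 + v)).sub
      (hc.comp (by fun_prop : Continuous fun v : ℝ => 1 - v))).continuousAt
  · intro v hv hv1
    refine ((hasDerivAt_evenPow_one_add s (by linarith)).sub
      (hasDerivAt_evenPow_one_sub s (sub_ne_zero.2 hv1.symm))).congr_deriv ?_
    ring

noncomputable def cutPow (r : ℂ) (v : ℝ) : ℂ := if v < 1 then evenPow r (1 - v) else 0

lemma evenPow_eq_cpow (s : ℂ) {y : ℝ} (hy : 0 < y) : evenPow s y = (y : ℂ) ^ s := by
  rw [evenPow_of_ne hy.ne', Complex.cpow_def_of_ne_zero (by exact_mod_cast hy.ne'),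
    ← Complex.ofReal_log hy.le, mul_comm]

lemma hasMellin_cutPow {a c : ℂ} (ha : 0 < a.re) (hc : 0 < c.re) :
    HasMellin (cutPow (c - 1)) a (Complex.betaIntegral a c) := by
  have h := Complex.betaIntegral_convergent ha hc
  rw [intervalIntegrable_iff_integrableOn_Ioo_of_le zero_le_one] at h
  have e : EqOn (fun t : ℝ => (t : ℂ) ^ (a - 1) • cutPow (c - 1) t)
      (fun t => (Ioo (0 : ℝ) 1).indicator
        (fun x : ℝ => (x : ℂ) ^ (a - 1) * (1 - (x : ℂ)) ^ (c - 1)) t) (Ioi 0) := by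
    intro t ht
    have ht : 0 < t := ht
    change _ = (Ioo (0 : ℝ) 1).indicator _ t
    by_cases h1 : t < 1
    · rw [indicator_of_mem (show t ∈ Ioo (0 : ℝ) 1 from ⟨ht, h1⟩)]
      simp only [cutPow, if_pos h1, smul_eq_mul]
      rw [evenPow_eq_cpow _ (by linarith)]; push_cast; rfl
    · rw [indicator_of_notMem fun h : t ∈ Ioo (0 : ℝ) 1 => h1 h.2]
      simp [cutPow, if_neg h1]
  refine ⟨?_, ?_⟩
  · rw [MellinConvergent, integrableOn_congr_fun e measurableSet_Ioi]
    exact (h.integrable_indicator measurableSet_Ioo).integrableOn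
  · rw [mellin, setIntegral_congr_fun measurableSet_Ioi e, setIntegral_indicator measurableSet_Ioo,
      inter_eq_self_of_subset_right Ioo_subset_Ioi_self, Complex.betaIntegral,
      intervalIntegral.integral_of_le zero_le_one, integral_Ioc_eq_integral_Ioo]

lemma hasMellin_evenPow_one_add {a c : ℂ} (ha : 0 < a.re) (hc : a.re < c.re) :
    HasMellin (fun v => evenPow (-c) (1 + v)) a (Complex.betaIntegral a (c - a)) := by
  have h := Complex.betaIntegral_convergent ha (v := c - a) (by simpa using hc)
  rw [intervalIntegrable_iff_integrableOn_Ioo_of_le zero_le_one] at h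
  set F : ℝ → ℝ := fun v => v / (1 + v) with hF
  have hd : ∀ v ∈ Ioi (0 : ℝ), HasDerivWithinAt F (1 / (1 + v) ^ 2) (Ioi 0) v := by
    intro v hv
    have hv : 0 < v := hv
    refine HasDerivAt.hasDerivWithinAt ?_
    refine ((hasDerivAt_id v).div ((hasDerivAt_id v).const_add 1) (by simp; linarith)).congr_deriv ?_
    simp
  have hinj : InjOn F (Ioi 0) := by
    intro x hx y hy hxy
    have hx : 0 < x := hx
    have hy : 0 < y := hy
    simp only [hF] at hxy
    rw [div_eq_div_iff (by linarith) (by linarith)] at hxy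
    linarith
  have himg : F '' Ioi 0 = Ioo 0 1 := by
    ext u
    constructor
    · rintro ⟨v, hv, rfl⟩
      have hv : 0 < v := hv
      exact ⟨by positivity, (div_lt_one (by linarith)).2 (by linarith)⟩
    · rintro ⟨h0, h1⟩
      have : 0 < 1 - u := by linarith
      refine ⟨u / (1 - u), by simp only [mem_Ioi]; positivity, ?_⟩
      simp only [hF]
      field_simp
      ring
  have e : EqOn (fun v : ℝ => (v : ℂ) ^ (a - 1) • evenPow (-c) (1 + v))
      (fun v => |1 / (1 + v) ^ 2| • (fun x : ℝ => (x : ℂ) ^ (a - 1) *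
        (1 - (x : ℂ)) ^ (c - a - 1)) (F v)) (Ioi 0) := by
    intro v hv
    have hv : 0 < v := hv
    have h1v : 0 < 1 + v := by linarith
    have e1 : (1 - ((F v : ℝ) : ℂ)) = (((1 + v)⁻¹ : ℝ) : ℂ) := by
      rw [← Complex.ofReal_one, ← Complex.ofReal_sub]; congr 1; simp only [hF]; field_simp; ring
    have e2 : F v = (1 + v)⁻¹ * v := by simp only [hF]; field_simp
    have e3 : ((|1 / (1 + v) ^ 2| : ℝ) : ℂ) = evenPow 2 (1 + v)⁻¹ := by
      rw [evenPow_two (inv_pos.2 h1v).ne', abs_of_pos (by positivity)]; push_cast; field_simp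
    simp only
    rw [e1, Complex.real_smul, e3, ← evenPow_eq_cpow _ (inv_pos.2 h1v),
      ← evenPow_eq_cpow _ (by positivity : 0 < F v), e2, evenPow_mul,
      ← evenPow_eq_cpow _ hv, smul_eq_mul]
    have e4 : evenPow (-c) (1 + v) = evenPow c (1 + v)⁻¹ := by
      rw [evenPow_of_ne h1v.ne', evenPow_of_ne (inv_pos.2 h1v).ne', Real.log_inv]
      push_cast; ring_nf
    have e5 : evenPow c (1 + v)⁻¹ = evenPow 2 (1 + v)⁻¹ * (evenPow (a - 1) (1 + v)⁻¹ *
        evenPow (c - a - 1) (1 + v)⁻¹) := by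
      rw [← evenPow_add (inv_pos.2 h1v).ne', ← evenPow_add (inv_pos.2 h1v).ne']; ring_nf
    rw [e4, e5]; ring
  rw [← himg, integrableOn_image_iff_integrableOn_abs_deriv_smul measurableSet_Ioi hd hinj] at h
  refine ⟨?_, ?_⟩
  · rw [MellinConvergent, integrableOn_congr_fun e measurableSet_Ioi]
    exact h
  · rw [mellin, setIntegral_congr_fun measurableSet_Ioi e,
      ← integral_image_eq_integral_abs_deriv_smul measurableSet_Ioi hd hinj
        (fun x : ℝ => (x : ℂ) ^ (a - 1) * (1 - (x : ℂ)) ^ (c - a - 1)), himg,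
      Complex.betaIntegral, intervalIntegral.integral_of_le zero_le_one,
      integral_Ioc_eq_integral_Ioo]

noncomputable def tailPow (r : ℂ) (v : ℝ) : ℂ := if 1 < v then evenPow r (v - 1) else 0

lemma hasMellin_tailPow {r p : ℂ} (hr : -1 < r.re) (hp : p.re < -r.re) :
    HasMellin (tailPow r) p (Complex.betaIntegral (-p - r) (r + 1)) := by
  have h0 := hasMellin_cutPow (a := -p - r) (c := r + 1) (by simp; linarith) (by simp; linarith)
  rw [add_sub_cancel_right] at h0
  have h1 : MellinConvergent (fun u : ℝ => (u : ℂ) ^ (-r) • cutPow r u) (-p) :=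
    MellinConvergent.cpow_smul.2 (by rw [← sub_eq_add_neg]; exact h0.1)
  have h2 : mellin (fun u : ℝ => (u : ℂ) ^ (-r) • cutPow r u) (-p) =
      Complex.betaIntegral (-p - r) (r + 1) := by
    rw [mellin_cpow_smul, ← sub_eq_add_neg]; exact h0.2
  have h3 := (MellinConvergent.comp_rpow (f := fun u : ℝ => (u : ℂ) ^ (-r) • cutPow r u) (s := p)
    (a := -1) (by norm_num)).2 (by simpa [div_neg] using h1)
  have h4 := mellin_comp_rpow (fun u : ℝ => (u : ℂ) ^ (-r) • cutPow r u) p (-1)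
  have h5 : HasMellin (fun t : ℝ => ((t ^ (-1 : ℝ) : ℝ) : ℂ) ^ (-r) • cutPow r (t ^ (-1 : ℝ))) p
      (Complex.betaIntegral (-p - r) (r + 1)) := by
    refine ⟨h3, h4.trans ?_⟩
    rw [← h2]; simp [div_neg]
  refine h5.congr_off_one fun v hv hv1 => ?_
  rw [Real.rpow_neg_one]
  have hvi : 0 < v⁻¹ := inv_pos.2 hv
  rcases lt_or_gt_of_ne hv1 with h | h
  · have : ¬ v⁻¹ < 1 := not_lt.2 ((one_le_inv₀ hv).2 h.le)
    simp [tailPow, cutPow, this, not_lt.2 h.le]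
  · have : v⁻¹ < 1 := inv_lt_one_of_one_lt₀ h
    simp only [tailPow, cutPow, if_pos this, if_pos h, smul_eq_mul]
    rw [← evenPow_eq_cpow _ hvi]
    have e1 : v - 1 = v * (1 - v⁻¹) := by field_simp
    have e2 : evenPow (-r) v⁻¹ = evenPow r v := by
      rw [evenPow_of_ne hvi.ne', evenPow_of_ne hv.ne', Real.log_inv]; push_cast; ring_nf
    rw [e1, evenPow_mul, e2]

/-- The Mellin transform at `p` of `(1 + v) ^ r - (1 - v)₊ ^ r`. -/
noncomputable def headVal (r p : ℂ) : ℂ :=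
  -(r * Complex.betaIntegral (p + 1) (-r - p)
    + (p + r + 1) * Complex.betaIntegral (p + 1) (r + 1)) / p

lemma hasMellin_head {r p : ℂ} (hr : -1 < r.re) (hp : -1 < p.re) (hp0 : p ≠ 0)
    (hrp : p.re < -r.re) :
    HasMellin (fun v => evenPow r (1 + v) - cutPow r v) p (headVal r p) := by
  have hc := mellinConvergent_powCut hr hp hrp
  have hcut : HasMellin (cutPow r) (p + 1) (Complex.betaIntegral (p + 1) (r + 1)) := by
    have := hasMellin_cutPow (a := p + 1) (c := r + 1) (by simp; linarith) (by simp; linarith)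
    rwa [add_sub_cancel_right] at this
  have hadd : HasMellin (fun v => evenPow (r - 1) (1 + v)) (p + 1)
      (Complex.betaIntegral (p + 1) (-r - p)) := by
    have := hasMellin_evenPow_one_add (a := p + 1) (c := 1 - r) (by simp; linarith)
      (by simp; linarith)
    convert this using 2 <;> ring_nf
  have hmf' := ((hadd.const_mul r).add (hcut.const_mul (r + 1))).ofReal_mul
  have key := mellin_euler (f := powCut r)
    (f' := fun v => r * evenPow (r - 1) (1 + v) + (r + 1) * cutPow r v) (p := p)
    (a := -r.re) (b := -1) ((continuousOn_powCut hr).continuousAt (Ioi_mem_nhds zero_lt_one))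
    ?_ hc hmf'.1 (powCut_isBigO_atTop r) hrp
    (isBigO_zero_of_isBigO_id (powCut_isBigO_zero r)) hp
  · rw [hmf'.2] at key
    have h := hc.hasMellin.sub hcut.ofReal_mul
    have e : mellin (powCut r) p - Complex.betaIntegral (p + 1) (r + 1) = headVal r p := by
      rw [headVal, eq_div_iff hp0]; linear_combination key
    rw [e] at h
    refine h.congr_off_one fun v hv hv1 => ?_
    rcases lt_or_gt_of_ne hv1 with h1 | h1
    · have e := mul_oddPow r (1 - v)
      rw [oddPow_of_pos (by linarith)] at e
      simp only [powCut, cutPow, if_pos h1, max_eq_left (sub_nonneg.2 h1.le)]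
      rw [← e]; push_cast; ring
    · simp [powCut, cutPow, not_lt.2 h1.le, max_eq_right (sub_nonpos.2 h1.le), evenPow_zero]
  · intro v hv hv1
    have h1v : 0 < 1 + v := by linarith
    have hd := hasDerivAt_evenPow_one_add r h1v.ne'
    rw [oddPow_of_pos h1v] at hd
    rcases lt_or_gt_of_ne hv1 with h1 | h1
    · have h := hd.sub (hasDerivAt_evenPow_one_sub (r + 1) (sub_ne_zero.2 hv1.symm))
      rw [add_sub_cancel_right, oddPow_of_pos (by linarith)] at h
      refine (h.congr_of_eventuallyEq ?_).congr_deriv ?_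
      · filter_upwards [eventually_lt_nhds h1] with x hx
        simp [powCut, max_eq_left (sub_nonneg.2 hx.le)]
      · simp [cutPow, if_pos h1]
    · refine (hd.congr_of_eventuallyEq ?_).congr_deriv ?_
      · filter_upwards [eventually_gt_nhds h1] with x hx
        simp [powCut, max_eq_right (sub_nonpos.2 hx.le), evenPow_zero]
      · simp [cutPow, not_lt.2 h1.le]

lemma mellin_powDiff_of_re {r p : ℂ} (hr : -1 < r.re) (hp : -1 < p.re) (hp0 : p ≠ 0)
    (hrp : p.re < -r.re) :
    mellin (powDiff r) p = headVal r p - Complex.betaIntegral (-p - r) (r + 1) := by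
  refine (((hasMellin_head hr hp hp0 hrp).sub (hasMellin_tailPow hr hrp)).congr_off_one
    fun v hv hv1 => ?_).2
  rcases lt_or_gt_of_ne hv1 with h1 | h1
  · simp [powDiff, cutPow, tailPow, h1, not_lt.2 h1.le]
  · simp only [powDiff, cutPow, tailPow, if_pos h1, if_neg (not_lt.2 h1.le)]
    rw [sub_zero, ← neg_sub v 1, evenPow_neg]

lemma mellin_powJump_of_re {r p : ℂ} (hr : -1 < r.re) (hp : -1 < p.re) (hp0 : p ≠ 0)
    (hrp : p.re < -r.re) :
    mellin (powJump r) p = headVal r p + Complex.betaIntegral (-p - r) (r + 1) := by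
  refine (((hasMellin_head hr hp hp0 hrp).add (hasMellin_tailPow hr hrp)).congr_off_one
    fun v hv hv1 => ?_).2
  rcases lt_or_gt_of_ne hv1 with h1 | h1
  · simp [powJump, cutPow, tailPow, h1, not_lt.2 h1.le, oddPow_of_pos (sub_pos.2 h1)]
  · simp only [powJump, cutPow, tailPow, if_pos h1, if_neg (not_lt.2 h1.le)]
    rw [← neg_sub v 1, oddPow_neg, oddPow_of_pos (sub_pos.2 h1)]; ring

lemma sin_pi_mul_ne_zero_of_re {r : ℂ} (hr : -1 < r.re) (hr1 : r.re < 1) (h0 : r ≠ 0) :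
    Complex.sin (π * r) ≠ 0 := by
  intro h
  obtain ⟨k, hk⟩ := Complex.sin_eq_zero_iff.1 h
  have hpi : (π : ℂ) ≠ 0 := by exact_mod_cast Real.pi_ne_zero
  have hk' : r = k := by
    apply mul_left_cancel₀ hpi; rw [hk]; ring
  rw [hk'] at hr hr1 h0
  simp only [Complex.intCast_re] at hr hr1
  have h1 : (-1 : ℤ) < k := by exact_mod_cast hr
  have h2 : k < (1 : ℤ) := by exact_mod_cast hr1
  exact h0 (by have : k = 0 := by omega
               simp [this])

lemma Gamma_add_one_mul_Gamma_neg {z : ℂ} :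
    Complex.Gamma (z + 1) * Complex.Gamma (-z) = -(π / Complex.sin (π * z)) := by
  have := Complex.Gamma_mul_Gamma_one_sub (z + 1)
  rw [show 1 - (z + 1) = -z by ring, mul_add, mul_one, Complex.sin_add_pi] at this
  rw [this, div_neg]

lemma tendsto_headVal {r : ℂ} (hr : -1 < r.re) (hr0 : r.re ≤ 0) (h0 : r ≠ 0) :
    Tendsto (fun δ : ℝ => headVal r (-(δ : ℂ))) (𝓝[>] 0)
      (𝓝 (-(π * Complex.cos (π * r)) / Complex.sin (π * r))) := by
  have hsin := sin_pi_mul_ne_zero_of_re hr (by linarith) h0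
  have hpi : (π : ℂ) ≠ 0 := by exact_mod_cast Real.pi_ne_zero
  have hδ : Tendsto (fun δ : ℝ => -(δ : ℂ)) (𝓝[>] 0) (𝓝[≠] 0) := by
    refine tendsto_nhdsWithin_of_tendsto_nhds_of_eventually_within _ ?_ ?_
    · have : ContinuousAt (fun δ : ℝ => -(δ : ℂ)) 0 := by fun_prop
      simpa [ContinuousAt] using this.tendsto.mono_left nhdsWithin_le_nhds
    · filter_upwards [self_mem_nhdsWithin] with δ hδ
      have : δ ≠ 0 := ne_of_gt hδ
      simpa using this
  have hGr : Complex.Gamma (-r) ≠ 0 := Complex.Gamma_ne_zero fun m hm => by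
    have := congrArg Complex.re hm
    simp only [Complex.neg_re, Complex.natCast_re, neg_inj] at this
    have hm0 : m = 0 := by
      have : (m : ℝ) = 0 := le_antisymm (by linarith) (Nat.cast_nonneg m)
      exact_mod_cast this
    rw [hm0] at hm
    exact h0 (by simpa using hm)
  have hslope : Tendsto (fun p : ℂ => p⁻¹ * (Complex.sin (π * (r + p)) - Complex.sin (π * r)))
      (𝓝[≠] 0) (𝓝 (π * Complex.cos (π * r))) := by
    have hd : HasDerivAt (fun z : ℂ => Complex.sin (π * z)) (π * Complex.cos (π * r)) r := by
      have := ((hasDerivAt_id r).const_mul (π : ℂ)).csin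
      simpa [mul_comm] using this
    simpa using hd.tendsto_slope_zero
  have hG : Tendsto (fun p : ℂ => Complex.Gamma (p + 1) * Complex.Gamma (-r - p)) (𝓝[≠] 0)
      (𝓝 (Complex.Gamma (-r))) := by
    have c1 : ContinuousAt (fun p : ℂ => Complex.Gamma (p + 1)) 0 := by
      refine ContinuousAt.comp (f := fun p : ℂ => p + 1) ?_ (by fun_prop)
      exact (Complex.differentiableAt_Gamma _ fun m hm => by
        have := congrArg Complex.re hm
        simp at this
        linarith [(Nat.cast_nonneg m : (0 : ℝ) ≤ m)]).continuousAt
    have c2 : ContinuousAt (fun p : ℂ => Complex.Gamma (-r - p)) 0 := by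
      refine ContinuousAt.comp (f := fun p : ℂ => -r - p) ?_ (by fun_prop)
      exact (Complex.differentiableAt_Gamma _ fun m hm => hGr (by
        rw [sub_zero] at hm
        rw [hm, Complex.Gamma_neg_nat_eq_zero])).continuousAt
    have : Tendsto (fun p : ℂ => Complex.Gamma (p + 1) * Complex.Gamma (-r - p)) (𝓝[≠] 0)
        (𝓝 (Complex.Gamma (0 + 1) * Complex.Gamma (-r - 0))) :=
      (c1.mul c2).tendsto.mono_left nhdsWithin_le_nhds
    simpa using this
  have hmain := ((hG.mul hslope).const_mul (-(Complex.Gamma (-r) * Complex.sin (π * r))⁻¹)).comp hδ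
  have hval : -(Complex.Gamma (-r) * Complex.sin (π * r))⁻¹ *
      (Complex.Gamma (-r) * (π * Complex.cos (π * r))) =
      -(π * Complex.cos (π * r)) / Complex.sin (π * r) := by field_simp
  rw [hval] at hmain
  refine hmain.congr' ?_
  filter_upwards [Ioo_mem_nhdsGT (show (0 : ℝ) < 1 + r.re by linarith)] with δ hδ
  set p : ℂ := -(δ : ℂ) with hp
  have hpre : p.re = -δ := by simp [hp]
  have hp0 : p ≠ 0 := by
    intro h; rw [h] at hpre; simp at hpre; linarith [hδ.1]
  have hs2 : Complex.sin (π * (r + p)) ≠ 0 := sin_pi_mul_ne_zero_of_re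
    (by simp [hpre]; linarith [hδ.2]) (by simp [hpre]; linarith [hδ.1])
    (fun h => by
      have := congrArg Complex.re h
      simp [hpre] at this; linarith [hδ.1])
  have g1 : Complex.Gamma (-r + 1) = -r * Complex.Gamma (-r) :=
    Complex.Gamma_add_one _ (neg_ne_zero.2 h0)
  have hrp0 : r + p + 1 ≠ 0 := fun h => by
    have := congrArg Complex.re h
    simp [hpre] at this; linarith [hδ.2]
  have g2 : Complex.Gamma (r + p + 1 + 1) = (r + p + 1) * Complex.Gamma (r + p + 1) :=
    Complex.Gamma_add_one _ hrp0
  have g3 := Gamma_add_one_mul_Gamma_neg (z := r)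
  have g4 := Gamma_add_one_mul_Gamma_neg (z := r + p)
  rw [show -(r + p) = -r - p by ring] at g4
  have hG4 : Complex.Gamma (r + p + 1) ≠ 0 := by
    intro h; rw [h, zero_mul] at g4
    exact (neg_ne_zero.2 (div_ne_zero hpi hs2)) g4.symm
  have b1 : Complex.betaIntegral (p + 1) (-r - p) =
      Complex.Gamma (p + 1) * Complex.Gamma (-r - p) / (-r * Complex.Gamma (-r)) := by
    rw [Complex.betaIntegral_eq_Gamma_mul_div _ _ (by simp [hpre]; linarith [hδ.2])
      (by simp [hpre]; linarith [hδ.1]), ← g1]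
    ring_nf
  have b2 : Complex.betaIntegral (p + 1) (r + 1) =
      Complex.Gamma (p + 1) * Complex.Gamma (r + 1) / ((r + p + 1) * Complex.Gamma (r + p + 1)) := by
    rw [Complex.betaIntegral_eq_Gamma_mul_div _ _ (by simp [hpre]; linarith [hδ.2])
      (by simp; linarith), ← g2]
    ring_nf
  have g5 : Complex.Gamma (r + 1) * (Complex.Gamma (-r) * Complex.sin (π * r)) = -π := by
    rw [← mul_assoc, g3]; field_simp
  have g6 : Complex.Gamma (r + p + 1) * (Complex.Gamma (-r - p) * Complex.sin (π * (r + p)))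
      = -π := by
    rw [← mul_assoc, g4]; field_simp
  have g7 : Complex.Gamma (r + 1) / Complex.Gamma (r + p + 1) =
      Complex.Gamma (-r - p) * Complex.sin (π * (r + p)) /
        (Complex.Gamma (-r) * Complex.sin (π * r)) := by
    rw [div_eq_div_iff hG4 (mul_ne_zero hGr hsin), g5, ← g6]; ring
  have e2 : (p + r + 1) * Complex.betaIntegral (p + 1) (r + 1) = Complex.Gamma (p + 1) *
      (Complex.Gamma (r + 1) / Complex.Gamma (r + p + 1)) := by
    rw [b2, show p + r + 1 = r + p + 1 by ring]; field_simp
  have e1 : r * Complex.betaIntegral (p + 1) (-r - p) =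
      -(Complex.Gamma (p + 1) * Complex.Gamma (-r - p) / Complex.Gamma (-r)) := by
    rw [b1]; field_simp
  simp only [Function.comp, headVal]
  rw [← hp, e1, e2, g7]
  generalize Complex.sin (π * r) = x at hsin
  field_simp
  ring

lemma tendsto_tail {r : ℂ} (hr : -1 < r.re) (hr0 : r.re ≤ 0) (h0 : r ≠ 0) :
    Tendsto (fun δ : ℝ => Complex.betaIntegral (-(-(δ : ℂ)) - r) (r + 1)) (𝓝[>] 0)
      (𝓝 (-(π / Complex.sin (π * r)))) := by
  have c1 : ContinuousAt (fun δ : ℝ => Complex.Gamma (δ - r)) 0 := by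
    refine ContinuousAt.comp (f := fun δ : ℝ => (δ : ℂ) - r) ?_ (by fun_prop)
    refine (Complex.differentiableAt_Gamma _ fun m hm => ?_).continuousAt
    have := congrArg Complex.re hm
    simp at this
    have hm0 : m = 0 := by
      have : (m : ℝ) = 0 := le_antisymm (by linarith) (Nat.cast_nonneg m)
      exact_mod_cast this
    rw [hm0] at hm
    exact h0 (by simpa using hm)
  have c2 : ContinuousAt (fun δ : ℝ => Complex.Gamma (δ + 1)) 0 := by
    refine ContinuousAt.comp (f := fun δ : ℝ => (δ : ℂ) + 1) ?_ (by fun_prop)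
    exact (Complex.differentiableAt_Gamma _ fun m hm => by
      have := congrArg Complex.re hm
      simp at this
      linarith [(Nat.cast_nonneg m : (0 : ℝ) ≤ m)]).continuousAt
  have h := ((c1.mul_const (Complex.Gamma (r + 1))).div c2 (by simp)).tendsto.mono_left
    (nhdsWithin_le_nhds (s := Ioi 0))
  have hv : Complex.Gamma (((0 : ℝ) : ℂ) - r) * Complex.Gamma (r + 1) /
      Complex.Gamma (((0 : ℝ) : ℂ) + 1) = -(π / Complex.sin (π * r)) := by
    rw [← Gamma_add_one_mul_Gamma_neg]; simp [mul_comm]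
  simp only [Pi.div_apply] at h
  rw [hv] at h
  refine h.congr' ?_
  filter_upwards [self_mem_nhdsWithin] with δ hδ
  have hδ : 0 < δ := hδ
  rw [Complex.betaIntegral_eq_Gamma_mul_div _ _ (by simp; linarith) (by simp; linarith)]
  simp only [Pi.div_apply]
  ring_nf

lemma pi_mul_tan_half {s : ℂ} (h : Complex.sin (π * s) ≠ 0) :
    π * (1 - Complex.cos (π * s)) / Complex.sin (π * s) = π * Complex.tan (π * s / 2) := by
  have e : (π : ℂ) * s = 2 * (π * s / 2) := by ring
  generalize (π : ℂ) * s / 2 = x at e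
  rw [e, Complex.sin_two_mul] at h
  have hs : Complex.sin x ≠ 0 := fun h0 => h (by simp [h0])
  have hc : Complex.cos x ≠ 0 := fun h0 => h (by simp [h0])
  rw [e, Complex.sin_two_mul, Complex.cos_two_mul, Complex.tan_eq_sin_div_cos]
  field_simp
  linear_combination (-2 : ℂ) * Complex.sin_sq_add_cos_sq x

lemma tendsto_mellin_powDiff {s : ℂ} (hs : -1 < s.re) (hs1 : s.re ≤ 1) (h0 : s ≠ 0) (h1 : s ≠ 1) :
    Tendsto (fun δ : ℝ => mellin (powDiff s) (-(δ : ℂ))) (𝓝[>] 0)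
      (𝓝 (π * Complex.tan (π * s / 2))) := by
  rcases le_or_gt s.re 0 with hle | hpos
  · have h := (tendsto_headVal hs hle h0).sub (tendsto_tail hs hle h0)
    rw [← pi_mul_tan_half (sin_pi_mul_ne_zero_of_re hs (by linarith) h0)]
    have e : -(π * Complex.cos (π * s)) / Complex.sin (π * s) - -(π / Complex.sin (π * s)) =
        π * (1 - Complex.cos (π * s)) / Complex.sin (π * s) := by ring
    rw [e] at h
    refine h.congr' ?_
    filter_upwards [Ioo_mem_nhdsGT (zero_lt_one (α := ℝ))] with δ hδ
    have hδ0 : -(δ : ℂ) ≠ 0 := by simpa using hδ.1.ne'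
    exact (mellin_powDiff_of_re hs (by simpa using hδ.2) hδ0 (by simp; linarith [hδ.1])).symm
  · set r := s - 1 with hr
    have hrre : r.re = s.re - 1 := by simp [hr]
    have hr0 : r ≠ 0 := sub_ne_zero.2 h1
    have hr1 : -1 < r.re := by linarith
    have hr2 : r.re ≤ 0 := by linarith
    have hsinr := sin_pi_mul_ne_zero_of_re hr1 (by linarith) hr0
    have es : Complex.sin (π * r) = -Complex.sin (π * s) := by
      rw [hr, mul_sub, mul_one, Complex.sin_sub_pi]
    have ec : Complex.cos (π * r) = -Complex.cos (π * s) := by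
      rw [hr, mul_sub, mul_one, Complex.cos_sub_pi]
    have hsin : Complex.sin (π * s) ≠ 0 := by rw [es] at hsinr; exact neg_ne_zero.1 hsinr
    have h := (tendsto_headVal hr1 hr2 hr0).add (tendsto_tail hr1 hr2 hr0)
    have e : -(π * Complex.cos (π * r)) / Complex.sin (π * r) + -(π / Complex.sin (π * r)) =
        π * (1 - Complex.cos (π * s)) / Complex.sin (π * s) := by
      rw [es, ec]; field_simp; ring
    rw [e, pi_mul_tan_half hsin] at h
    have hc : Tendsto (fun δ : ℝ => s / (-(δ : ℂ) + s)) (𝓝[>] 0) (𝓝 1) := by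
      have : ContinuousAt (fun δ : ℝ => s / (-(δ : ℂ) + s)) 0 := by
        refine ContinuousAt.div (by fun_prop) (by fun_prop) (by simpa using h0)
      simpa [ContinuousAt, h0] using this.tendsto.mono_left nhdsWithin_le_nhds
    have h2 := hc.mul h
    rw [one_mul] at h2
    refine h2.congr' ?_
    filter_upwards [Ioo_mem_nhdsGT hpos, Ioo_mem_nhdsGT (zero_lt_one (α := ℝ))] with δ hδ hδ1
    have hδ0 : -(δ : ℂ) ≠ 0 := by simpa using hδ.1.ne'
    have hds : -(δ : ℂ) + s ≠ 0 := fun h => by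
      have := congrArg Complex.re h
      simp at this; linarith [hδ.2]
    have k1 := mellin_powDiff_of_pos (s := s) (p := -(δ : ℂ)) hpos (by simpa using hδ1.2)
      (by simp; linarith [hδ.1])
    have k2 := mellin_powJump_of_re (r := r) (p := -(δ : ℂ)) hr1 (by simpa using hδ1.2) hδ0
      (by simp; linarith [hδ.1])
    rw [← k2, div_mul_eq_mul_div, div_eq_iff hds, ← k1]; ring

lemma norm_mellin_le {K : ℝ → ℂ} {δ δ₁ ρ B : ℝ} (hδ : 0 < δ) (hδ₁ : δ ≤ δ₁)
    (hK₁ : MellinConvergent K ((δ₁ : ℂ) - 1)) (hρ : 0 < ρ) (hρ1 : ρ ≤ 1)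
    (hB : ∀ κ ∈ Ioo 0 ρ, ‖K κ‖ ≤ B * κ ^ 2) :
    ‖mellin K ((δ : ℂ) - 1)‖ ≤ ∫ κ in Ioi (0 : ℝ), ((Ioo 0 ρ).indicator (fun _ => B) κ
      + ρ ^ (-δ₁) * ‖(κ : ℂ) ^ ((δ₁ : ℂ) - 1 - 1) • K κ‖) := by
  have hint : Integrable ((Ioo 0 ρ).indicator fun _ : ℝ => B) :=
    (integrableOn_const (by simp)).integrable_indicator measurableSet_Ioo
  refine norm_integral_le_of_norm_le (hint.integrableOn.add (hK₁.norm.const_mul _)) ?_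
  filter_upwards [ae_restrict_mem measurableSet_Ioi] with κ hκ
  have hκ : 0 < κ := hκ
  have hn : ∀ t : ℝ, ‖(κ : ℂ) ^ ((t : ℂ) - 1 - 1) • K κ‖ = κ ^ (t - 2) * ‖K κ‖ := by
    intro t
    rw [norm_smul, Complex.norm_cpow_eq_rpow_re_of_pos hκ]
    congr 2; simp; ring
  rw [hn, hn]
  by_cases h : κ < ρ
  · rw [indicator_of_mem (show κ ∈ Ioo 0 ρ from ⟨hκ, h⟩)]
    have h1 : κ ^ (δ - 2) * ‖K κ‖ ≤ B := by
      have hB0 : 0 ≤ B := by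
        have := (norm_nonneg _).trans (hB κ ⟨hκ, h⟩)
        exact nonneg_of_mul_nonneg_left this (by positivity)
      calc κ ^ (δ - 2) * ‖K κ‖ ≤ κ ^ (δ - 2) * (B * κ ^ 2) := by gcongr; exact hB κ ⟨hκ, h⟩
        _ = B * κ ^ δ := by
          rw [Real.rpow_sub hκ, Real.rpow_two]; field_simp
        _ ≤ B * 1 := by
          gcongr; exact Real.rpow_le_one hκ.le (h.le.trans hρ1) hδ.le
        _ = B := mul_one B
    have : 0 ≤ ρ ^ (-δ₁) * (κ ^ (δ₁ - 2) * ‖K κ‖) := by positivity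
    linarith
  · rw [indicator_of_notMem fun hh : κ ∈ Ioo 0 ρ => h hh.2, zero_add, ← mul_assoc]
    gcongr
    have h1 : κ ^ (δ - 2) = κ ^ (δ - δ₁) * κ ^ (δ₁ - 2) := by rw [← Real.rpow_add hκ]; ring_nf
    rw [h1]
    gcongr
    calc κ ^ (δ - δ₁) ≤ ρ ^ (δ - δ₁) :=
          Real.rpow_le_rpow_of_nonpos hρ (not_lt.1 h) (by linarith)
      _ ≤ ρ ^ (-δ₁) := Real.rpow_le_rpow_of_exponent_ge hρ hρ1 (by linarith)

/-- If `K κ = C κ + a κ ^ b + O(κ ^ 2)` near `0`, its Mellin transform has residue `C` at `-1`. -/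
lemma tendsto_mul_mellin {K : ℝ → ℂ} {δ₁ ρ B : ℝ} {a b C : ℂ} (hδ₁ : 0 < δ₁)
    (hK : ∀ δ : ℝ, 0 < δ → δ ≤ δ₁ → MellinConvergent K ((δ : ℂ) - 1)) (hρ : 0 < ρ) (hρ1 : ρ ≤ 1)
    (hb : 1 ≤ b.re) (hb1 : b ≠ 1)
    (hB : ∀ κ ∈ Ioo 0 ρ, ‖K κ - (C * (κ : ℂ) + a * (κ : ℂ) ^ b)‖ ≤ B * κ ^ 2) :
    Tendsto (fun δ : ℝ => (δ : ℂ) * mellin K ((δ : ℂ) - 1)) (𝓝[>] 0) (𝓝 C) := by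
  set K₁ : ℝ → ℂ := fun κ => K κ - (C * (Ioc 0 1).indicator (fun t : ℝ => (t : ℂ) ^ (1 : ℂ)) κ
    + a * (Ioc 0 1).indicator (fun t : ℝ => (t : ℂ) ^ b) κ) with hK₁
  have hmK : ∀ δ : ℝ, 0 < δ → δ ≤ δ₁ → HasMellin K₁ ((δ : ℂ) - 1) (mellin K ((δ : ℂ) - 1)
      - (C * (1 / ((δ : ℂ) - 1 + 1)) + a * (1 / ((δ : ℂ) - 1 + b)))) := fun δ h0 h1 =>
    (hK δ h0 h1).hasMellin.sub (((hasMellin_cpow_Ioc 1 (by simpa using h0)).const_mul C).add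
      ((hasMellin_cpow_Ioc b (by simp; linarith)).const_mul a))
  have hB' : ∀ κ ∈ Ioo 0 ρ, ‖K₁ κ‖ ≤ B * κ ^ 2 := by
    intro κ hκ
    have hm : κ ∈ Ioc (0 : ℝ) 1 := ⟨hκ.1, hκ.2.le.trans hρ1⟩
    simp only [hK₁, indicator_of_mem hm, Complex.cpow_one]
    exact hB κ hκ
  obtain ⟨M, hM⟩ : ∃ M, ∀ δ : ℝ, 0 < δ → δ ≤ δ₁ → ‖mellin K₁ ((δ : ℂ) - 1)‖ ≤ M :=
    ⟨_, fun δ h0 h1 => norm_mellin_le h0 h1 (hmK δ₁ hδ₁ le_rfl).1 hρ hρ1 hB'⟩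
  have hδ0 : Tendsto (fun δ : ℝ => (δ : ℂ)) (𝓝[>] 0) (𝓝 0) := by
    have : ContinuousAt (fun δ : ℝ => (δ : ℂ)) 0 := by fun_prop
    simpa [ContinuousAt] using this.tendsto.mono_left nhdsWithin_le_nhds
  have t1 : Tendsto (fun δ : ℝ => (δ : ℂ) * mellin K₁ ((δ : ℂ) - 1)) (𝓝[>] 0) (𝓝 0) := by
    refine hδ0.zero_mul_isBoundedUnder_le ?_
    refine isBoundedUnder_of_eventually_le (a := M) ?_
    filter_upwards [Ioo_mem_nhdsGT hδ₁] with δ hδ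
    exact hM δ hδ.1 hδ.2.le
  have hb0 : (0 : ℂ) - 1 + b ≠ 0 := fun h => hb1 (by linear_combination h)
  have t2 : Tendsto (fun δ : ℝ => (δ : ℂ) * (a * (1 / ((δ : ℂ) - 1 + b)))) (𝓝[>] 0)
      (𝓝 (0 * (a * (1 / ((0 : ℂ) - 1 + b))))) :=
    hδ0.mul (((((hδ0.sub_const 1).add_const b).inv₀ hb0).congr fun δ => by
      rw [one_div]).const_mul a |>.trans (by rw [one_div]))
  have t3 := (t1.add t2).add_const C
  simp only [zero_mul, zero_add] at t3
  refine t3.congr' ?_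
  filter_upwards [Ioo_mem_nhdsGT hδ₁] with δ hδ
  rw [(hmK δ hδ.1 hδ.2.le).2]
  have : (δ : ℂ) ≠ 0 := by exact_mod_cast hδ.1.ne'
  rw [sub_add_cancel]
  field_simp
  ring

lemma hasMellin_comp_div {f : ℝ → ℂ} {p : ℂ} {x : ℝ} (heven : ∀ y, f (-y) = f y) (hx : x ≠ 0)
    (h : MellinConvergent f p) :
    HasMellin (fun κ => f (x / κ)) (-p) (evenPow (-p) x * mellin f p) := by
  have hx' : 0 < |x| := abs_pos.2 hx
  have e : (fun κ : ℝ => f (x / κ)) = fun κ => (fun t => f (|x| * t)) κ⁻¹ := by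
    funext κ
    rcases abs_choice x with h | h <;> simp [h, div_eq_mul_inv, heven]
  have h1 : MellinConvergent (fun κ : ℝ => (fun t => f (|x| * t)) (κ ^ (-1 : ℝ))) (-p) :=
    (MellinConvergent.comp_rpow (by norm_num)).2
      ((MellinConvergent.comp_mul_left hx').2 (by simpa [div_neg] using h))
  rw [e]
  refine ⟨by simpa only [Real.rpow_neg_one] using h1, ?_⟩
  rw [mellin_comp_inv (fun t => f (|x| * t)), neg_neg, mellin_comp_mul_left _ _ hx', ← evenPow_eq_cpow _ hx', evenPow_abs,
    smul_eq_mul]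

lemma ofReal_norm_cpow_smul {t : ℝ} (ht : 0 < t) (w z : ℂ) :
    ((‖(t : ℂ) ^ w • z‖ : ℝ) : ℂ) = (t : ℂ) ^ (w.re : ℂ) * ‖z‖ := by
  rw [norm_smul, Complex.norm_cpow_eq_rpow_re_of_pos ht, Complex.ofReal_mul,
    Complex.ofReal_cpow ht.le]

lemma MellinConvergent.ofReal_norm {f : ℝ → ℂ} {p : ℂ} (h : MellinConvergent f p) :
    MellinConvergent (fun t => ((‖f t‖ : ℝ) : ℂ)) (p.re : ℂ) := by
  have h1 : IntegrableOn (fun t : ℝ => ((‖(t : ℂ) ^ (p - 1) • f t‖ : ℝ) : ℂ)) (Ioi 0) :=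
    h.norm.ofReal
  refine h1.congr_fun (fun t ht => ?_) measurableSet_Ioi
  simp only [ofReal_norm_cpow_smul ht]
  simp

lemma integral_norm_cpow_smul_comp_div {f : ℝ → ℂ} {p : ℂ} {x : ℝ} (heven : ∀ y, f (-y) = f y)
    (hx : x ≠ 0) (h : MellinConvergent f p) :
    ((∫ κ in Ioi (0 : ℝ), ‖(κ : ℂ) ^ (-p - 1) • f (x / κ)‖ : ℝ) : ℂ) =
      evenPow (-(p.re : ℂ)) x * mellin (fun t => ((‖f t‖ : ℝ) : ℂ)) (p.re : ℂ) := by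
  rw [← (hasMellin_comp_div (by simp [heven]) hx h.ofReal_norm).2, ← integral_complex_ofReal]
  refine setIntegral_congr_fun measurableSet_Ioi fun t ht => ?_
  simp only [ofReal_norm_cpow_smul ht]
  simp

lemma hasMellin_integral_prodLaw {f : ℝ → ℂ} {p : ℂ} (hm : Measurable f)
    (heven : ∀ y, f (-y) = f y) (h : MellinConvergent f p) (hp : p.re < 1) :
    HasMellin (fun κ => ∫ x, f (x / κ) ∂prodLaw) (-p) (arcMoment (-p) ^ 2 * mellin f p) := by
  set F : ℝ → ℝ → ℂ := fun x κ => (κ : ℂ) ^ (-p - 1) • f (x / κ) with hF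
  have hmeas : Measurable (Function.uncurry F) := by
    simp only [hF, Function.uncurry_def]
    exact Measurable.smul ((Complex.measurable_ofReal.comp measurable_snd).pow_const _)
      (hm.comp (measurable_fst.div measurable_snd))
  have hint : Integrable (Function.uncurry F) (prodLaw.prod (volume.restrict (Ioi 0))) := by
    rw [integrable_prod_iff hmeas.aestronglyMeasurable]
    constructor
    · filter_upwards [ae_prodLaw_ne_zero] with x hx
      exact (hasMellin_comp_div heven hx h).1
    · have h1 := ((integrable_evenPow_prodLaw (w := -(p.re : ℂ)) (by simpa using by linarith)).mul_const
        (mellin (fun t => ((‖f t‖ : ℝ) : ℂ)) (p.re : ℂ))).re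
      refine h1.congr ?_
      filter_upwards [ae_prodLaw_ne_zero] with x hx
      rw [← integral_norm_cpow_smul_comp_div heven hx h]
      rfl
  have hsw := integral_integral_swap hint
  constructor
  · refine Integrable.congr hint.integral_prod_right (Eventually.of_forall fun κ => ?_)
    exact integral_smul (μ := prodLaw) ((κ : ℂ) ^ (-p - 1)) fun x => f (x / κ)
  · rw [mellin]
    simp_rw [← integral_smul]
    rw [← hsw, ← integral_evenPow_prodLaw (by simpa using by linarith), ← integral_mul_const]
    refine integral_congr_ae ?_
    filter_upwards [ae_prodLaw_ne_zero] with x hx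
    exact (hasMellin_comp_div heven hx h).2

lemma powMid_neg (s : ℂ) (v : ℝ) : powMid s (-v) = powMid s v := by
  rw [powMid, powMid, evenPow_neg, sub_neg_eq_add, ← sub_eq_add_neg, add_comm]

lemma measurable_powMid (s : ℂ) : Measurable (powMid s) :=
  ((((measurable_evenPow s).comp (by fun_prop)).add ((measurable_evenPow s).comp (by fun_prop))).div_const
    2).sub (measurable_evenPow s)

/-- `E powMid s (X / κ)` for `X` the product of two independent cosines. -/
noncomputable def midMean (s : ℂ) (κ : ℝ) : ℂ := ∫ x, powMid s (x / κ) ∂prodLaw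

lemma hasMellin_midMean {s : ℂ} (hs : -1 < s.re) {δ : ℝ} (h0 : 0 < δ) (h1 : δ < 1)
    (h2 : δ < 1 + s.re) (hs1 : s.re ≤ 1) :
    HasMellin (midMean s) ((δ : ℂ) - 1)
      (arcMoment ((δ : ℂ) - 1) ^ 2 * mellin (powMid s) (1 - δ)) := by
  have := hasMellin_integral_prodLaw (measurable_powMid s) (powMid_neg s) (p := 1 - δ)
    (mellinConvergent_powMid hs (by simpa using h1) (by simp; linarith) (by simp; linarith))
    (by simpa using h0)
  rwa [neg_sub] at this

lemma integrable_evenPow_add {s : ℂ} (hs : -1 < s.re) {κ : ℝ} (hκ : κ ∈ Ioo (0 : ℝ) 1) :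
    Integrable (fun x => evenPow s (κ + x)) prodLaw := by
  rcases lt_or_ge 0 s.re with h | h
  · exact integrable_prodLaw ((continuous_evenPow h).comp (by fun_prop))
  · obtain ⟨C, hC⟩ := exists_hasExpansion_add_two (s := (s.re : ℂ)) (by simpa using hs)
      (ofReal_not_odd hs h)
    refine (integrable_of_hasDerivAt_oddMean hs (hC.hasDerivAt_oddMean (by simpa using hs)
      (ofReal_not_odd hs h) hκ)).mono'
      ((measurable_evenPow s).comp (by fun_prop)).aestronglyMeasurable
      (Eventually.of_forall fun x => norm_evenPow_le s _)

lemma evenPow_mul_midMean {s : ℂ} (hs : -1 < s.re) {κ : ℝ} (hκ : κ ∈ Ioo (0 : ℝ) 1) :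
    evenPow s κ * midMean s κ = evenMean s κ - arcMoment s ^ 2 := by
  have hm : Measurable fun x => evenPow s (κ + x) := (measurable_evenPow s).comp (by fun_prop)
  have h1 := integrable_evenPow_add hs hκ
  have h2 : Integrable (fun x => evenPow s (κ - x)) prodLaw := by
    have h3 := h1
    rw [← map_neg_prodLaw, integrable_map_measure hm.aestronglyMeasurable (by fun_prop)] at h3
    exact h3
  have e2 : ∫ x, evenPow s (κ - x) ∂prodLaw = evenMean s κ := by
    rw [evenMean, ← integral_prodLaw_neg hm]; rfl
  have key : ∀ x, evenPow s κ * powMid s (x / κ) =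
      (evenPow s (κ + x) + evenPow s (κ - x)) / 2 - evenPow s x := by
    intro x
    have e3 : κ + x = κ * (1 + x / κ) := by have := hκ.1.ne'; field_simp
    have e4 : κ - x = κ * (1 - x / κ) := by have := hκ.1.ne'; field_simp
    have e5 : evenPow s x = evenPow s κ * evenPow s (x / κ) := by
      rw [← evenPow_mul, mul_div_cancel₀ _ hκ.1.ne']
    rw [e3, e4, evenPow_mul, evenPow_mul, e5, powMid]; ring
  rw [midMean, ← integral_const_mul]
  simp_rw [key]
  have h12 : Integrable (fun x => (evenPow s (κ + x) + evenPow s (κ - x)) / 2) prodLaw :=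
    (h1.add h2).div_const 2
  rw [integral_sub h12 (integrable_evenPow_prodLaw hs), integral_div,
    integral_add h1 h2, e2, integral_evenPow_prodLaw hs, evenMean]
  ring

lemma HasExpansion.midMean_bound {s C : ℂ} (h : HasExpansion s C) (hs : -1 < s.re)
    (hs1 : s.re ≤ 1) (hodd : ∀ n : ℤ, s ≠ 2 * n + 1) :
    ∃ B : ℝ, ∀ κ ∈ Ioo (0 : ℝ) (1 / 2), ‖midMean s κ - (C * (κ : ℂ)
      + arcMoment s ^ 2 * regCoef s 1 * (κ : ℂ) ^ (2 - s))‖ ≤ B * κ ^ 2 := by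
  have hr := unitSummable_regCoef hodd
  have hg := unitSummable_singCoef hs
  obtain ⟨B₁, hB₁, hb₁⟩ := powSer_bound ((hr.shift 1).shift 1) (0 + 2 + 2) (ρ := 1 / 2)
    (by norm_num) (by norm_num)
  obtain ⟨B₂, hB₂, hb₂⟩ := powSer_bound (hg.shift 1) (s + 1 + 2) (ρ := 1 / 2)
    (by norm_num) (by norm_num)
  refine ⟨‖arcMoment s ^ 2‖ * B₁ + ‖C‖ * B₂, fun κ hκ => ?_⟩
  have h0 : 0 < κ := hκ.1
  have h1 : κ < 1 := hκ.2.trans (by norm_num)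
  have e1 := evenPow_mul_midMean hs ⟨h0, h1⟩
  rw [h κ ⟨h0, h1⟩, powSer_eq_head_add hr 0 h0 h1, powSer_eq_head_add (hr.shift 1) (0 + 2) h0 h1,
    powSer_eq_head_add hg (s + 1) h0 h1] at e1
  specialize hb₁ κ h0 hκ.2.le
  specialize hb₂ κ h0 hκ.2.le
  set R₁ := powSer (fun n => regCoef s (n + 1 + 1)) (0 + 2 + 2) κ
  set R₂ := powSer (fun n => singCoef s (n + 1)) (s + 1 + 2) κ
  have hinv : evenPow (-s) κ * evenPow s κ = 1 := by
    rw [← evenPow_add h0.ne', neg_add_cancel, evenPow_exp_zero h0.ne']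
  have p1 : evenPow (-s) κ * evenPow (0 + 2) κ = (κ : ℂ) ^ (2 - s) := by
    rw [← evenPow_add h0.ne', evenPow_eq_cpow _ h0]; ring_nf
  have p2 : evenPow (-s) κ * evenPow (s + 1) κ = κ := by
    rw [← evenPow_add h0.ne', evenPow_eq_cpow _ h0]; ring_nf; exact Complex.cpow_one _
  have c0 : regCoef s 0 = 1 := hypCoef_zero _ _ _
  have c1 : singCoef s 0 = 1 := hypCoef_zero _ _ _
  rw [c0, c1, evenPow_exp_zero h0.ne'] at e1
  have e2 : midMean s κ - (C * (κ : ℂ) + arcMoment s ^ 2 * regCoef s 1 * (κ : ℂ) ^ (2 - s)) =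
      evenPow (-s) κ * (arcMoment s ^ 2 * R₁ + C * R₂) := by
    rw [← p1, ← p2]
    have e3 : midMean s κ = evenPow (-s) κ * (evenPow s κ * midMean s κ) := by
      rw [← mul_assoc, hinv, one_mul]
    rw [e3, e1]
    simp only [zero_add]
    ring
  rw [e2, norm_mul, norm_evenPow_of_ne h0.ne', abs_of_pos h0]
  have q1 : κ ^ (-s).re * κ ^ ((0 : ℂ) + 2 + 2).re ≤ κ ^ 2 := by
    rw [← Real.rpow_add h0, ← Real.rpow_two]
    exact Real.rpow_le_rpow_of_exponent_ge h0 h1.le (by simp; linarith)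
  have q2 : κ ^ (-s).re * κ ^ (s + 1 + 2).re ≤ κ ^ 2 := by
    rw [← Real.rpow_add h0, ← Real.rpow_two]
    exact Real.rpow_le_rpow_of_exponent_ge h0 h1.le (by simp)
  calc κ ^ (-s).re * ‖arcMoment s ^ 2 * R₁ + C * R₂‖
      ≤ κ ^ (-s).re * (‖arcMoment s ^ 2‖ * (B₁ * κ ^ ((0 : ℂ) + 2 + 2).re)
        + ‖C‖ * (B₂ * κ ^ (s + 1 + 2).re)) := by
        gcongr
        refine (norm_add_le _ _).trans ?_
        rw [norm_mul, norm_mul]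
        gcongr
    _ = ‖arcMoment s ^ 2‖ * B₁ * (κ ^ (-s).re * κ ^ ((0 : ℂ) + 2 + 2).re)
        + ‖C‖ * B₂ * (κ ^ (-s).re * κ ^ (s + 1 + 2).re) := by ring
    _ ≤ ‖arcMoment s ^ 2‖ * B₁ * κ ^ 2 + ‖C‖ * B₂ * κ ^ 2 := by gcongr
    _ = _ := by ring

lemma tendsto_mul_arcMoment :
    Tendsto (fun δ : ℝ => (δ : ℂ) * arcMoment ((δ : ℂ) - 1)) (𝓝[>] 0) (𝓝 (2 / π)) := by
  have hδ0 : Tendsto (fun δ : ℝ => (δ : ℂ)) (𝓝[>] 0) (𝓝 0) := by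
    have : ContinuousAt (fun δ : ℝ => (δ : ℂ)) 0 := by fun_prop
    simpa [ContinuousAt] using this.tendsto.mono_left nhdsWithin_le_nhds
  have hg : Complex.Gamma (1 / 2) ≠ 0 := Complex.Gamma_ne_zero_of_re_pos (by norm_num)
  have hG : ContinuousAt (fun z : ℂ => 2 * Complex.Gamma (z / 2 + 1) /
      (Complex.Gamma (1 / 2) * Complex.Gamma ((z - 1) / 2 + 1))) 0 := by
    have c1 : ContinuousAt (fun z : ℂ => Complex.Gamma (z / 2 + 1)) 0 := by
      refine ContinuousAt.comp (g := Complex.Gamma)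
        (Complex.differentiableAt_Gamma _ fun m hm => ?_).continuousAt (by fun_prop)
      have := congrArg Complex.re hm
      simp at this; have : (0 : ℝ) ≤ m := by positivity
      linarith
    have c2 : ContinuousAt (fun z : ℂ => Complex.Gamma ((z - 1) / 2 + 1)) 0 := by
      refine ContinuousAt.comp (g := Complex.Gamma)
        (Complex.differentiableAt_Gamma _ fun m hm => ?_).continuousAt (by fun_prop)
      have := congrArg Complex.re hm
      norm_num at this; have : (0 : ℝ) ≤ m := by positivity
      linarith
    refine (continuousAt_const.mul c1).div (continuousAt_const.mul c2) (mul_ne_zero hg ?_)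
    convert hg using 2; norm_num
  have h := hG.tendsto.comp hδ0
  have hv : 2 * Complex.Gamma (0 / 2 + 1) /
      (Complex.Gamma (1 / 2) * Complex.Gamma ((0 - 1) / 2 + 1)) = 2 / π := by
    rw [show ((0 : ℂ) - 1) / 2 + 1 = 1 / 2 by norm_num, zero_div, zero_add, Complex.Gamma_one,
      ← sq, complex_Gamma_half_sq, mul_one]
  rw [hv] at h
  refine h.congr' ?_
  filter_upwards [self_mem_nhdsWithin] with δ hδ
  have hδ : (δ : ℂ) ≠ 0 := by exact_mod_cast (ne_of_gt hδ)
  simp only [Function.comp, arcMoment]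
  rw [Complex.Gamma_add_one _ (div_ne_zero hδ two_ne_zero), sub_add_cancel]
  ring

lemma HasExpansion.eq_of_re_le_one {s C : ℂ} (h : HasExpansion s C) (hs : -1 < s.re)
    (hs1 : s.re ≤ 1) (h0 : s ≠ 0) (hodd : ∀ n : ℤ, s ≠ 2 * n + 1) :
    C = 2 / π * Complex.tan (π * s / 2) / (s + 1) := by
  have hne1 : s ≠ 1 := by simpa using hodd 0
  have hsp : s + 1 ≠ 0 := by exact_mod_cast add_ne_zero_of_re (c := 1) hs
  obtain ⟨B, hB⟩ := h.midMean_bound hs hs1 hodd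
  obtain ⟨δ₁, hδ0, hδ1⟩ : ∃ δ₁ : ℝ, 0 < δ₁ ∧ δ₁ < min 1 (1 + s.re) :=
    exists_between (lt_min one_pos (by linarith))
  obtain ⟨hd1, hd2⟩ := lt_min_iff.1 hδ1
  have hM : ∀ δ : ℝ, 0 < δ → δ ≤ δ₁ → HasMellin (midMean s) ((δ : ℂ) - 1)
      (arcMoment ((δ : ℂ) - 1) ^ 2 * mellin (powMid s) (1 - δ)) := fun δ h h' =>
    hasMellin_midMean hs h (by linarith) (by linarith) hs1
  have t1 := tendsto_mul_mellin hδ0 (fun δ h h' => (hM δ h h').1) (by norm_num) (by norm_num)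
    (b := 2 - s) (by simp; linarith) (fun hh => hne1 (by linear_combination -hh)) hB
  have hδ0' : Tendsto (fun δ : ℝ => (δ : ℂ)) (𝓝[>] 0) (𝓝 0) := by
    have : ContinuousAt (fun δ : ℝ => (δ : ℂ)) 0 := by fun_prop
    simpa [ContinuousAt] using this.tendsto.mono_left nhdsWithin_le_nhds
  have hden : 2 * (s + 1 - 0) ≠ 0 := by simpa using hsp
  have t2 := (tendsto_mul_arcMoment.pow 2).mul ((tendsto_mellin_powDiff hs hs1 h0 hne1).div
    ((hδ0'.const_sub (s + 1)).const_mul 2) hden)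
  have t3 : Tendsto (fun δ : ℝ => (δ : ℂ) * mellin (midMean s) ((δ : ℂ) - 1)) (𝓝[>] 0)
      (𝓝 ((2 / π) ^ 2 * (π * Complex.tan (π * s / 2) / (2 * (s + 1 - 0))))) := by
    refine t2.congr' ?_
    filter_upwards [Ioo_mem_nhdsGT hδ0] with δ hδ
    rw [(hM δ hδ.1 hδ.2.le).2]
    have hmid := mellin_powMid (s := s) (p := -(δ : ℂ)) hs (by simp; linarith [hδ.2])
      (by simp; linarith [hδ.2]) (by simp; linarith [hδ.1])
    rw [neg_add_eq_sub (δ : ℂ) 1] at hmid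
    have hne : s + 1 - δ ≠ 0 := by
      have := add_ne_zero_of_re (s := s) (c := 1 - δ) (by linarith [hδ.2])
      intro hh; apply this; push_cast; linear_combination hh
    simp only [Pi.div_apply]
    rw [mul_div_assoc', div_eq_iff (mul_ne_zero two_ne_zero hne)]
    linear_combination (-(δ : ℂ) * arcMoment (δ - 1) ^ 2) * hmid
  rw [tendsto_nhds_unique t1 t3]
  have hpi : (π : ℂ) ≠ 0 := by exact_mod_cast Real.pi_ne_zero
  rw [sub_zero]
  field_simp

lemma hasExpansion_zero : HasExpansion 0 0 := by
  intro κ hκ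
  have h1 : evenMean 0 κ = 1 := by
    rw [evenMean, integral_congr_ae (g := fun _ => (1 : ℂ))]
    · simp
    · filter_upwards [ae_prodLaw_ne (-κ)] with x hx
      exact evenPow_exp_zero fun hh => hx (by linarith)
  have h2 : ∀ n : ℕ, regCoef 0 (n + 1) = 0 := by
    intro n
    simp [regCoef, hypCoef, poch]
  rw [h1, arcMoment_zero, powSer, tsum_eq_single 0]
  · simp [regCoef, hypCoef_zero, evenPow_exp_zero hκ.1.ne']
  · intro n hn
    obtain ⟨m, rfl⟩ := Nat.exists_eq_succ_of_ne_zero hn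
    simp [h2]

lemma hasExpansion_tan_of_re_le (n : ℕ) : ∀ {s : ℂ}, -1 < s.re → s.re ≤ 1 + 2 * n →
    (∀ n : ℤ, s ≠ 2 * n + 1) →
    HasExpansion s (2 / π * Complex.tan (π * s / 2) / (s + 1)) := by
  induction n with
  | zero =>
    intro s hs hs1 hodd
    rcases eq_or_ne s 0 with rfl | h0
    · simpa using hasExpansion_zero
    · obtain ⟨C, hC⟩ := exists_hasExpansion hs hodd
      rwa [← hC.eq_of_re_le_one hs (by simpa using hs1) h0 hodd]
  | succ n ih =>
    intro s hs hs1 hodd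
    rcases le_or_gt s.re 1 with h | h
    · exact ih hs (by have : (0 : ℝ) ≤ n := by positivity
                      linarith) hodd
    · have hodd' : ∀ n : ℤ, s - 2 ≠ 2 * n + 1 := fun n h =>
        hodd (n + 1) (by push_cast; linear_combination h)
      have := (ih (s := s - 2) (by simp; linarith) (by push_cast at hs1; simp; linarith) hodd').up
        (by simp; linarith) hodd'
      have e : (π : ℂ) * (s - 2) / 2 = π * s / 2 - π := by ring
      rwa [e, Complex.tan_sub_pi, sub_add_cancel, show s - 2 + 3 = s + 1 by ring] at this

lemma hasExpansion_tan {s : ℂ} (hs : -1 < s.re) (hodd : ∀ n : ℤ, s ≠ 2 * n + 1) :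
    HasExpansion s (2 / π * Complex.tan (π * s / 2) / (s + 1)) := by
  obtain ⟨n, hn⟩ := exists_nat_ge s.re
  exact hasExpansion_tan_of_re_le n hs
    (by have : (0 : ℝ) ≤ n := by positivity
        linarith) hodd

end

lemma integral_arcLaw_prod (g : ℝ × ℝ → ℂ) (hg : Measurable g) :
    ∫ q, g q ∂(arcLaw.prod arcLaw) = ((2 * π : ℝ) : ℂ)⁻¹ ^ 2 *
      ∫ θ : Fin 2 → ℝ in Set.univ.pi fun _ => Set.Icc 0 (2 * π),
        g (Real.cos (θ 0), Real.cos (θ 1)) := by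
  have hc : ENNReal.ofReal (2 * π) ≠ 0 := by simp [Real.pi_pos]
  have e1 : arcLaw.prod arcLaw = Measure.map (Prod.map Real.cos Real.cos)
      ((ENNReal.ofReal (2 * π))⁻¹ • (ENNReal.ofReal (2 * π))⁻¹ •
        (volume.restrict (Set.Icc 0 (2 * π) ×ˢ Set.Icc 0 (2 * π)) : Measure (ℝ × ℝ))) := by
    rw [arcLaw, restrict_Ioc_eq_restrict_Icc, Measure.map_smul,
      Measure.prod_smul_left, Measure.prod_smul_right,
      Measure.map_prod_map _ _ Real.measurable_cos Real.measurable_cos, Measure.prod_restrict,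
      Measure.map_smul, Measure.map_smul, Measure.volume_eq_prod]
  have e2 : (Set.univ.pi fun _ : Fin 2 => Set.Icc 0 (2 * π)) =
      MeasurableEquiv.finTwoArrow ⁻¹' (Set.Icc 0 (2 * π) ×ˢ Set.Icc 0 (2 * π)) := by
    ext θ; simp [MeasurableEquiv.finTwoArrow, Pi.le_def, Fin.forall_fin_two, and_assoc]
  have e3 := (volume_preserving_finTwoArrow ℝ).setIntegral_preimage_emb
    (MeasurableEquiv.measurableEmbedding _)
    (fun q : ℝ × ℝ => g (Real.cos q.1, Real.cos q.2)) (Set.Icc 0 (2 * π) ×ˢ Set.Icc 0 (2 * π))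
  rw [e1, integral_map (by fun_prop) hg.aestronglyMeasurable, integral_smul_measure,
    integral_smul_measure, e2]
  simp only [ENNReal.toReal_inv, ENNReal.toReal_ofReal (by positivity : 0 ≤ 2 * π)]
  rw [← Complex.ofReal_inv, Complex.real_smul, Complex.real_smul, ← mul_assoc, ← sq]
  congr 1
  exact e3.symm

lemma Wr_two_eq_evenMean (k : ℝ) (s : ℂ) : Wr 2 k s = evenPow s 4 * evenMean s (k / 4) := by
  have hm : Measurable fun x => evenPow s (k / 4 + x) := (measurable_evenPow s).comp (by fun_prop)
  have hm2 : Measurable fun q : ℝ × ℝ => evenPow s (k / 4 + q.1 * q.2) :=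
    (measurable_evenPow s).comp (by fun_prop)
  rw [evenMean, prodLaw, integral_map (by fun_prop) hm.aestronglyMeasurable,
    integral_arcLaw_prod _ hm2, Wr,
    mul_left_comm, ← integral_const_mul (evenPow s 4)]
  congr 1
  refine integral_congr_ae (Filter.Eventually.of_forall fun θ => ?_)
  simp only
  rw [← evenPow_mul, Fin.prod_univ_two, ← evenPow_abs, evenPow, abs_abs]
  congr 2
  ring

lemma evenPow_four_mul_arcMoment_sq {s : ℂ} (hs : -1 < s.re) :
    evenPow s 4 * arcMoment s ^ 2 = Complex.Gamma (s + 1) ^ 2 / Complex.Gamma (s / 2 + 1) ^ 4 := by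
  have hg : Complex.Gamma (s / 2 + 1) ≠ 0 :=
    Complex.Gamma_ne_zero_of_re_pos (by
      have : (s / 2).re = s.re / 2 := by simp
      rw [Complex.add_re, this, Complex.one_re]; linarith)
  have hg1 : Complex.Gamma (1 / 2) ≠ 0 := Complex.Gamma_ne_zero_of_re_pos (by norm_num)
  have h := Complex.Gamma_mul_Gamma_add_half ((s + 1) / 2)
  have e1 : (s + 1) / 2 + 1 / 2 = s / 2 + 1 := by ring
  have e2 : 2 * ((s + 1) / 2) = s + 1 := by ring
  have e3 : (1 : ℂ) - (s + 1) = -s := by ring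
  have e4 : (2 : ℂ) ^ (-s) = evenPow (-s) 2 := by
    rw [evenPow_eq_cpow _ two_pos]; norm_num
  have e5 : ((√π : ℝ) : ℂ) ^ 2 = Complex.Gamma (1 / 2) ^ 2 := by
    rw [complex_Gamma_half_sq, ← Complex.ofReal_pow, Real.sq_sqrt Real.pi_pos.le]
  have e6 : evenPow s 4 = evenPow s 2 ^ 2 := by
    rw [sq, ← evenPow_mul]; norm_num
  have e7 : evenPow s 2 * evenPow (-s) 2 = 1 := by
    rw [← evenPow_add two_ne_zero, add_neg_cancel, evenPow_exp_zero two_ne_zero]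
  rw [e1, e2, e3, e4] at h
  have h2 : Complex.Gamma ((s + 1) / 2) ^ 2 * Complex.Gamma (s / 2 + 1) ^ 2 =
      Complex.Gamma (s + 1) ^ 2 * evenPow (-s) 2 ^ 2 * Complex.Gamma (1 / 2) ^ 2 := by
    rw [← mul_pow, h, ← e5]; ring
  rw [arcMoment, e6, div_pow, mul_div_assoc', div_eq_div_iff (by positivity) (by positivity)]
  have h3 : evenPow s 2 ^ 2 * evenPow (-s) 2 ^ 2 = 1 := by rw [← mul_pow, e7, one_pow]
  linear_combination (evenPow s 2 ^ 2 * Complex.Gamma (s / 2 + 1) ^ 2) * h2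
    + Complex.Gamma (s + 1) ^ 2 * Complex.Gamma (1 / 2) ^ 2 * Complex.Gamma (s / 2 + 1) ^ 2 * h3

lemma hyp3F2_zero (a1 a2 a3 b1 b2 : ℂ) : hyp3F2 a1 a2 a3 b1 b2 0 = 1 := by
  rw [hyp3F2, tsum_eq_single 0]
  · simp [poch]
  · intro n hn; simp [hn]

/-- For `|k| < 4`, `Re(s) > −1`, `s` not an odd integer:
`W₂(k;s) = (1/(2π))·(tan(πs/2)/(s+1))·|k|^{1+s}·₃F₂(1/2,1/2,1/2; 1+s/2, 3/2+s/2; k²/16)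
 + (Γ(s+1)²/Γ(s/2+1)⁴)·₃F₂(−s/2,−s/2,−s/2; (1−s)/2, 1/2; k²/16)`. -/
theorem stmt8 (k : ℝ) (hk : |k| < 4) (s : ℂ) (hs : -1 < s.re)
    (hodd : ∀ n : ℤ, s ≠ 2 * n + 1) :
    Wr 2 k s =
      ((2 * Real.pi : ℝ) : ℂ)⁻¹ * (Complex.tan ((Real.pi : ℂ) * s / 2) / (s + 1)) *
          cpow0 |k| (1 + s) *
          hyp3F2 (1/2) (1/2) (1/2) (1 + s/2) (3/2 + s/2) ((k : ℂ) ^ 2 / 16) +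
        (Complex.Gamma (s + 1) ^ 2 / Complex.Gamma (s/2 + 1) ^ 4) *
          hyp3F2 (-s/2) (-s/2) (-s/2) ((1 - s)/2) (1/2) ((k : ℂ) ^ 2 / 16) := by
  rw [Wr_two_eq_evenMean, ← evenPow_four_mul_arcMoment_sq hs]
  rcases eq_or_ne k 0 with rfl | hk0
  · simp [evenMean_zero hs, cpow0, hyp3F2_zero]
  have hκ0 : 0 < |k| / 4 := by positivity
  have hκ : |k| / 4 ∈ Set.Ioo (0 : ℝ) 1 := ⟨hκ0, by linarith⟩
  have hsq : (((|k| / 4 : ℝ) : ℂ)) ^ 2 = (k : ℂ) ^ 2 / 16 := by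
    rw [← Complex.ofReal_pow, div_pow, sq_abs]; push_cast; ring
  have hpow : cpow0 |k| (1 + s) = evenPow s 4 * 4 * evenPow (s + 1) (|k| / 4) := by
    have e1 : evenPow (s + 1) 4 = evenPow s 4 * 4 := by
      rw [evenPow_add four_ne_zero, evenPow_eq_cpow 1 four_pos]; simp
    rw [← e1, ← evenPow_mul, mul_div_cancel₀ _ four_ne_zero, evenPow_abs, evenPow, add_comm]
  have hmean : evenMean s (k / 4) = evenMean s (|k| / 4) := by
    rw [← evenMean_abs, abs_div, abs_of_pos (four_pos (α := ℝ))]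
  have hpi : (π : ℂ) ≠ 0 := by exact_mod_cast Real.pi_ne_zero
  have hs1 : s + 1 ≠ 0 := by exact_mod_cast add_ne_zero_of_re (c := 1) hs
  rw [hmean, hasExpansion_tan hs hodd _ hκ, regCoef, singCoef, powSer_hypCoef _ _ _ _ hκ0.ne',
    powSer_hypCoef _ _ _ _ hκ0.ne', hsq, hpow, evenPow_exp_zero hκ0.ne']
  push_cast
  field_simp
  ring
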